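/- arXiv:1002.1829 — 2 statements merged into one kernel-verified Lean document; each statement's English description precedes it below -/
import Mathlib

section
/- Let d ≥ 2, a > 0, and let μ be the measure on ℝ^d with density e^{v(|x|)} with respect to Lebesgue measure, where v(r) = r^{a+1}/(a+1) (so v'(r) = r^a). Set r_0 = ((d+2)/a)^{1/(a+1)}. Then for every r ≥ r_0 and every bounded open set A ⊂ ℝ^d with smooth boundary satisfying μ(A) = μ(B_r), one has μ⁺(∂A) ≥ μ⁺(∂B_r). -/
open MeasureTheory Metric Filter Set
open scoped ENNReal

/-- The (lower outer) surface measure `μ⁺(∂A) = liminf_{ε→0⁺} (μ(A^ε) − μ(A))/ε`,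
where `A^ε` is the open `ε`-neighborhood of `A`. -/
noncomputable def surfaceMeasure {X : Type*} [PseudoEMetricSpace X] [MeasurableSpace X]
    (μ : Measure X) (A : Set X) : ℝ≥0∞ :=
  Filter.liminf (fun ε : ℝ => (μ (Metric.thickening ε A) - μ A) / ENNReal.ofReal ε)
    (nhdsWithin 0 (Set.Ioi 0))

/-- `A` has smooth boundary: near every boundary point, `A` is the sublevel set of a
smooth function with nonvanishing differential. -/
def HasSmoothBoundary {d : ℕ} (A : Set (EuclideanSpace ℝ (Fin d))) : Prop :=
  ∀ x ∈ frontier A, ∃ U : Set (EuclideanSpace ℝ (Fin d)), IsOpen U ∧ x ∈ U ∧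
    ∃ g : EuclideanSpace ℝ (Fin d) → ℝ, ContDiff ℝ (⊤ : ℕ∞) g ∧ (∀ y ∈ U, fderiv ℝ g y ≠ 0) ∧
      A ∩ U = {y | g y < 0} ∩ U

/-- The measure on `ℝ^d` with density `e^{v(|x|)}` with respect to Lebesgue measure. -/
noncomputable def radMeasure (d : ℕ) (v : ℝ → ℝ) : Measure (EuclideanSpace ℝ (Fin d)) :=
  volume.withDensity fun x => ENNReal.ofReal (Real.exp (v ‖x‖))

namespace S12

/-- One-dimensional Brunn–Minkowski for compact sets. -/
lemma bm1_compact {K M S : Set ℝ} (hK : IsCompact K) (hM : IsCompact M) (hKn : K.Nonempty)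
    (hMn : M.Nonempty) (h : ∀ x ∈ K, ∀ y ∈ M, x + y ∈ S) :
    volume K + volume M ≤ volume S := by
  obtain ⟨k, hkK, hk⟩ := hK.exists_isGreatest hKn
  obtain ⟨m, hmM, hm⟩ := hM.exists_isLeast hMn
  have h1 : volume ((fun x => x + m) '' K) = volume K := by
    rw [image_add_right, measure_preimage_add_right]
  have h2 : volume ((fun x => k + x) '' M) = volume M := by
    rw [image_add_left, measure_preimage_add]
  have hd : AEDisjoint volume ((fun x => x + m) '' K) ((fun x => k + x) '' M) := by
    refine measure_mono_null (t := {k + m}) ?_ (by simp)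
    rintro z ⟨⟨x, hx, rfl⟩, ⟨y, hy, hxy⟩⟩
    have := hk hx
    have := hm hy
    simp only [mem_singleton_iff] at *
    linarith
  rw [← h1, ← h2, ← measure_union₀ _ hd]
  · refine measure_mono ?_
    rintro z (⟨x, hx, rfl⟩ | ⟨x, hx, rfl⟩)
    · exact h _ hx _ hmM
    · exact h _ hkK _ hx
  · exact ((hM.image (by fun_prop)).measurableSet).nullMeasurableSet

lemma bm1 {K M S : Set ℝ} (hK : MeasurableSet K) (hM : MeasurableSet M) (hKn : K.Nonempty)
    (hMn : M.Nonempty) (h : ∀ x ∈ K, ∀ y ∈ M, x + y ∈ S) :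
    volume K + volume M ≤ volume S := by
  obtain ⟨k, hk⟩ := hKn
  obtain ⟨m, hm⟩ := hMn
  have key : ∀ K0 ⊆ K, IsCompact K0 → ∀ M0 ⊆ M, IsCompact M0 → volume K0 + volume M0 ≤ volume S := by
    intro K0 h0 hK0 M0 h1 hM0
    have := bm1_compact (S := S) (hK0.insert k) (hM0.insert m) ⟨k, by simp⟩ ⟨m, by simp⟩ ?_
    · refine le_trans (add_le_add (measure_mono (subset_insert _ _)) (measure_mono (subset_insert _ _))) this
    · intro x hx y hy
      refine h _ (insert_subset hk h0 hx) _ (insert_subset hm h1 hy)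
  rw [hK.measure_eq_iSup_isCompact, hM.measure_eq_iSup_isCompact]
  have e1 : (⨆ (K0) (_ : K0 ⊆ K) (_ : IsCompact K0), volume K0) =
      ⨆ (K0) (_ : K0 ⊆ K ∧ IsCompact K0), volume K0 := by simp only [iSup_and]
  have e2 : (⨆ (K0) (_ : K0 ⊆ M) (_ : IsCompact K0), volume K0) =
      ⨆ (K0) (_ : K0 ⊆ M ∧ IsCompact K0), volume K0 := by simp only [iSup_and]
  rw [e1, e2]
  refine ENNReal.biSup_add_biSup_le' ⟨∅, by simp⟩ ⟨∅, by simp⟩ ?_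
  exact fun i hi j hj => key i hi.1 hi.2 j hj.1 hj.2

open scoped Pointwise in
lemma bm1' {K M S : Set ℝ} {l : ℝ} (h0 : 0 < l) (h1 : l < 1)
    (hK : MeasurableSet K) (hM : MeasurableSet M) (hKn : K.Nonempty)
    (hMn : M.Nonempty) (h : ∀ x ∈ K, ∀ y ∈ M, l * x + (1 - l) * y ∈ S) :
    ENNReal.ofReal l * volume K + ENNReal.ofReal (1 - l) * volume M ≤ volume S := by
  have h1' : 0 < 1 - l := by linarith
  have := bm1 (K := l • K) (M := (1 - l) • M) (S := S) (hK.const_smul₀ l) (hM.const_smul₀ _)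
    hKn.smul_set hMn.smul_set ?_
  · rw [Measure.addHaar_smul, Measure.addHaar_smul] at this
    simpa [abs_of_pos h0, abs_of_pos h1'] using this
  · rintro _ ⟨x, hx, rfl⟩ _ ⟨y, hy, rfl⟩
    exact h x hx y hy

lemma pl1_norm {f g h : ℝ → ℝ} {l : ℝ} (h0 : 0 < l) (h1 : l < 1)
    (hf : Measurable f) (hg : Measurable g) (hh : Measurable h)
    (f0 : ∀ x, 0 ≤ f x) (g0 : ∀ x, 0 ≤ g x) (hh0 : ∀ x, 0 ≤ h x)
    (f1 : ∀ x, f x ≤ 1) (g1 : ∀ x, g x ≤ 1)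
    (fs : ∀ t < 1, ∃ x, t < f x) (gs : ∀ t < 1, ∃ x, t < g x)
    (H : ∀ x y, f x ^ l * g y ^ (1 - l) ≤ h (l * x + (1 - l) * y)) :
    ENNReal.ofReal l * (∫⁻ x, ENNReal.ofReal (f x)) +
      ENNReal.ofReal (1 - l) * (∫⁻ x, ENNReal.ofReal (g x)) ≤ ∫⁻ x, ENNReal.ofReal (h x) := by
  rw [lintegral_eq_lintegral_meas_lt volume (Eventually.of_forall f0) hf.aemeasurable,
    lintegral_eq_lintegral_meas_lt volume (Eventually.of_forall g0) hg.aemeasurable,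
    lintegral_eq_lintegral_meas_lt volume (Eventually.of_forall hh0) hh.aemeasurable]
  have mf : ∀ f : ℝ → ℝ, Measurable fun t => volume {a | t < f a} := by
    intro f
    have : Antitone fun t => volume {a | t < f a} := by
      intro s t hst
      exact measure_mono fun a (ha : t < f a) => lt_of_le_of_lt hst ha
    exact this.measurable
  rw [← lintegral_const_mul _ (mf f), ← lintegral_const_mul _ (mf g),
    ← lintegral_add_left ((mf f).const_mul _)]
  refine setLIntegral_mono (mf h) ?_
  intro t ht
  have ht : 0 < t := ht
  rcases lt_or_ge t 1 with ht1 | ht1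
  · refine bm1' h0 h1 (measurableSet_lt measurable_const hf) (measurableSet_lt measurable_const hg)
      (fs t ht1) (gs t ht1) ?_
    intro x hx y hy
    have hx : t < f x := hx
    have hy : t < g y := hy
    refine lt_of_lt_of_le ?_ (H x y)
    calc t = t ^ l * t ^ (1 - l) := by rw [← Real.rpow_add ht]; simp
      _ < f x ^ l * g y ^ (1 - l) := by
        have a1 := Real.rpow_lt_rpow ht.le hx h0
        have a2 := Real.rpow_lt_rpow ht.le hy (sub_pos.2 h1)
        have : 0 < t ^ l := by positivity
        have : 0 < t ^ (1 - l) := by positivity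
        gcongr
  · have e1 : {a | t < f a} = ∅ := by ext a; simp; linarith [f1 a]
    have e2 : {a | t < g a} = ∅ := by ext a; simp; linarith [g1 a]
    simp [e1, e2]

lemma amgm_ennreal {l : ℝ} (h0 : 0 < l) (h1 : l < 1) (a b : ℝ≥0∞) :
    a ^ l * b ^ (1 - l) ≤ ENNReal.ofReal l * a + ENNReal.ofReal (1 - l) * b := by
  have h1' : 0 < 1 - l := by linarith
  by_cases ha : a = ⊤
  · simp [ha, ENNReal.mul_top, h0, h1']
  by_cases hb : b = ⊤
  · have : ENNReal.ofReal (1 - l) ≠ 0 := by simpa using h1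
    rw [hb, ENNReal.mul_top this]; simp
  lift a to NNReal using ha
  lift b to NNReal using hb
  have := NNReal.geom_mean_le_arith_mean2_weighted ⟨l, h0.le⟩ ⟨1 - l, h1'.le⟩ a b (NNReal.eq (show l + (1 - l) = 1 by ring))
  rw [ENNReal.ofReal_eq_coe_nnreal h0.le, ENNReal.ofReal_eq_coe_nnreal h1'.le,
   ← ENNReal.coe_rpow_of_nonneg _ h0.le, ← ENNReal.coe_rpow_of_nonneg _ h1'.le]
  exact_mod_cast this

/-- The Prékopa–Leindler property of a measure. -/
def PL {X : Type*} [AddCommGroup X] [Module ℝ X] [MeasurableSpace X] (μ : Measure X) : Prop :=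
  ∀ (l : ℝ), 0 < l → l < 1 → ∀ f g h : X → ℝ≥0∞, Measurable f → Measurable g → Measurable h →
    (∀ x y, f x ^ l * g y ^ (1 - l) ≤ h (l • x + (1 - l) • y)) →
    (∫⁻ x, f x ∂μ) ^ l * (∫⁻ x, g x ∂μ) ^ (1 - l) ≤ ∫⁻ x, h x ∂μ

lemma pl1_bdd {f g h : ℝ → ℝ≥0∞} {l : ℝ} (h0 : 0 < l) (h1 : l < 1)
    (hf : Measurable f) (hg : Measurable g) (hh : Measurable h)
    {C : ℝ≥0∞} (hC : C ≠ ⊤) (fC : ∀ x, f x ≤ C) (gC : ∀ x, g x ≤ C)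
    (H : ∀ x y, f x ^ l * g y ^ (1 - l) ≤ h (l * x + (1 - l) * y)) :
    (∫⁻ x, f x) ^ l * (∫⁻ x, g x) ^ (1 - l) ≤ ∫⁻ x, h x := by
  have h1' : 0 < 1 - l := by linarith
  set α := ⨆ x, f x with hα
  set β := ⨆ x, g x with hβ
  have αt : α ≠ ⊤ := ne_top_of_le_ne_top hC (iSup_le fC)
  have βt : β ≠ ⊤ := ne_top_of_le_ne_top hC (iSup_le gC)
  by_cases α0 : α = 0
  · have : ∀ x, f x = 0 := fun x => by
      have := le_iSup f x
      rw [← hα, α0] at this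
      simpa using this
    simp [this, h0]
  by_cases β0 : β = 0
  · have : ∀ x, g x = 0 := fun x => by
      have := le_iSup g x
      rw [← hβ, β0] at this
      simpa using this
    simp [this, h1']
  set γ := α ^ l * β ^ (1 - l) with hγ
  have γt : γ ≠ ⊤ := ENNReal.mul_ne_top (ENNReal.rpow_ne_top_of_nonneg h0.le αt)
    (ENNReal.rpow_ne_top_of_nonneg h1'.le βt)
  have αl0 : α ^ l ≠ 0 := fun h => α0 ((ENNReal.rpow_eq_zero_iff_of_pos h0).1 h)
  have βl0 : β ^ (1 - l) ≠ 0 := fun h => β0 ((ENNReal.rpow_eq_zero_iff_of_pos h1').1 h)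
  have αlt : α ^ l ≠ ⊤ := ENNReal.rpow_ne_top_of_nonneg h0.le αt
  have γ0 : γ ≠ 0 := by
    exact mul_ne_zero αl0 βl0
  have key : ∀ x y, (f x / α) ^ l * (g y / β) ^ (1 - l) ≤ h (l * x + (1 - l) * y) / γ := by
    intro x y
    rw [ENNReal.div_rpow_of_nonneg _ _ h0.le, ENNReal.div_rpow_of_nonneg _ _ h1'.le,
      ← ENNReal.mul_div_mul_comm]
    · exact ENNReal.div_le_div_right (H x y) _
    · exact Or.inl αl0
    · exact Or.inl αlt
  have fle : ∀ x, f x / α ≤ 1 := fun x => ENNReal.div_le_of_le_mul (by simpa using le_iSup f x)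
  have gle : ∀ x, g x / β ≤ 1 := fun x => ENNReal.div_le_of_le_mul (by simpa using le_iSup g x)
  have ftop : ∀ x, f x / α ≠ ⊤ := fun x => ne_top_of_le_ne_top (by simp) (fle x)
  have gtop : ∀ x, g x / β ≠ ⊤ := fun x => ne_top_of_le_ne_top (by simp) (gle x)
  have htop : ∀ x, min (h x / γ) 1 ≠ ⊤ := fun x => ne_top_of_le_ne_top (by simp) (min_le_right _ _)
  have sup : ∀ (f : ℝ → ℝ≥0∞) (α : ℝ≥0∞), α = ⨆ x, f x → α ≠ 0 → α ≠ ⊤ → (∀ x, f x / α ≠ ⊤) →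
      ∀ t < 1, ∃ x, t < (f x / α).toReal := by
    intro f α hα α0 αt hx t ht
    have : ENNReal.ofReal t * α < ⨆ x, f x := by
      rw [← hα]
      conv_rhs => rw [← one_mul α]
      refine (ENNReal.mul_lt_mul_iff_left α0 αt).2 ?_
      simpa using ht
    obtain ⟨x, hx'⟩ := lt_iSup_iff.1 this
    refine ⟨x, ?_⟩
    rcases lt_or_ge t 0 with h | h
    · exact h.trans_le ENNReal.toReal_nonneg
    rw [← ENNReal.ofReal_lt_iff_lt_toReal h (hx x)]
    exact (ENNReal.lt_div_iff_mul_lt (Or.inl α0) (Or.inl αt)).2 hx'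
  have main := pl1_norm (f := fun x => (f x / α).toReal) (g := fun x => (g x / β).toReal)
    (h := fun x => (min (h x / γ) 1).toReal) h0 h1 (by fun_prop) (by fun_prop) (by fun_prop)
    (fun _ => ENNReal.toReal_nonneg) (fun _ => ENNReal.toReal_nonneg) (fun _ => ENNReal.toReal_nonneg) (fun x => ENNReal.toReal_le_of_le_ofReal (by simp) (by simpa using fle x))
    (fun x => ENNReal.toReal_le_of_le_ofReal (by simp) (by simpa using gle x)) (sup f α hα α0 αt ftop)
    (sup g β hβ β0 βt gtop) ?_
  · simp only [ENNReal.ofReal_toReal (ftop _), ENNReal.ofReal_toReal (gtop _),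
      ENNReal.ofReal_toReal (htop _)] at main
    have m2 := (amgm_ennreal h0 h1 _ _).trans (main.trans (lintegral_mono fun x => min_le_left (h x / γ) 1))
    simp only [div_eq_mul_inv] at m2
    rw [lintegral_mul_const _ hf, lintegral_mul_const _ hg, lintegral_mul_const _ hh] at m2
    simp only [← div_eq_mul_inv] at m2
    rw [ENNReal.div_rpow_of_nonneg _ _ h0.le, ENNReal.div_rpow_of_nonneg _ _ h1'.le,
      ← ENNReal.mul_div_mul_comm, ← hγ] at m2
    · rwa [ENNReal.div_le_iff γ0 γt, ENNReal.div_mul_cancel γ0 γt] at m2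
    · exact Or.inl αl0
    · exact Or.inl αlt
  · intro x y
    rw [ENNReal.toReal_rpow, ENNReal.toReal_rpow, ← ENNReal.toReal_mul]
    refine ENNReal.toReal_mono (htop _) (le_min (key x y) ?_)
    exact mul_le_one' (ENNReal.rpow_le_one (fle x) h0.le) (ENNReal.rpow_le_one (gle y) h1'.le)

end S12

namespace S12

lemma pl_real : PL (volume : Measure ℝ) := by
  intro l h0 h1 f g h hf hg hh H
  have h1' : 0 < 1 - l := by linarith
  simp only [smul_eq_mul] at H
  have conv : ∀ f : ℝ → ℝ≥0∞, Measurable f → 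
      Tendsto (fun n : ℕ => ∫⁻ x, min (f x) n) atTop (nhds (∫⁻ x, f x)) := by
    intro f hf
    refine lintegral_tendsto_of_tendsto_of_monotone (fun n => by fun_prop) 
      (Eventually.of_forall fun x m n hmn => by dsimp only; gcongr) (Eventually.of_forall fun x => ?_)
    have : Tendsto (fun n : ℕ => min (f x) (n : ℝ≥0∞)) atTop (nhds (min (f x) ⊤)) :=
      tendsto_const_nhds.min ENNReal.tendsto_nat_nhds_top
    simpa using this
  by_cases F0 : ∫⁻ x, f x = 0
  · simp [F0, h0]
  by_cases G0 : ∫⁻ x, g x = 0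
  · simp [G0, h1']
  have t1 := (ENNReal.continuous_rpow_const (y := l)).continuousAt.tendsto.comp (conv f hf)
  have t2 := (ENNReal.continuous_rpow_const (y := 1 - l)).continuousAt.tendsto.comp (conv g hg)
  have t3 := ENNReal.Tendsto.mul t1 (Or.inl fun h => F0 ((ENNReal.rpow_eq_zero_iff_of_pos h0).1 h))
    t2 (Or.inl fun h => G0 ((ENNReal.rpow_eq_zero_iff_of_pos h1').1 h))
  refine le_of_tendsto' t3 fun n => ?_
  refine pl1_bdd h0 h1 (by fun_prop) (by fun_prop) hh (C := n) (by simp) (fun x => min_le_right _ _)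
    (fun x => min_le_right _ _) fun x y => le_trans ?_ (H x y)
  gcongr <;> exact min_le_left _ _

lemma pl_prod {X Y : Type*} [AddCommGroup X] [Module ℝ X] [MeasurableSpace X]
    [AddCommGroup Y] [Module ℝ Y] [MeasurableSpace Y] {μ : Measure X} {ν : Measure Y}
    [SFinite μ] [SFinite ν] (hμ : PL μ) (hν : PL ν) : PL (μ.prod ν) := by
  intro l h0 h1 f g h hf hg hh H
  rw [lintegral_prod _ hf.aemeasurable, lintegral_prod _ hg.aemeasurable,
    lintegral_prod _ hh.aemeasurable]
  refine hμ l h0 h1 _ _ _ hf.lintegral_prod_right' hg.lintegral_prod_right'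
    hh.lintegral_prod_right' ?_
  intro x x'
  refine hν l h0 h1 _ _ _ (hf.comp measurable_prodMk_left) (hg.comp measurable_prodMk_left)
    (hh.comp measurable_prodMk_left) ?_
  intro y y'
  exact H (x, y) (x', y')

lemma pl_map {X Y : Type*} [AddCommGroup X] [Module ℝ X] [MeasurableSpace X]
    [AddCommGroup Y] [Module ℝ Y] [MeasurableSpace Y] {μ : Measure X} {ν : Measure Y}
    (e : X →ₗ[ℝ] Y) (he : MeasurePreserving e μ ν) (hμ : PL μ) : PL ν := by
  intro l h0 h1 f g h hf hg hh H
  rw [← he.lintegral_comp hf, ← he.lintegral_comp hg, ← he.lintegral_comp hh]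
  refine hμ l h0 h1 _ _ _ (hf.comp he.measurable) (hg.comp he.measurable) (hh.comp he.measurable) ?_
  intro x y
  simpa using H (e x) (e y)

lemma pl_pi (n : ℕ) : PL (volume : Measure (Fin n → ℝ)) := by
  induction n with
  | zero =>
    intro l h0 h1 f g h hf hg hh H
    rw [Measure.volume_pi_eq_dirac (x := (0 : Fin 0 → ℝ))]
    rw [lintegral_dirac, lintegral_dirac, lintegral_dirac]
    have := H 0 0
    simpa using this
  | succ n ih =>
    have mp := (volume_preserving_piFinSuccAbove (fun _ : Fin (n + 1) => ℝ) 0).symm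
    let e : (ℝ × (Fin n → ℝ)) →ₗ[ℝ] (Fin (n + 1) → ℝ) :=
      { toFun := (MeasurableEquiv.piFinSuccAbove (fun _ : Fin (n + 1) => ℝ) 0).symm
        map_add' := by
          intro x y
          ext i
          refine Fin.cases ?_ (fun j => ?_) i <;> simp [MeasurableEquiv.piFinSuccAbove]
        map_smul' := by
          intro c x
          ext i
          refine Fin.cases ?_ (fun j => ?_) i <;> simp [MeasurableEquiv.piFinSuccAbove] }
    exact pl_map e mp (pl_prod pl_real ih)

lemma pl_eucl (d : ℕ) : PL (volume : Measure (EuclideanSpace ℝ (Fin d))) :=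
  pl_map (WithLp.linearEquiv 2 ℝ (Fin d → ℝ)).symm.toLinearMap (PiLp.volume_preserving_toLp _) (pl_pi d)

variable {d : ℕ}

local notation "𝔼" => EuclideanSpace ℝ (Fin d)

open scoped Pointwise in
/-- Brunn–Minkowski inequality for the thickening. -/
lemma bm_thickening (hd : 1 ≤ d) {S : Set 𝔼} (hS : MeasurableSet S) {s ε : ℝ} (hs : 0 < s) (hε : 0 < ε)
    (hv : volume S = ENNReal.ofReal (s ^ d) * volume (ball (0 : 𝔼) 1)) :
    ENNReal.ofReal ((s + ε) ^ d) * volume (ball (0 : 𝔼) 1) ≤ volume (thickening ε S) := by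
  have hse : 0 < s + ε := by linarith
  have hl0 : 0 < s / (s + ε) := by positivity
  have hl1 : s / (s + ε) < 1 := by rw [div_lt_one hse]; linarith
  have e1 : 1 - s / (s + ε) = ε / (s + ε) := by field_simp; ring
  have key := pl_eucl d (s / (s + ε)) hl0 hl1 (((s / (s + ε))⁻¹ • S).indicator 1)
    ((ball (0 : 𝔼) (s + ε)).indicator 1) ((thickening ε S).indicator 1)
    (measurable_one.indicator (hS.const_smul₀ _)) (measurable_one.indicator measurableSet_ball)
    (measurable_one.indicator isOpen_thickening.measurableSet) ?_
  · rw [lintegral_indicator_one (hS.const_smul₀ _), lintegral_indicator_one measurableSet_ball,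
      lintegral_indicator_one isOpen_thickening.measurableSet, Measure.addHaar_smul, hv, ← mul_assoc,
      Measure.addHaar_ball_of_pos _ _ hse, finrank_euclideanSpace_fin, abs_of_pos (by positivity),
      ← ENNReal.ofReal_mul (by positivity)] at key
    have e2 : (s / (s + ε))⁻¹ ^ d * s ^ d = (s + ε) ^ d := by
      rw [← mul_pow]; congr 1; field_simp
    rw [e2] at key
    have hb : volume (ball (0 : 𝔼) 1) ≠ 0 := (measure_ball_pos _ _ one_pos).ne'
    have hbt : volume (ball (0 : 𝔼) 1) ≠ ⊤ := measure_ball_lt_top.ne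
    rw [← ENNReal.rpow_add] at key
    · simpa using key
    · refine mul_ne_zero ?_ hb
      simp; positivity
    · exact ENNReal.mul_ne_top (by simp) hbt
  · intro x y
    by_cases hx : x ∈ (s / (s + ε))⁻¹ • S
    · by_cases hy : y ∈ ball (0 : 𝔼) (s + ε)
      · have : (s / (s + ε)) • x + (1 - s / (s + ε)) • y ∈ thickening ε S := by
          obtain ⟨z, hz, rfl⟩ := hx
          rw [mem_thickening_iff]
          refine ⟨z, hz, ?_⟩
          simp only
          rw [smul_inv_smul₀ hl0.ne', e1, dist_eq_norm, add_sub_cancel_left, norm_smul, Real.norm_of_nonneg (by positivity)]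
          rw [mem_ball_zero_iff] at hy
          rw [div_mul_eq_mul_div, div_lt_iff₀ hse]
          gcongr
        rw [indicator_of_mem hx, indicator_of_mem hy, indicator_of_mem this]; simp
      · have : (0:ℝ) < 1 - s / (s + ε) := by linarith
        simp only [indicator_of_notMem hy, ENNReal.zero_rpow_of_pos this, mul_zero, zero_le]
    · simp only [indicator_of_notMem hx, ENNReal.zero_rpow_of_pos hl0, zero_mul, zero_le]

/-- Polynomial lower bound deduced from Brunn–Minkowski. -/
lemma bm_poly (hd : 1 ≤ d) {S : Set 𝔼} (hS : MeasurableSet S) (hSb : volume S ≠ ⊤) {ε ρ : ℝ}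
    (hε : 0 < ε) (hρ : 0 < ρ) (hT : volume (thickening ε S) ≠ ⊤) {V0 N : ℝ}
    (hV0 : V0 = ρ ^ d * volume.real (ball (0 : 𝔼) 1)) (hN : N = volume.real S - V0) :
    volume.real S + ε * ((1 / ρ) * (d * V0 + (d - 1) * N - N ^ 2 / V0)) ≤
      volume.real (thickening ε S) := by
  set ω := volume.real (ball (0 : 𝔼) 1) with hω
  have ω0 : 0 < ω := ENNReal.toReal_pos (measure_ball_pos _ _ one_pos).ne' measure_ball_lt_top.ne
  have hV0' : 0 < V0 := by rw [hV0]; positivity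
  have hd0 : d ≠ 0 := by omega
  have hmono : volume.real S ≤ volume.real (thickening ε S) :=
    measureReal_mono (self_subset_thickening hε S) hT
  rcases (measureReal_nonneg (μ := volume) (s := S)).eq_or_lt with h0 | h0
  · have : N = - V0 := by rw [hN, ← h0]; ring
    have e : (d * V0 + (d - 1) * N - N ^ 2 / V0) = 0 := by
      rw [this]; field_simp; ring
    rw [e]; linarith
  set s := (volume.real S / ω) ^ (1 / (d : ℝ)) with hs
  have s0 : 0 < s := by positivity
  have hsd : s ^ d = volume.real S / ω := by
    rw [hs, ← Real.rpow_natCast, ← Real.rpow_mul (by positivity)]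
    rw [one_div_mul_cancel (by positivity), Real.rpow_one]
  have hS' : volume.real S = s ^ d * ω := by rw [hsd]; field_simp
  have key := bm_thickening hd hS s0 hε (by
    rw [← ENNReal.ofReal_toReal (measure_ball_lt_top (μ := volume) (x := (0 : 𝔼)) (r := 1)).ne,
      ← ENNReal.ofReal_mul (by positivity), ← ENNReal.ofReal_toReal hSb]
    congr 1)
  have key2 : (s + ε) ^ d * ω ≤ volume.real (thickening ε S) := by
    have := ENNReal.toReal_mono hT key
    rwa [ENNReal.toReal_mul, ENNReal.toReal_ofReal (by positivity)] at this
  refine le_trans ?_ key2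
  have b1 : s ^ d + d * s ^ (d - 1) * ε ≤ (s + ε) ^ d := by
    have := one_add_mul_le_pow (a := ε / s) (by have : 0 < ε / s := by positivity
                                                linarith) d
    have h2 : (s + ε) ^ d = s ^ d * (1 + ε / s) ^ d := by
      rw [← mul_pow]; congr 1; field_simp
    rw [h2]
    calc s ^ d + d * s ^ (d - 1) * ε = s ^ d * (1 + d * (ε / s)) := by
          rw [← Nat.sub_add_cancel hd, pow_succ]; simp; field_simp
      _ ≤ _ := by gcongr
  have b2 : (1 / ρ) * (d * V0 + (d - 1) * N - N ^ 2 / V0) ≤ d * s ^ (d - 1) * ω := by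
    set τ := s / ρ with hτ
    have τ0 : 0 < τ := by positivity
    have hsτ : s = τ * ρ := by rw [hτ]; field_simp
    have hNe : N = V0 * (τ ^ d - 1) := by rw [hN, hS', hV0, hsτ, mul_pow]; ring
    have e : (1 / ρ) * (d * V0 + (d - 1) * N - N ^ 2 / V0) = (V0 / ρ) * (τ ^ d * (d + 1 - τ ^ d)) := by
      rw [hNe]; field_simp; ring
    have e2 : d * s ^ (d - 1) * ω = (V0 / ρ) * (d * τ ^ (d - 1)) := by
      rw [hV0, hsτ, mul_pow]
      obtain ⟨k, rfl⟩ : ∃ k, d = k + 1 := ⟨d - 1, by omega⟩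
      simp [pow_succ]; field_simp
    rw [e, e2]
    refine mul_le_mul_of_nonneg_left ?_ (by positivity)
    have bern : 1 + ((d + 1 : ℕ) : ℝ) * (τ - 1) ≤ τ ^ (d + 1) := by
      have := one_add_mul_le_pow (a := τ - 1) (by linarith) (d + 1)
      simpa using this
    obtain ⟨k, rfl⟩ : ∃ k, d = k + 1 := ⟨d - 1, by omega⟩
    have hp : 0 < τ ^ k := by positivity
    push_cast at bern ⊢
    rw [pow_succ τ k]
    rw [pow_succ, pow_succ] at bern
    nlinarith [mul_le_mul_of_nonneg_left bern hp.le]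
  rw [hS']
  nlinarith [mul_le_mul_of_nonneg_left b2 hε.le, mul_le_mul_of_nonneg_right b1 ω0.le]

end S12

namespace S12

/-- The radial density. -/
noncomputable def W (a u : ℝ) : ℝ := Real.exp (u ^ (a + 1) / (a + 1))

lemma W_pos (a u : ℝ) : 0 < W a u := Real.exp_pos _

lemma W_hasDeriv {a : ℝ} (ha : 0 < a) (u : ℝ) : HasDerivAt (W a) (u ^ a * W a u) u := by
  have h := (Real.hasDerivAt_rpow_const (x := u) (p := a + 1) (Or.inr (by linarith))).div_const (a + 1)
  have := h.exp
  have h1 : a + 1 ≠ 0 := by linarith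
  have e : u ^ a * W a u =
      Real.exp (u ^ (a + 1) / (a + 1)) * ((a + 1) * u ^ (a + 1 - 1) / (a + 1)) := by
    unfold W
    rw [add_sub_cancel_right]
    field_simp
  rw [e]
  exact this

lemma W_cont {a : ℝ} (ha : 0 < a) : Continuous (W a) :=
  continuous_iff_continuousAt.2 fun u => (W_hasDeriv ha u).continuousAt

lemma pow_cont {a : ℝ} (ha : 0 < a) : Continuous fun u : ℝ => u ^ a :=
  Real.continuous_rpow_const ha.le

lemma W'_cont {a : ℝ} (ha : 0 < a) : Continuous fun u : ℝ => u ^ a * W a u :=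
  (pow_cont ha).mul (W_cont ha)

lemma W_zero {a : ℝ} (ha : 0 < a) : W a 0 = 1 := by
  unfold W; rw [Real.zero_rpow (by linarith)]; simp

lemma W_mono {a : ℝ} (ha : 0 < a) {s t : ℝ} (hs : 0 ≤ s) (hst : s ≤ t) : W a s ≤ W a t := by
  unfold W
  apply Real.exp_le_exp.2
  have : 0 < a + 1 := by linarith
  gcongr

lemma W_ftc {a : ℝ} (ha : 0 < a) (s t : ℝ) : ∫ u in s..t, u ^ a * W a u = W a t - W a s :=
  intervalIntegral.integral_eq_sub_of_hasDerivAt (fun u _ => W_hasDeriv ha u)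
    ((W'_cont ha).intervalIntegrable _ _)

variable {d : ℕ}

local notation "𝔼" => EuclideanSpace ℝ (Fin d)

lemma intOn {k : ℝ → ℝ} (hk : Continuous k) {S : Set 𝔼} {L : ℝ}
    (hS : S ⊆ closedBall 0 L) : IntegrableOn (fun x : 𝔼 => k ‖x‖) S :=
  ((hk.comp continuous_norm).continuousOn.integrableOn_compact (isCompact_closedBall 0 L)).mono_set hS

lemma rad_apply {a : ℝ} (ha : 0 < a) {v : ℝ → ℝ} (hv : ∀ r : ℝ, v r = r ^ (a + 1) / (a + 1))
    {S : Set 𝔼} {L : ℝ} (hS : S ⊆ closedBall 0 L) (hSm : MeasurableSet S) :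
    radMeasure d v S = ENNReal.ofReal (∫ x in S, W a ‖x‖) := by
  have : v = fun r => r ^ (a + 1) / (a + 1) := funext hv
  rw [radMeasure, withDensity_apply _ hSm, this,
    ofReal_integral_eq_lintegral_ofReal (intOn (W_cont ha) hS)
      (Eventually.of_forall fun x => (W_pos _ _).le)]
  rfl

lemma surf_ge {X : Type*} [PseudoEMetricSpace X] [MeasurableSpace X] {μ : Measure X} {A : Set X} {F : ℝ}
    {δ : ℝ → ℝ} (hδ : Tendsto δ (nhdsWithin 0 (Ioi 0)) (nhds 0)) (hA : μ A ≠ ⊤)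
    (h : ∀ᶠ ε in nhdsWithin (0 : ℝ) (Ioi 0),
      ENNReal.ofReal (ε * (F - δ ε)) + μ A ≤ μ (thickening ε A)) :
    ENNReal.ofReal F ≤ surfaceMeasure μ A := by
  have t : Tendsto (fun ε => ENNReal.ofReal (F - δ ε)) (nhdsWithin 0 (Ioi 0)) (nhds (ENNReal.ofReal F)) := by
    have := (tendsto_const_nhds (x := F)).sub hδ
    rw [sub_zero] at this
    exact (ENNReal.continuous_ofReal.tendsto _).comp this
  rw [← t.liminf_eq]
  refine liminf_le_liminf ?_
  filter_upwards [h, self_mem_nhdsWithin] with ε he hε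
  have hε : 0 < ε := hε
  rw [ENNReal.le_div_iff_mul_le (by simp [hε]) (by simp), ← ENNReal.ofReal_mul' hε.le, mul_comm]
  exact ENNReal.le_sub_of_add_le_right hA he

lemma ball_real (hd : 1 ≤ d) {r : ℝ} (hr : 0 ≤ r) :
    volume.real (closedBall (0 : 𝔼) r) = r ^ d * volume.real (ball (0 : 𝔼) 1) := by
  rw [measureReal_def, Measure.addHaar_closedBall _ _ hr, ENNReal.toReal_mul,
    ENNReal.toReal_ofReal (by positivity), finrank_euclideanSpace_fin]
  rfl

lemma ball_surf {a : ℝ} (ha : 0 < a) {v : ℝ → ℝ} (hv : ∀ r : ℝ, v r = r ^ (a + 1) / (a + 1))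
    (hd : 1 ≤ d) {r : ℝ} (hr : 0 < r) :
    surfaceMeasure (radMeasure d v) (closedBall (0 : 𝔼) r) ≤
      ENNReal.ofReal (d * volume.real (ball (0 : 𝔼) 1) * r ^ (d - 1) * W a r) := by
  set ω := volume.real (ball (0 : 𝔼) 1) with hω
  have t : Tendsto (fun ε => W a (r + ε) * ω * (ε⁻¹ * ((r + ε) ^ d - r ^ d))) (nhdsWithin 0 (Ioi 0))
      (nhds (W a r * ω * (d * r ^ (d - 1)))) := by
    refine Tendsto.mul (Tendsto.mul ?_ tendsto_const_nhds) ?_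
    · have : Tendsto (fun ε => W a (r + ε)) (nhds 0) (nhds (W a (r + 0))) :=
        ((W_cont ha).comp (continuous_const.add continuous_id)).tendsto 0
      rw [add_zero] at this
      exact this.mono_left nhdsWithin_le_nhds
    · have := (hasDerivAt_pow d r).tendsto_slope_zero_right
      simpa using this
  have e : d * ω * r ^ (d - 1) * W a r = W a r * ω * (d * r ^ (d - 1)) := by ring
  rw [e, ← ((ENNReal.continuous_ofReal.tendsto _).comp t).liminf_eq]
  refine liminf_le_liminf ?_
  filter_upwards [self_mem_nhdsWithin] with ε hε
  have hε : 0 < ε := hε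
  have hlt : r < r + ε := by linarith
  simp only [Function.comp]
  rw [thickening_closedBall hε hr.le]
  refine ENNReal.div_le_of_le_mul ?_
  rw [← ENNReal.ofReal_mul' hε.le]
  refine le_measure_sdiff.trans ?_
  have sub : ball (0 : 𝔼) (ε + r) \ closedBall 0 r ⊆ closedBall 0 (r + ε) := by
    rw [add_comm]; exact sdiff_subset.trans ball_subset_closedBall
  rw [rad_apply ha hv sub (measurableSet_ball.diff measurableSet_closedBall)]
  apply ENNReal.ofReal_le_ofReal
  have e2 : W a (r + ε) * ω * (ε⁻¹ * ((r + ε) ^ d - r ^ d)) * ε = W a (r + ε) * ((r + ε) ^ d * ω - r ^ d * ω) := by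
    field_simp
  rw [e2, ← ball_real hd hr.le, ← ball_real hd (by linarith), ← measureReal_sdiff (closedBall_subset_closedBall hlt.le) measurableSet_closedBall
    measure_closedBall_lt_top.ne]
  calc ∫ x in ball (0 : 𝔼) (ε + r) \ closedBall 0 r, W a ‖x‖ 
      ≤ ∫ x in ball (0 : 𝔼) (ε + r) \ closedBall 0 r, W a (r + ε) := by
        refine setIntegral_mono_on (intOn (W_cont ha) sub) ?_ (measurableSet_ball.diff measurableSet_closedBall) ?_
        · exact (integrableOn_const measure_closedBall_lt_top.ne).mono_set sub
        · intro x hx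
          refine W_mono ha (norm_nonneg _) ?_
          simpa using sub hx
    _ = W a (r + ε) * volume.real (ball (0 : 𝔼) (ε + r) \ closedBall 0 r) := by
        rw [setIntegral_const, smul_eq_mul, mul_comm]
    _ ≤ _ := by
        refine mul_le_mul_of_nonneg_left ?_ (W_pos _ _).le
        refine measureReal_mono ?_ ?_
        · rw [add_comm]; exact sdiff_subset_sdiff_left ball_subset_closedBall
        · exact ne_top_of_le_ne_top measure_closedBall_lt_top.ne (measure_mono sdiff_subset)

/-- Radial integration formula. -/
lemma radial (hd : 1 ≤ d) {k : ℝ → ℝ} {s t : ℝ} (hs : 0 ≤ s) (hst : s ≤ t) :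
    ∫ x in closedBall (0 : 𝔼) t \ closedBall 0 s, k ‖x‖ =
      ∫ u in s..t, k u * (d * volume.real (ball (0 : 𝔼) 1) * u ^ (d - 1)) := by
  have : Nonempty (Fin d) := ⟨⟨0, by omega⟩⟩
  have e1 : ∫ x in closedBall (0 : 𝔼) t \ closedBall 0 s, k ‖x‖ = ∫ x : 𝔼, (Ioc s t).indicator k ‖x‖ := by
    rw [← integral_indicator (measurableSet_closedBall.diff measurableSet_closedBall)]
    congr 1; ext x
    simp only [indicator, Set.mem_sdiff, mem_closedBall_zero_iff, mem_Ioc, not_le, and_comm]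
  rw [e1, integral_fun_norm_addHaar, intervalIntegral.integral_of_le hst, finrank_euclideanSpace_fin]
  rw [← integral_indicator measurableSet_Ioi, ← integral_indicator measurableSet_Ioc]
  rw [nsmul_eq_mul, smul_eq_mul, ← integral_const_mul, ← integral_const_mul]
  congr 1; ext u
  by_cases hu : u ∈ Ioc s t
  · have : u ∈ Ioi (0:ℝ) := lt_of_le_of_lt hs hu.1
    simp only [indicator_of_mem hu, indicator_of_mem this, smul_eq_mul]; ring
  · simp only [indicator_of_notMem hu, smul_zero]; simp only [indicator, hu, if_false]; simp

end S12

namespace S12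

/-- Layer-cake formula with real integrals. -/
lemma LC {X : Type*} [MeasurableSpace X] (ν : Measure X) [IsFiniteMeasure ν] {s : X → ℝ}
    (hs : Measurable s) {l L : ℝ} (hlL : l ≤ L) (hl : ∀ᵐ x ∂ν, l ≤ s x) (hL : ∀ᵐ x ∂ν, s x ≤ L)
    {k : ℝ → ℝ} (hk : IntervalIntegrable k volume l L) :
    ∫ x, (∫ u in l..s x, k u) ∂ν = ∫ u in l..L, k u * ν.real {x | u < s x} := by
  rw [intervalIntegrable_iff_integrableOn_Ioc_of_le hlL] at hk
  have e1 : ∫ x, (∫ u in l..s x, k u) ∂ν =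
      ∫ x, (∫ u in Ioc l L, {p : X × ℝ | p.2 < s p.1}.indicator (fun p => k p.2) (x, u)) ∂ν := by
    refine integral_congr_ae ?_
    filter_upwards [hl, hL] with x h1 h2
    have : (fun u => {p : X × ℝ | p.2 < s p.1}.indicator (fun p => k p.2) (x, u)) =
        (Iio (s x)).indicator k := by
      ext u; simp [indicator]
    rw [this, setIntegral_indicator measurableSet_Iio, intervalIntegral.integral_of_le h1,
      integral_Ioc_eq_integral_Ioo]
    have e : Ioc l L ∩ Iio (s x) = Ioo l (s x) := by
      ext u; simp only [mem_inter_iff, mem_Ioc, mem_Iio, mem_Ioo]; constructor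
      · rintro ⟨⟨h, _⟩, h'⟩; exact ⟨h, h'⟩
      · rintro ⟨h, h'⟩; exact ⟨⟨h, by linarith⟩, h'⟩
    rw [e]
  rw [e1, integral_integral_swap, intervalIntegral.integral_of_le hlL]
  · congr 1; ext u
    have : (fun x => {p : X × ℝ | p.2 < s p.1}.indicator (fun p => k p.2) (x, u)) =
        {x | u < s x}.indicator (fun _ => k u) := by
      ext x; simp [indicator]
    rw [this, integral_indicator_const _ (measurableSet_lt measurable_const hs), smul_eq_mul, mul_comm]
  · have : Integrable (fun p : X × ℝ => k p.2) (ν.prod (volume.restrict (Ioc l L))) := hk.comp_snd ν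
    exact this.indicator (measurableSet_lt measurable_snd (hs.comp measurable_fst))

variable {d : ℕ}

local notation "𝔼" => EuclideanSpace ℝ (Fin d)

lemma vol_fin {S : Set 𝔼} {L : ℝ} (hS : S ⊆ closedBall 0 L) : volume S ≠ ⊤ :=
  ne_top_of_le_ne_top measure_closedBall_lt_top.ne (measure_mono hS)

/-- Layer cake for a set. -/
lemma LCset {S : Set 𝔼} {l L : ℝ} (hlL : l ≤ L) (hS : S ⊆ closedBall 0 L)
    (hSl : ∀ x ∈ S, l ≤ ‖x‖) (hSm : MeasurableSet S)
    {k : ℝ → ℝ} (hk : IntervalIntegrable k volume l L) :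
    ∫ x in S, (∫ u in l..‖x‖, k u) = ∫ u in l..L, k u * volume.real (S \ closedBall 0 u) := by
  haveI : IsFiniteMeasure (volume.restrict S) := ⟨by simpa using (vol_fin hS).lt_top⟩
  rw [LC (volume.restrict S) measurable_norm hlL (ae_restrict_of_forall_mem hSm hSl)
    (ae_restrict_of_forall_mem hSm fun x hx => by simpa using hS hx) hk]
  congr 1; ext u
  congr 1
  rw [measureReal_restrict_apply (measurableSet_lt measurable_const measurable_norm)]
  congr 1
  ext x; simp [and_comm]

lemma mass_layer {a : ℝ} (ha : 0 < a) {S : Set 𝔼} {L : ℝ} (hL : 0 ≤ L) (hS : S ⊆ closedBall 0 L)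
    (hSm : MeasurableSet S) :
    ∫ x in S, W a ‖x‖ = volume.real S + ∫ u in 0..L, u ^ a * W a u * volume.real (S \ closedBall 0 u) := by
  rw [← LCset hL hS (fun x _ => norm_nonneg x) hSm ((W'_cont ha).intervalIntegrable _ _)]
  simp only [W_ftc ha, W_zero ha]
  rw [integral_sub (intOn (W_cont ha) hS) (integrableOn_const (vol_fin hS))]
  simp

lemma anti_vol {S : Set 𝔼} {L : ℝ} (hS : S ⊆ closedBall 0 L) :
    Antitone fun u : ℝ => volume.real (S \ closedBall (0 : 𝔼) u) := by
  intro s t hst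
  exact measureReal_mono (sdiff_subset_sdiff_right (closedBall_subset_closedBall hst))
    (vol_fin (sdiff_subset.trans hS))

lemma W_diff {a : ℝ} (ha : 0 < a) {s t : ℝ} (hs : 0 ≤ s) (hst : s ≤ t) :
    W a t - W a s ≤ (t - s) * (t ^ a * W a t) := by
  rw [← W_ftc ha]
  calc ∫ u in s..t, u ^ a * W a u ≤ ∫ u in s..t, t ^ a * W a t := by
        refine intervalIntegral.integral_mono_on hst ((W'_cont ha).intervalIntegrable _ _) (by simp) ?_
        intro u hu
        have h0 : 0 ≤ u := hs.trans hu.1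
        have := W_mono ha h0 hu.2
        have := hu.2
        have := (W_pos a u).le
        have := Real.rpow_nonneg (hs.trans hst) a
        gcongr
    _ = _ := by simp; ring

/-- The shell error term. -/
lemma shell_err {a : ℝ} (ha : 0 < a) (hd : 1 ≤ d) {A : Set 𝔼} {L ε : ℝ} (hL : 0 < L) 
    (hA : A ⊆ closedBall 0 L) (hAm : MeasurableSet A) (hε : 0 < ε) (hε1 : ε ≤ 1) :
    ∫ u in 0..L, u ^ a * W a u * (volume.real ((closedBall (0 : 𝔼) (L + 1) \ A) \ closedBall 0 u) -
      volume.real ((closedBall (0 : 𝔼) (L + 1) \ A) \ closedBall 0 (u + ε))) ≤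
    ε * (∫ x in closedBall (0 : 𝔼) L \ A, ‖x‖ ^ a * W a ‖x‖) +
     ε * (L ^ a * W a L * (volume.real (ball (0 : 𝔼) 1) * ((L + ε) ^ d - L ^ d))) := by
  set D := closedBall (0 : 𝔼) (L + 1) \ A with hD
  have hDs : D ⊆ closedBall 0 (L + 1) := sdiff_subset
  have hDm : MeasurableSet D := measurableSet_closedBall.diff hAm
  haveI : IsFiniteMeasure (volume.restrict D) := ⟨by simpa using (vol_fin hDs).lt_top⟩
  let s1 : 𝔼 → ℝ := fun y => min ‖y‖ L
  let s2 : 𝔼 → ℝ := fun y => min (max (‖y‖ - ε) 0) L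
  have c1 : Continuous s1 := by fun_prop
  have c2 : Continuous s2 := by fun_prop
  have ii := (W'_cont ha).intervalIntegrable (μ := volume) 0 L
  have l1 := LC (volume.restrict D) (s := s1) c1.measurable hL.le
    (Eventually.of_forall fun y => le_min (norm_nonneg _) hL.le)
    (Eventually.of_forall fun y => min_le_right _ _) ii
  have l2 := LC (volume.restrict D) (s := s2) c2.measurable hL.le
    (Eventually.of_forall fun y => le_min (le_max_right _ _) hL.le)
    (Eventually.of_forall fun y => min_le_right _ _) ii
  have anti := anti_vol hDs
  have i1 : IntervalIntegrable (fun u => u ^ a * W a u * volume.real (D \ closedBall 0 u)) volume 0 L :=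
    (anti.intervalIntegrable).continuousOn_mul (W'_cont ha).continuousOn
  have anti2 : Antitone fun u : ℝ => volume.real (D \ closedBall (0 : 𝔼) (u + ε)) :=
    fun s t hst => anti (by linarith : s + ε ≤ t + ε)
  have i2 : IntervalIntegrable (fun u => u ^ a * W a u * volume.real (D \ closedBall 0 (u + ε))) volume 0 L :=
    (anti2.intervalIntegrable).continuousOn_mul (W'_cont ha).continuousOn
  have aeL : ∀ᵐ u : ℝ, u ≠ L := by simp [ae_iff]
  have r1 : ∫ u in 0..L, u ^ a * W a u * volume.real (D \ closedBall 0 u) =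
      ∫ u in 0..L, u ^ a * W a u * (volume.restrict D).real {x | u < s1 x} := by
    refine intervalIntegral.integral_congr_ae ?_
    filter_upwards [aeL] with u hne hu
    rw [uIoc_of_le hL.le] at hu
    have huL : u < L := lt_of_le_of_ne hu.2 hne
    rw [measureReal_restrict_apply (measurableSet_lt measurable_const c1.measurable)]
    congr 2
    ext x; simp [s1, and_comm, huL]
  have r2 : ∫ u in 0..L, u ^ a * W a u * volume.real (D \ closedBall 0 (u + ε)) =
      ∫ u in 0..L, u ^ a * W a u * (volume.restrict D).real {x | u < s2 x} := by
    refine intervalIntegral.integral_congr_ae ?_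
    filter_upwards [aeL] with u hne hu
    rw [uIoc_of_le hL.le] at hu
    have huL : u < L := lt_of_le_of_ne hu.2 hne
    rw [measureReal_restrict_apply (measurableSet_lt measurable_const c2.measurable)]
    congr 2
    ext x; simp [s2, and_comm, huL, not_lt.2 hu.1.le, lt_sub_iff_add_lt]
  simp only [mul_sub] at *
  rw [intervalIntegral.integral_sub i1 i2, r1, r2, ← l1, ← l2]
  have kint : ∀ {k : 𝔼 → ℝ}, Continuous k → IntegrableOn k (closedBall (0 : 𝔼) (L + 1)) := fun hk =>
    hk.continuousOn.integrableOn_compact (isCompact_closedBall 0 _)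
  have Wc : ∀ {s : 𝔼 → ℝ}, Continuous s → Continuous fun x => W a (s x) - W a 0 := fun hs =>
    ((W_cont ha).comp hs).sub continuous_const
  simp only [W_ftc ha]
  rw [← integral_sub ((kint (Wc c1)).mono_set hDs) ((kint (Wc c2)).mono_set hDs)]
  have hsub : closedBall (0 : 𝔼) (L + ε) ⊆ closedBall 0 (L + 1) := closedBall_subset_closedBall (by linarith)
  have W's1 : Continuous fun x => ε * (s1 x ^ a * W a (s1 x)) :=
    continuous_const.mul ((W'_cont ha).comp c1)
  calc ∫ x in D, (W a (s1 x) - W a 0 - (W a (s2 x) - W a 0)) 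
      ≤ ∫ x in D, (closedBall (0 : 𝔼) (L + ε)).indicator (fun x => ε * (s1 x ^ a * W a (s1 x))) x := by
        refine setIntegral_mono_on ((kint ((Wc c1).sub (Wc c2))).mono_set hDs)
          (((kint W's1).mono_set hDs).indicator measurableSet_closedBall) hDm ?_
        intro x hx
        have h2 : 0 ≤ s2 x := le_min (le_max_right _ _) hL.le
        have h1 : 0 ≤ s1 x := le_min (norm_nonneg _) hL.le
        by_cases hxL : ‖x‖ ≤ L + ε
        · rw [indicator_of_mem (by simpa using hxL)]
          have h21 : s2 x ≤ s1 x := min_le_min_right _ (max_le (by linarith) (norm_nonneg x))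
          have h12 : s1 x - s2 x ≤ ε := by
            have : s1 x ≤ s2 x + ε := by
              simp only [s1, s2]
              rw [← min_add_add_right]
              refine min_le_min ?_ (by linarith)
              linarith [le_max_left (‖x‖ - ε) 0]
            linarith
          have := W_diff ha h2 h21
          have h3 : 0 ≤ s1 x ^ a * W a (s1 x) := mul_nonneg (Real.rpow_nonneg h1 _) (W_pos _ _).le
          nlinarith [mul_le_mul_of_nonneg_right h12 h3]
        · rw [indicator_of_notMem (by simpa using hxL)]
          push Not at hxL
          have e1 : s1 x = L := min_eq_right (by linarith)
          have e2 : s2 x = L := min_eq_right (le_max_of_le_left (by linarith))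
          rw [e1, e2]; simp
    _ = ∫ x in (closedBall (0 : 𝔼) L \ A) ∪ (closedBall (0 : 𝔼) (L + ε) \ closedBall 0 L), ε * (s1 x ^ a * W a (s1 x)) := by
        rw [setIntegral_indicator measurableSet_closedBall]
        congr 2
        ext x
        simp only [hD, mem_inter_iff, Set.mem_sdiff, mem_closedBall_zero_iff, Set.mem_union, not_le]
        constructor
        · rintro ⟨⟨h1, h2⟩, h3⟩
          rcases le_or_gt ‖x‖ L with h | h
          · exact Or.inl ⟨h, h2⟩
          · exact Or.inr ⟨h3, h⟩
        · rintro (⟨h1, h2⟩ | ⟨h1, h2⟩)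
          · exact ⟨⟨by linarith, h2⟩, by linarith⟩
          · refine ⟨⟨by linarith, fun h => ?_⟩, h1⟩
            have := hA h
            simp at this; linarith
    _ = (∫ x in (closedBall (0 : 𝔼) L \ A), ε * (s1 x ^ a * W a (s1 x))) +
        ∫ x in (closedBall (0 : 𝔼) (L + ε) \ closedBall 0 L), ε * (s1 x ^ a * W a (s1 x)) := by
        refine setIntegral_union ?_ (measurableSet_closedBall.diff measurableSet_closedBall) ?_ ?_
        · exact disjoint_sdiff_right.mono_left sdiff_subset
        · exact (kint W's1).mono_set (sdiff_subset.trans (closedBall_subset_closedBall (by linarith)))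
        · exact (kint W's1).mono_set (sdiff_subset.trans hsub)
    _ = _ := by
        congr 1
        · rw [← integral_const_mul]
          refine setIntegral_congr_fun (measurableSet_closedBall.diff hAm) ?_
          intro x hx
          have : s1 x = ‖x‖ := min_eq_left (by simpa using hx.1)
          simp only [this]
        · have : ∫ x in (closedBall (0 : 𝔼) (L + ε) \ closedBall 0 L), ε * (s1 x ^ a * W a (s1 x)) =
              ∫ x in (closedBall (0 : 𝔼) (L + ε) \ closedBall 0 L), ε * (L ^ a * W a L) := by
            refine setIntegral_congr_fun (measurableSet_closedBall.diff measurableSet_closedBall) ?_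
            intro x hx
            have : s1 x = L := min_eq_right (by have := hx.2; simp at this; linarith)
            simp only [this]
          rw [this, setIntegral_const, measureReal_sdiff (closedBall_subset_closedBall (by linarith))
            measurableSet_closedBall measure_closedBall_lt_top.ne, ball_real hd (by linarith),
            ball_real hd hL.le, smul_eq_mul]
          ring

end S12

namespace S12

variable {d : ℕ}

local notation "𝔼" => EuclideanSpace ℝ (Fin d)

/-- volume of `A ∪ B_u` minus the volume of the ball of radius `max u r`. -/
noncomputable def NN (A : Set 𝔼) (r u : ℝ) : ℝ :=
  volume.real (A ∪ closedBall 0 u) - (max u r) ^ d * volume.real (ball (0 : 𝔼) 1)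

/-- Lower bound for the perimeter of `A ∪ B_u`. -/
noncomputable def GG (A : Set 𝔼) (r u : ℝ) : ℝ :=
  (1 / max u r) * (d * ((max u r) ^ d * volume.real (ball (0 : 𝔼) 1)) + (d - 1) * NN A r u -
    NN A r u ^ 2 / ((max u r) ^ d * volume.real (ball (0 : 𝔼) 1)))

lemma om_pos : 0 < volume.real (ball (0 : 𝔼) 1) :=
  ENNReal.toReal_pos (measure_ball_pos _ _ one_pos).ne' measure_ball_lt_top.ne

lemma bd_union {A : Set 𝔼} {L : ℝ} (hA : A ⊆ closedBall 0 L) (u : ℝ) :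
    A ∪ closedBall 0 u ⊆ closedBall 0 (max L u) :=
  union_subset (hA.trans (closedBall_subset_closedBall (le_max_left _ _)))
    (closedBall_subset_closedBall (le_max_right _ _))

lemma mono_union {A : Set 𝔼} {L : ℝ} (hA : A ⊆ closedBall 0 L) :
    Monotone fun u : ℝ => volume.real (A ∪ closedBall (0 : 𝔼) u) := by
  intro s t hst
  exact measureReal_mono (union_subset_union_right _ (closedBall_subset_closedBall hst))
    (vol_fin (bd_union hA t))

lemma ii_quad {m c0 c1 c2 : ℝ → ℝ} (hm : Monotone m) (m0 : ∀ u, 0 ≤ m u) (h0 : Continuous c0)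
    (h1 : Continuous c1) (h2 : Continuous c2) (s t : ℝ) :
    IntervalIntegrable (fun u => c0 u + c1 u * m u + c2 u * m u ^ 2) volume s t := by
  have hm2 : Monotone fun u => m u ^ 2 := fun u v huv => pow_le_pow_left₀ (m0 u) (hm huv) 2
  exact ((h0.intervalIntegrable _ _).add ((hm.intervalIntegrable).continuousOn_mul h1.continuousOn)).add
    ((hm2.intervalIntegrable).continuousOn_mul h2.continuousOn)

lemma rho_cont {r : ℝ} (hr : 0 < r) : Continuous fun u : ℝ => (1 / max u r) :=
  continuous_const.div (by fun_prop) fun u => (lt_max_of_lt_right hr).ne'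

lemma vol_cont {r : ℝ} (hr : 0 < r) :
    Continuous fun u : ℝ => (1 / ((max u r) ^ d * volume.real (ball (0 : 𝔼) 1))) :=
  continuous_const.div (by fun_prop) fun u => by
    have : 0 < max u r := lt_max_of_lt_right hr
    have := om_pos (d := d)
    positivity

lemma GG_ii {A : Set 𝔼} {r L : ℝ} (hr : 0 < r) (hA : A ⊆ closedBall 0 L) {k : ℝ → ℝ} (hk : Continuous k)
    (s t : ℝ) : IntervalIntegrable (fun u => k u * GG A r u) volume s t := by
  have c1 := rho_cont hr
  have c2 := vol_cont (d := d) hr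
  set ω := volume.real (ball (0 : 𝔼) 1) with hω
  have := ii_quad (mono_union hA) (fun _ => measureReal_nonneg)
    (c0 := fun u => k u * (1 / max u r) * (d * ((max u r) ^ d * ω) - (d - 1) * ((max u r) ^ d * ω)
      - ((max u r) ^ d * ω) ^ 2 * (1 / ((max u r) ^ d * ω))))
    (c1 := fun u => k u * (1 / max u r) * ((d - 1) + 2 * ((max u r) ^ d * ω) * (1 / ((max u r) ^ d * ω))))
    (c2 := fun u => - (k u * (1 / max u r) * (1 / ((max u r) ^ d * ω))))
    (by fun_prop) (by fun_prop) (by fun_prop) s t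
  refine this.congr fun u _ => ?_
  simp only [GG, NN, ← hω, div_eq_mul_inv]
  ring

/-- The lower bound functional. -/
noncomputable def FF (a : ℝ) (A : Set 𝔼) (r L : ℝ) : ℝ :=
  GG A r 0 + (∫ u in 0..L, u ^ a * W a u * GG A r u) - 
    ∫ x in closedBall (0 : 𝔼) L \ A, ‖x‖ ^ a * W a ‖x‖

lemma layer_ineq (hd : 1 ≤ d) {A : Set 𝔼} {r L ε u : ℝ} (hr : 0 < r) (hL : 0 < L)
    (hA : A ⊆ closedBall 0 L) (hAm : MeasurableSet A) (hε : 0 < ε) (hε1 : ε ≤ 1)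
    (hu : 0 ≤ u) (huL : u ≤ L) :
    volume.real (A \ closedBall 0 u) + (ε * GG A r u - (volume.real ((closedBall (0 : 𝔼) (L + 1) \ A) \ closedBall 0 u) -
      volume.real ((closedBall (0 : 𝔼) (L + 1) \ A) \ closedBall 0 (u + ε)))) ≤
      volume.real (thickening ε A \ closedBall 0 u) := by
  have hTA : thickening ε A ⊆ closedBall 0 (L + 1) := by
    refine (thickening_subset_of_subset _ hA).trans ?_
    rw [thickening_closedBall hε hL.le]
    exact ball_subset_closedBall.trans (closedBall_subset_closedBall (by linarith))
  have hB : closedBall (0 : 𝔼) u ⊆ closedBall 0 (L + 1) := closedBall_subset_closedBall (by linarith)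
  have hB' : closedBall (0 : 𝔼) (u + ε) ⊆ closedBall 0 (L + 1) := closedBall_subset_closedBall (by linarith)
  have hBB : closedBall (0 : 𝔼) u ⊆ closedBall 0 (u + ε) := closedBall_subset_closedBall (by linarith)
  have hth : thickening ε (A ∪ closedBall 0 u) = thickening ε A ∪ ball 0 (ε + u) := by
    rw [thickening_union, thickening_closedBall hε hu]
  have hT : thickening ε (A ∪ closedBall 0 u) ⊆ closedBall 0 (L + 1) := by
    rw [hth]
    exact union_subset hTA (ball_subset_closedBall.trans (by rw [add_comm]; exact hB'))
  have key := bm_poly hd (hAm.union measurableSet_closedBall) (vol_fin (bd_union hA u)) hε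
    (lt_max_of_lt_right hr : 0 < max u r) (vol_fin hT) rfl (rfl : NN A r u = _)
  have e1 : volume.real (A ∪ closedBall 0 u) = volume.real (A \ closedBall 0 u) + volume.real (closedBall (0 : 𝔼) u) := by
    rw [← sdiff_union_self, measureReal_union disjoint_sdiff_left measurableSet_closedBall
      (vol_fin (sdiff_subset.trans hA)) measure_closedBall_lt_top.ne]
  have e2 : volume.real ((closedBall (0 : 𝔼) (L + 1) \ A) \ closedBall 0 u) =
     volume.real ((closedBall (0 : 𝔼) (u + ε) \ A) \ closedBall 0 u) +
      volume.real ((closedBall (0 : 𝔼) (L + 1) \ A) \ closedBall 0 (u + ε)) := by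
    rw [← measureReal_union _ ((measurableSet_closedBall.diff hAm).diff measurableSet_closedBall)
      (vol_fin (sdiff_subset.trans (sdiff_subset.trans hB'))) (vol_fin (sdiff_subset.trans sdiff_subset))]
    · congr 1
      ext x
      have h1 := @hBB x
      have h2 := @hB' x
      simp only [Set.mem_sdiff, Set.mem_union]
      tauto
    · rw [Set.disjoint_left]
      rintro x ⟨⟨h1, _⟩, _⟩ ⟨_, h2⟩
      exact h2 h1
  have e3 : volume.real (thickening ε (A ∪ closedBall 0 u)) ≤ volume.real (thickening ε A \ closedBall 0 u) +
      volume.real (closedBall (0 : 𝔼) u) + volume.real ((closedBall (0 : 𝔼) (u + ε) \ A) \ closedBall 0 u) := by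
    have : thickening ε (A ∪ closedBall 0 u) ⊆ ((thickening ε A \ closedBall 0 u) ∪ closedBall (0 : 𝔼) u) ∪
       ((closedBall (0 : 𝔼) (u + ε) \ A) \ closedBall 0 u) := by
      rw [hth]
      intro x hx
      have h1 := @self_subset_thickening _ _ ε hε A x
      have h2 : x ∈ ball (0 : 𝔼) (ε + u) → x ∈ closedBall (0 : 𝔼) (u + ε) := by
        rw [add_comm]; exact fun h => ball_subset_closedBall h
      simp only [Set.mem_sdiff, Set.mem_union] at *
      tauto
    refine (measureReal_mono this ?_).trans ?_
    · refine vol_fin (L := L + 1) (union_subset (union_subset (sdiff_subset.trans hTA) hB) (sdiff_subset.trans (sdiff_subset.trans hB')))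
    · exact (measureReal_union_le _ _).trans (by gcongr; exact measureReal_union_le _ _)
  have eG : GG A r u = (1 / max u r) * (d * ((max u r) ^ d * volume.real (ball (0 : 𝔼) 1)) + (d - 1) * NN A r u -
    NN A r u ^ 2 / ((max u r) ^ d * volume.real (ball (0 : 𝔼) 1))) := rfl
  rw [← eG] at key
  linarith

lemma layer_zero (hd : 1 ≤ d) {A : Set 𝔼} {r L ε : ℝ} (hr : 0 < r) (hL : 0 < L)
    (hA : A ⊆ closedBall 0 L) (hAm : MeasurableSet A) (hε : 0 < ε) :
    volume.real A + ε * GG A r 0 ≤ volume.real (thickening ε A) := by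
  have : Nonempty (Fin d) := ⟨⟨0, by omega⟩⟩
  have hTA : thickening ε A ⊆ closedBall 0 (L + ε) := by
    refine (thickening_subset_of_subset _ hA).trans ?_
    rw [thickening_closedBall hε hL.le, add_comm]
    exact ball_subset_closedBall
  have e0 : volume.real (A ∪ closedBall 0 0) = volume.real A := by
    rw [closedBall_zero, measureReal_def, measureReal_def, union_singleton]
    congr 1
    refine measure_congr (insert_ae_eq_self _ _)
  have hN : NN A r 0 = volume.real A - (max 0 r) ^ d * volume.real (ball (0 : 𝔼) 1) := by rw [NN, e0]
  exact bm_poly hd hAm (vol_fin hA) hε (lt_max_of_lt_right hr : 0 < max 0 r) (vol_fin hTA) rfl hN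

lemma surf_FF {a : ℝ} (ha : 0 < a) {v : ℝ → ℝ} (hv : ∀ r : ℝ, v r = r ^ (a + 1) / (a + 1))
    (hd : 1 ≤ d) {A : Set 𝔼} {r L : ℝ} (hr : 0 < r) (hL : 1 < L)
    (hA : A ⊆ closedBall 0 (L - 1)) (hAm : MeasurableSet A) :
    ENNReal.ofReal (FF a A r L) ≤ surfaceMeasure (radMeasure d v) A := by
  have hL0 : 0 < L := by linarith
  have hAL : A ⊆ closedBall 0 L := hA.trans (closedBall_subset_closedBall (by linarith))
  have hμA := rad_apply ha hv hAL hAm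
  refine surf_ge (δ := fun ε => L ^ a * W a L * (volume.real (ball (0 : 𝔼) 1) * ((L + ε) ^ d - L ^ d))) ?_
    (by rw [hμA]; simp) ?_
  · have : Continuous fun ε => L ^ a * W a L * (volume.real (ball (0 : 𝔼) 1) * ((L + ε) ^ d - L ^ d)) := by
      fun_prop
    have := this.tendsto 0
    simp only [add_zero, sub_self, mul_zero] at this
    exact this.mono_left nhdsWithin_le_nhds
  · filter_upwards [Ioc_mem_nhdsGT (zero_lt_one' ℝ)] with ε hε
    have hTA : thickening ε A ⊆ closedBall 0 L := by
      refine (thickening_subset_of_subset _ hA).trans ?_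
      rw [thickening_closedBall hε.1 (by linarith)]
      exact ball_subset_closedBall.trans (closedBall_subset_closedBall (by linarith [hε.2]))
    have hTm : MeasurableSet (thickening ε A) := isOpen_thickening.measurableSet
    rw [hμA, rad_apply ha hv hTA hTm]
    have nn : 0 ≤ ∫ x in A, W a ‖x‖ := integral_nonneg fun x => (W_pos _ _).le
    have nn' : 0 ≤ ∫ x in thickening ε A, W a ‖x‖ := integral_nonneg fun x => (W_pos _ _).le
    have mono : ∫ x in A, W a ‖x‖ ≤ ∫ x in thickening ε A, W a ‖x‖ :=
      setIntegral_mono_set (intOn (W_cont ha) hTA) (Eventually.of_forall fun x => (W_pos _ _).le)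
        (self_subset_thickening hε.1 A).eventuallyLE
    suffices h : ε * (FF a A r L - L ^ a * W a L * (volume.real (ball (0 : 𝔼) 1) * ((L + ε) ^ d - L ^ d)))
        ≤ (∫ x in thickening ε A, W a ‖x‖) - ∫ x in A, W a ‖x‖ by
      calc _ ≤ ENNReal.ofReal ((∫ x in thickening ε A, W a ‖x‖) - ∫ x in A, W a ‖x‖) + ENNReal.ofReal (∫ x in A, W a ‖x‖) := by
            gcongr
        _ = _ := by rw [← ENNReal.ofReal_add (by linarith) nn]; congr 1; ring
    rw [mass_layer ha hL0.le hTA hTm, mass_layer ha hL0.le hAL hAm]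
    have z := layer_zero hd hr hL0 hAL hAm hε.1
    have se := shell_err ha hd hL0 hAL hAm hε.1 hε.2
    have hDs : closedBall (0 : 𝔼) (L + 1) \ A ⊆ closedBall 0 (L + 1) := sdiff_subset
    have anti := anti_vol hDs
    have anti2 : Antitone fun u : ℝ => volume.real ((closedBall (0 : 𝔼) (L + 1) \ A) \ closedBall (0 : 𝔼) (u + ε)) :=
      fun s t hst => anti (by linarith : s + ε ≤ t + ε)
    have iT : IntervalIntegrable (fun u => u ^ a * W a u * volume.real (thickening ε A \ closedBall 0 u)) volume 0 L :=
      ((anti_vol hTA).intervalIntegrable).continuousOn_mul (W'_cont ha).continuousOn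
    have iA : IntervalIntegrable (fun u => u ^ a * W a u * volume.real (A \ closedBall 0 u)) volume 0 L :=
      ((anti_vol hAL).intervalIntegrable).continuousOn_mul (W'_cont ha).continuousOn
    have iG : IntervalIntegrable (fun u => u ^ a * W a u * GG A r u) volume 0 L := GG_ii hr hAL (W'_cont ha) _ _
    have iC : IntervalIntegrable (fun u => u ^ a * W a u * (volume.real ((closedBall (0 : 𝔼) (L + 1) \ A) \ closedBall 0 u) -
      volume.real ((closedBall (0 : 𝔼) (L + 1) \ A) \ closedBall 0 (u + ε)))) volume 0 L :=
      ((anti.intervalIntegrable).sub (anti2.intervalIntegrable)).continuousOn_mul (W'_cont ha).continuousOn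
    have main : (∫ u in 0..L, u ^ a * W a u * volume.real (A \ closedBall 0 u)) +
       (ε * (∫ u in 0..L, u ^ a * W a u * GG A r u) - ∫ u in 0..L, u ^ a * W a u * (volume.real ((closedBall (0 : 𝔼) (L + 1) \ A) \ closedBall 0 u) -
      volume.real ((closedBall (0 : 𝔼) (L + 1) \ A) \ closedBall 0 (u + ε)))) ≤
       ∫ u in 0..L, u ^ a * W a u * volume.real (thickening ε A \ closedBall 0 u) := by
      rw [← intervalIntegral.integral_const_mul, ← intervalIntegral.integral_sub (iG.const_mul ε) iC,
        ← intervalIntegral.integral_add iA ((iG.const_mul ε).sub iC)]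
      refine intervalIntegral.integral_mono_on hL0.le (iA.add ((iG.const_mul ε).sub iC)) iT ?_
      intro u hu
      have h1 : 0 ≤ u ^ a * W a u := mul_nonneg (Real.rpow_nonneg hu.1 _) (W_pos _ _).le
      have := mul_le_mul_of_nonneg_left (layer_ineq hd hr hL0 hAL hAm hε.1 hε.2 hu.1 hu.2) h1
      linarith
    rw [FF]
    linarith
end S12

namespace S12

lemma bracket {a r q : ℝ} {d : ℕ} (ha : 2 ≤ a) (hr : 0 < r) (hR : (d : ℝ) + 2 ≤ a * r ^ (a + 1)) (hq : r ≤ q) :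
    0 ≤ a / q + q ^ a - r ^ a + (d - 1) / q - (d + 1) / r := by
  have hq0 : 0 < q := lt_of_lt_of_le hr hq
  obtain ⟨z, hz, hz0, hz1⟩ : ∃ z, z = r / q ∧ 0 < z ∧ z ≤ 1 :=
    ⟨r / q, rfl, by positivity, by rw [div_le_one hq0]; exact hq⟩
  have hqz : q = r / z := by rw [hz]; field_simp
  have hb : 1 + a * (1 / z - 1) ≤ (1 / z) ^ a := by
    have := one_add_mul_self_le_rpow_one_add (s := 1 / z - 1) (p := a) (by have : 0 < 1 / z := by positivity
                                                                           linarith) (by linarith)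
    simpa using this
  have hz2 : 1 - z ≤ 1 / z - 1 := by
    rw [← sub_nonneg]
    have : 1 / z - 1 - (1 - z) = (1 - z) ^ 2 / z := by field_simp
    rw [this]; positivity
  have hqa : q ^ a = r ^ a * (1 / z) ^ a := by
    rw [← Real.mul_rpow hr.le (by positivity), hqz]; congr 1; field_simp
  have hra : 0 < r ^ a := by positivity
  have hR' : (d : ℝ) + 2 ≤ a * (r ^ a * r) := by
    rwa [Real.rpow_add hr, Real.rpow_one] at hR
  have h3 : a * (1 - z) * (r ^ a) ≤ q ^ a - r ^ a := by
    rw [hqa]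
    have h : 1 + a * (1 - z) ≤ (1 / z) ^ a := by nlinarith
    nlinarith
  have h4 : ((d : ℝ) + 2) * (1 - z) ≤ (q ^ a - r ^ a) * r := by
    have : 0 ≤ 1 - z := by linarith
    nlinarith
  have e : a / q + q ^ a - r ^ a + (d - 1) / q - (d + 1) / r =
      ((q ^ a - r ^ a) * r + (a + d - 1) * z - (d + 1)) / r := by
    rw [hz]; field_simp; ring
  rw [e]
  apply div_nonneg _ hr.le
  nlinarith

lemma Phi {a r q : ℝ} {d : ℕ} (ha : 2 ≤ a) (hr : 0 < r) (hR : (d : ℝ) + 2 ≤ a * r ^ (a + 1)) (hq : r ≤ q) :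
    0 ≤ q ^ a * W a q - r ^ a * W a q + (∫ u in r..q, u ^ a * W a u * ((d - 1) / max u r - 1 / r)) -
      (d / r) * (W a q - W a r) := by
  have ha0 : 0 < a := by linarith
  have c1 := rho_cont hr
  have hc : Continuous fun u : ℝ => ((d : ℝ) - 1) / max u r - 1 / r := by
    have : (fun u : ℝ => ((d : ℝ) - 1) / max u r - 1 / r) = fun u => (d - 1) * (1 / max u r) - 1 / r := by
      ext u; ring
    rw [this]; fun_prop
  have i1 : IntervalIntegrable (fun u => u ^ a * W a u * (((d : ℝ) - 1) / max u r - 1 / r)) volume r q :=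
    ((W'_cont ha0).mul hc).intervalIntegrable _ _
  have i0 : IntervalIntegrable (fun u => u ^ a * W a u) volume r q := (W'_cont ha0).intervalIntegrable _ _
  have hwc := W_cont ha0
  have hpc := pow_cont ha0
  have hpc' : Continuous fun u : ℝ => u ^ (a - 1) := pow_cont (by linarith)
  have i2 : IntervalIntegrable (fun u => a * u ^ (a - 1) * W a u + u ^ a * (u ^ a * W a u) - r ^ a * (u ^ a * W a u)) volume r q := by
    apply Continuous.intervalIntegrable; fun_prop
  have f1 : ∫ u in r..q, (a * u ^ (a - 1) * W a u + u ^ a * (u ^ a * W a u) - r ^ a * (u ^ a * W a u)) =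
      (q ^ a * W a q - r ^ a * W a q) - (r ^ a * W a r - r ^ a * W a r) := by
    refine intervalIntegral.integral_eq_sub_of_hasDerivAt (f := fun u => u ^ a * W a u - r ^ a * W a u) (fun u hu => ?_) i2
    rw [uIcc_of_le hq] at hu
    exact ((Real.hasDerivAt_rpow_const (Or.inr (by linarith))).mul (W_hasDeriv ha0 u)).sub ((W_hasDeriv ha0 u).const_mul _)
  have e : q ^ a * W a q - r ^ a * W a q = ∫ u in r..q, (a * u ^ (a - 1) * W a u + u ^ a * (u ^ a * W a u) - r ^ a * (u ^ a * W a u)) := by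
    rw [f1]; ring
  rw [e, ← W_ftc ha0, ← intervalIntegral.integral_const_mul, ← intervalIntegral.integral_add i2 i1,
    ← intervalIntegral.integral_sub (i2.add i1) (i0.const_mul _)]
  refine intervalIntegral.integral_nonneg hq fun u hu => ?_
  have hu0 : 0 < u := lt_of_lt_of_le hr hu.1
  rw [max_eq_left hu.1]
  have hb := bracket ha hr hR hu.1
  have h1 : u ^ (a - 1) = u ^ a / u := by rw [Real.rpow_sub hu0, Real.rpow_one]
  have hW := W_pos a u
  have hp : 0 ≤ u ^ a * W a u := by positivity
  have := mul_nonneg hp hb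
  rw [h1]
  refine le_of_le_of_eq this ?_
  ring

lemma inner_ineq {a r s : ℝ} (ha : 1 ≤ a) (hr : 0 < r) (hs : 0 ≤ s) (hsr : s ≤ r) :
    0 ≤ r ^ a * W a s - s ^ a * W a s - (1 / r) * (W a s * (1 - W a s / W a r)) := by
  have ha0 : 0 < a := by linarith
  have e0 : W a s / W a r = Real.exp (s ^ (a + 1) / (a + 1) - r ^ (a + 1) / (a + 1)) := by
    unfold W; rw [Real.exp_sub]
  have h1 : 1 - W a s / W a r ≤ (r ^ (a + 1) - s ^ (a + 1)) / (a + 1) := by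
    rw [e0]
    have := Real.add_one_le_exp (s ^ (a + 1) / (a + 1) - r ^ (a + 1) / (a + 1))
    have e : (r ^ (a + 1) - s ^ (a + 1)) / (a + 1) = - (s ^ (a + 1) / (a + 1) - r ^ (a + 1) / (a + 1)) := by ring
    linarith
  have r1 : r ^ (a + 1) = r ^ a * r := Real.rpow_add_one' hr.le (by linarith)
  have s1 : s ^ (a + 1) = s ^ a * s := Real.rpow_add_one' hs (by linarith)
  have r2 : r ^ a = r ^ (a - 1) * r := by
    have := Real.rpow_add_one' (y := a - 1) hr.le (by linarith)
    rwa [sub_add_cancel] at this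
  have s2 : s ^ a = s ^ (a - 1) * s := by
    have := Real.rpow_add_one' (y := a - 1) hs (by linarith)
    rwa [sub_add_cancel] at this
  have pp : s ^ (a - 1) ≤ r ^ (a - 1) := by gcongr
  have pp0 : 0 ≤ s ^ (a - 1) := by positivity
  have h2 : s ^ (a - 1) * (r - s) ≤ r ^ a - s ^ a := by rw [r2, s2]; nlinarith
  have hd0 : 0 ≤ r - s := by linarith
  have h3 : s ^ a * (r - s) ≤ r * (r ^ a - s ^ a) := by
    calc s ^ a * (r - s) = s * (s ^ (a - 1) * (r - s)) := by rw [s2]; ring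
      _ ≤ r * (s ^ (a - 1) * (r - s)) := by gcongr
      _ ≤ _ := by gcongr
  have h4 : 0 ≤ r ^ a - s ^ a := le_trans (by positivity) h2
  have h5 : (r ^ (a + 1) - s ^ (a + 1)) / (a + 1) ≤ r * (r ^ a - s ^ a) := by
    rw [div_le_iff₀ (by linarith), r1, s1]
    nlinarith [mul_nonneg hr.le h4]
  have h6 : (1 / r) * (1 - W a s / W a r) ≤ r ^ a - s ^ a := by
    rw [div_mul_eq_mul_div, one_mul, div_le_iff₀ hr]; linarith
  have := mul_le_mul_of_nonneg_left h6 (W_pos a s).le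
  nlinarith

variable {d : ℕ}

local notation "𝔼" => EuclideanSpace ℝ (Fin d)

/-- Second moment bound. -/
lemma second_moment {a : ℝ} (ha : 0 < a) {S : Set 𝔼} {r β : ℝ} (hr : 0 < r) (hS : S ⊆ closedBall 0 r)
    (hSm : MeasurableSet S) (hβ : volume.real S ≤ β) :
    volume.real S ^ 2 + (∫ u in 0..r, u ^ a * W a u * volume.real (S \ closedBall 0 u) ^ 2) ≤
      (∫ x in S, W a ‖x‖) ^ 2 / W a r + β * ∫ x in S, W a ‖x‖ * (1 - W a ‖x‖ / W a r) := by
  set X := ∫ x in S, W a ‖x‖ with hX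
  set k : ℝ → ℝ := fun u => u ^ a * W a u * volume.real (S \ closedBall 0 u) with hk
  have ik : ∀ s t, IntervalIntegrable k volume s t := fun s t =>
    ((anti_vol hS).intervalIntegrable).continuousOn_mul (W'_cont ha).continuousOn
  have hml := mass_layer ha hr.le hS hSm
  have lc := LCset hr.le hS (fun x _ => norm_nonneg x) hSm (ik 0 r)
  have e1 : ∫ u in 0..r, u ^ a * W a u * volume.real (S \ closedBall 0 u) ^ 2 =
     ∫ u in 0..r, k u * volume.real (S \ closedBall 0 u) := by
    congr 1; ext u; simp only [hk]; ring
  rw [e1, ← lc]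
  have cG : Continuous fun s : ℝ => volume.real S + ∫ u in 0..s, k u :=
    continuous_const.add (intervalIntegral.continuous_primitive ik 0)
  have cW := W_cont ha
  have cR : Continuous fun s : ℝ => W a s * (X / W a r) + β * (W a s * (1 - W a s / W a r)) := by fun_prop
  have e2 : volume.real S ^ 2 + ∫ x in S, (∫ u in 0..‖x‖, k u) = ∫ x in S, (volume.real S + ∫ u in 0..‖x‖, k u) := by
    rw [integral_add (intOn (k := fun _ => volume.real S) continuous_const hS) (intOn (intervalIntegral.continuous_primitive ik 0) hS)]
    simp [sq]
  have e3 : X ^ 2 / W a r + β * ∫ x in S, W a ‖x‖ * (1 - W a ‖x‖ / W a r) =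
     ∫ x in S, (W a ‖x‖ * (X / W a r) + β * (W a ‖x‖ * (1 - W a ‖x‖ / W a r))) := by
    rw [integral_add (intOn (k := fun s => W a s * (X / W a r)) (by fun_prop) hS)
      (intOn (k := fun s => β * (W a s * (1 - W a s / W a r))) (by fun_prop) hS), integral_mul_const, integral_const_mul, ← hX]
    ring
  rw [e2, e3]
  refine setIntegral_mono_on (intOn cG hS) (intOn cR hS) hSm fun x hx => ?_
  have hxr : ‖x‖ ≤ r := by simpa using hS hx
  have kpos : ∀ u, 0 ≤ u → 0 ≤ k u := fun u hu =>
    mul_nonneg (mul_nonneg (Real.rpow_nonneg hu _) (W_pos _ _).le) measureReal_nonneg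
  have g1 : volume.real S + ∫ u in 0..‖x‖, k u ≤ X := by
    rw [hX, hml]
    have : (∫ u in 0..r, k u) = (∫ u in 0..‖x‖, k u) + ∫ u in ‖x‖..r, k u :=
      (intervalIntegral.integral_add_adjacent_intervals (ik _ _) (ik _ _)).symm
    have h2 : 0 ≤ ∫ u in ‖x‖..r, k u := intervalIntegral.integral_nonneg hxr fun u hu =>
      kpos u ((norm_nonneg x).trans hu.1)
    simp only [hk] at *
    linarith
  have g2 : volume.real S + ∫ u in 0..‖x‖, k u ≤ β * W a ‖x‖ := by
    have : (∫ u in 0..‖x‖, k u) ≤ ∫ u in 0..‖x‖, u ^ a * W a u * β := by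
      refine intervalIntegral.integral_mono_on (norm_nonneg x) (ik _ _)
        (((W'_cont ha).mul continuous_const).intervalIntegrable _ _) fun u hu => ?_
      refine mul_le_mul_of_nonneg_left ?_ (mul_nonneg (Real.rpow_nonneg hu.1 _) (W_pos _ _).le)
      exact (measureReal_mono sdiff_subset (vol_fin hS)).trans hβ
    rw [intervalIntegral.integral_mul_const, W_ftc ha, W_zero ha] at this
    linarith
  have hwr := W_pos a r
  have w1 : W a ‖x‖ / W a r ≤ 1 := by rw [div_le_one hwr]; exact W_mono ha (norm_nonneg _) hxr
  have w0 : 0 ≤ W a ‖x‖ / W a r := (div_pos (W_pos _ _) hwr).le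
  have e4 : W a ‖x‖ * (X / W a r) = (W a ‖x‖ / W a r) * X := by ring
  rw [e4]
  generalize W a ‖x‖ / W a r = t at *
  have a1 := mul_le_mul_of_nonneg_left g1 w0
  have a2 := mul_le_mul_of_nonneg_left g2 (sub_nonneg.2 w1)
  nlinarith

lemma final_arith {d : ℝ} {r β wr Q X Y J1 J2 KK ra M F : ℝ} (hr : 0 < r) (hβ : 0 < β) (hwr : 0 < wr)
    (hQ : 0 ≤ Q)
    (i : 0 ≤ J1 - ra * X + KK - (d / r) * (X - wr * Q))
    (ii : 0 ≤ ra * X - J2 - (1 / r) * Y)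
    (iii : M ≤ X ^ 2 / wr + β * Y)
    (iv : (1 / r) * (d * β * wr + (d - 1) * (Q * wr - X) - (Q ^ 2 * wr - 2 * Q * X + M) / β) + KK - J2 + J1 ≤ F)
    (v1 : Q * wr ≤ X) (v2 : X ≤ wr * β) : d * β * wr / r ≤ F := by
  have h1 : (Q ^ 2 * wr - 2 * Q * X + M) / β ≤ (X - wr * Q) + Y := by
    rw [div_le_iff₀ hβ]
    have e : Q ^ 2 * wr - 2 * Q * X + X ^ 2 / wr = (X - wr * Q) * ((X - wr * Q) / wr) := by field_simp; ring
    have h2 : (X - wr * Q) / wr ≤ β := by rw [div_le_iff₀ hwr]; nlinarith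
    have h3 : (X - wr * Q) * ((X - wr * Q) / wr) ≤ (X - wr * Q) * β :=
      mul_le_mul_of_nonneg_left h2 (by linarith)
    nlinarith
  have h2 : (1 / r) * (d * β * wr + (d - 1) * (Q * wr - X) - ((X - wr * Q) + Y)) ≤
     (1 / r) * (d * β * wr + (d - 1) * (Q * wr - X) - (Q ^ 2 * wr - 2 * Q * X + M) / β) := by
    refine mul_le_mul_of_nonneg_left (by linarith) (by positivity)
  have e : (1 / r) * (d * β * wr + (d - 1) * (Q * wr - X) - ((X - wr * Q) + Y)) =
    d * β * wr / r - (d / r) * (X - wr * Q) - (1 / r) * Y := by field_simp; ring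
  linarith

end S12

namespace S12

variable {d : ℕ}

local notation "𝔼" => EuclideanSpace ℝ (Fin d)

lemma NN_inner (hd : 1 ≤ d) {A : Set 𝔼} {r L u : ℝ} (hr : 0 < r) (hA : A ⊆ closedBall 0 L) (hAm : MeasurableSet A)
    (hur : u ≤ r) :
    NN A r u = volume.real (A \ closedBall 0 r) - volume.real ((closedBall 0 r \ A) \ closedBall 0 u) := by
  have hB : closedBall (0 : 𝔼) u ⊆ closedBall 0 r := closedBall_subset_closedBall hur
  have e : A ∪ closedBall 0 u = (A \ closedBall 0 r) ∪ (closedBall 0 r \ ((closedBall 0 r \ A) \ closedBall 0 u)) := by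
    ext x
    have := @hB x
    simp only [Set.mem_sdiff, Set.mem_union]
    tauto
  unfold NN
  rw [max_eq_right hur, ← ball_real hd hr.le, e, measureReal_union _ _ (vol_fin (sdiff_subset.trans hA)) (vol_fin sdiff_subset),
    measureReal_sdiff (s₁ := closedBall 0 r) (sdiff_subset.trans sdiff_subset)
      ((measurableSet_closedBall.diff hAm).diff measurableSet_closedBall) (vol_fin subset_rfl)]
  · ring
  · rw [Set.disjoint_left]
    rintro x ⟨_, h1⟩ ⟨h2, _⟩
    exact h1 h2
  · exact measurableSet_closedBall.diff ((measurableSet_closedBall.diff hAm).diff measurableSet_closedBall)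

lemma NN_outer (hd : 1 ≤ d) {A : Set 𝔼} {r L u : ℝ} (hr : 0 < r) (hA : A ⊆ closedBall 0 L) 
    (hur : r ≤ u) :
    NN A r u = volume.real ((A \ closedBall 0 r) \ closedBall 0 u) := by
  have hB : closedBall (0 : 𝔼) r ⊆ closedBall 0 u := closedBall_subset_closedBall hur
  have e : A ∪ closedBall 0 u = ((A \ closedBall 0 r) \ closedBall 0 u) ∪ closedBall 0 u := by
    ext x
    have := @hB x
    simp only [Set.mem_sdiff, Set.mem_union]
    tauto
  unfold NN
  rw [max_eq_left hur, ← ball_real hd (hr.le.trans hur), e, measureReal_union disjoint_sdiff_left measurableSet_closedBall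
    (vol_fin (sdiff_subset.trans (sdiff_subset.trans hA))) (vol_fin subset_rfl)]
  ring

lemma inner_part (hd : 1 ≤ d) {a : ℝ} (ha : 0 < a) {A : Set 𝔼} {r L : ℝ} (hr : 0 < r) (hA : A ⊆ closedBall 0 L)
    (hAm : MeasurableSet A) {β Q X : ℝ} (hβ : β = r ^ d * volume.real (ball (0 : 𝔼) 1)) (hQ : Q = volume.real (A \ closedBall 0 r))
    (hX : X = ∫ x in closedBall (0 : 𝔼) r \ A, W a ‖x‖) :
    GG A r 0 + (∫ u in 0..r, u ^ a * W a u * GG A r u) =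
    (1 / r) * (d * β * W a r + (d - 1) * (Q * W a r - X) - (Q ^ 2 * W a r - 2 * Q * X +
      (volume.real (closedBall (0 : 𝔼) r \ A) ^ 2 + ∫ u in 0..r, u ^ a * W a u * volume.real ((closedBall (0 : 𝔼) r \ A) \ closedBall 0 u) ^ 2)) / β) := by
  have : Nonempty (Fin d) := ⟨⟨0, by omega⟩⟩
  have hS : closedBall (0 : 𝔼) r \ A ⊆ closedBall 0 r := sdiff_subset
  have hSm : MeasurableSet (closedBall (0 : 𝔼) r \ A) := measurableSet_closedBall.diff hAm
  have hml := mass_layer ha hr.le hS hSm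
  rw [← hX] at hml
  have hx0 : volume.real ((closedBall (0 : 𝔼) r \ A) \ closedBall 0 0) = volume.real (closedBall (0 : 𝔼) r \ A) := by
    rw [closedBall_zero]
    unfold Measure.real
    rw [measure_sdiff_null (by simp)]
  have hG : ∀ u, u ≤ r → GG A r u = (1 / r) * (d * β + (d - 1) * (Q - volume.real ((closedBall (0 : 𝔼) r \ A) \ closedBall 0 u)) -
     (Q - volume.real ((closedBall (0 : 𝔼) r \ A) \ closedBall 0 u)) ^ 2 / β) := by
    intro u hu
    rw [GG, NN_inner hd hr hA hAm hu, max_eq_right hu, ← hβ, ← hQ]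
  rw [hG 0 hr.le, hx0]
  set x0 := volume.real (closedBall (0 : 𝔼) r \ A)
  have hanti := anti_vol hS
  have hanti2 : Antitone fun u : ℝ => volume.real ((closedBall (0 : 𝔼) r \ A) \ closedBall (0 : 𝔼) u) ^ 2 :=
    fun u v huv => pow_le_pow_left₀ measureReal_nonneg (hanti huv) 2
  set xx := fun u : ℝ => volume.real ((closedBall (0 : 𝔼) r \ A) \ closedBall (0 : 𝔼) u) with hxx
  have i1 : IntervalIntegrable (fun u => u ^ a * W a u * xx u) volume 0 r := 
    (hanti.intervalIntegrable).continuousOn_mul (W'_cont ha).continuousOn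
  have i2 : IntervalIntegrable (fun u => u ^ a * W a u * xx u ^ 2) volume 0 r := 
    (hanti2.intervalIntegrable).continuousOn_mul (W'_cont ha).continuousOn
  have i0 : IntervalIntegrable (fun u => u ^ a * W a u) volume 0 r := (W'_cont ha).intervalIntegrable _ _
  have e1 : ∫ u in 0..r, u ^ a * W a u * GG A r u = ∫ u in 0..r, (((1 / r) * (d * β + (d - 1) * Q - Q ^ 2 / β)) * (u ^ a * W a u)
     + ((1 / r) * (- (d - 1) + 2 * Q / β)) * (u ^ a * W a u * xx u) + (- (1 / r) / β) * (u ^ a * W a u * xx u ^ 2)) := by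
    refine intervalIntegral.integral_congr fun u hu => ?_
    rw [uIcc_of_le hr.le] at hu
    simp only [hG u hu.2, hxx]
    ring
  have hw := W_ftc ha 0 r
  rw [W_zero ha] at hw
  rw [e1, intervalIntegral.integral_add ((i0.const_mul _).add (i1.const_mul _)) (i2.const_mul _),
    intervalIntegral.integral_add (i0.const_mul _) (i1.const_mul _), intervalIntegral.integral_const_mul,
    intervalIntegral.integral_const_mul, intervalIntegral.integral_const_mul, hw]
  have hml' : (∫ u in 0..r, u ^ a * W a u * xx u) = X - x0 := by simp only [hxx]; linarith
  rw [hml']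
  simp only [hxx]
  ring

lemma outer_part (hd : 1 ≤ d) {a : ℝ} (ha : 0 < a) {A : Set 𝔼} {r L : ℝ} (hr : 0 < r) (hrL : r ≤ L) (hA : A ⊆ closedBall 0 L)
    (hAm : MeasurableSet A) (hQ : volume.real (A \ closedBall 0 r) ≤ r ^ d * volume.real (ball (0 : 𝔼) 1)) :
    (∫ x in closedBall (0 : 𝔼) L \ closedBall 0 r, ‖x‖ ^ a * W a ‖x‖) + 
      (∫ x in A \ closedBall 0 r, (∫ u in r..‖x‖, u ^ a * W a u * ((d - 1) / max u r - 1 / r))) ≤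
      ∫ u in r..L, u ^ a * W a u * GG A r u := by
  have hS : A \ closedBall 0 r ⊆ closedBall 0 L := sdiff_subset.trans hA
  have hSm : MeasurableSet (A \ closedBall 0 r) := hAm.diff measurableSet_closedBall
  have c1 := rho_cont hr
  have cW' := W'_cont ha
  have hc : Continuous fun u : ℝ => u ^ a * W a u * (((d : ℝ) - 1) / max u r - 1 / r) := by
    have : (fun u : ℝ => u ^ a * W a u * (((d : ℝ) - 1) / max u r - 1 / r)) = fun u => u ^ a * W a u * ((d - 1) * (1 / max u r) - 1 / r) := by
      ext u; ring
    rw [this]; fun_prop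
  rw [radial hd (k := fun u => u ^ a * W a u) hr.le hrL, LCset hrL hS (fun x hx => ?_) hSm (hc.intervalIntegrable _ _)]
  swap
  · have := hx.2
    simp at this
    exact this.le
  have i2 : IntervalIntegrable (fun u : ℝ => u ^ a * W a u * (((d : ℝ) - 1) / max u r - 1 / r) * volume.real ((A \ closedBall 0 r) \ closedBall 0 u)) volume r L :=
    ((anti_vol hS).intervalIntegrable).continuousOn_mul hc.continuousOn
  have i1 : IntervalIntegrable (fun u : ℝ => u ^ a * W a u * (d * volume.real (ball (0 : 𝔼) 1) * u ^ (d - 1))) volume r L := by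
    apply Continuous.intervalIntegrable; fun_prop
  rw [← intervalIntegral.integral_add i1 i2]
  refine intervalIntegral.integral_mono_on hrL (i1.add i2) (GG_ii hr hA cW' _ _) fun u hu => ?_
  have hu0 : 0 < u := lt_of_lt_of_le hr hu.1
  have hq0 : 0 ≤ volume.real ((A \ closedBall 0 r) \ closedBall 0 u) := measureReal_nonneg
  have hq1 : volume.real ((A \ closedBall 0 r) \ closedBall 0 u) ≤ volume.real (A \ closedBall 0 r) :=
    measureReal_mono sdiff_subset (vol_fin hS)
  rw [GG, NN_outer hd hr hA hu.1, max_eq_left hu.1]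
  generalize volume.real ((A \ closedBall 0 r) \ closedBall 0 u) = q at *
  have hω := om_pos (d := d)
  generalize volume.real (ball (0 : 𝔼) 1) = ω at *
  have hp : u ^ d = u ^ (d - 1) * u := by rw [← pow_succ]; congr 1; omega
  have h1 : q ^ 2 / (u ^ d * ω) ≤ q := by
    rw [div_le_iff₀ (by positivity)]
    have : r ^ d * ω ≤ u ^ d * ω := by have := hu.1; gcongr
    nlinarith
  have h2 : 1 / u * (q ^ 2 / (u ^ d * ω)) ≤ 1 / r * q := by
    have := hu.1
    gcongr
  have h3 : d * ω * u ^ (d - 1) + ((d - 1) / u - 1 / r) * q ≤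
     1 / u * (d * (u ^ d * ω) + (d - 1) * q - q ^ 2 / (u ^ d * ω)) := by
    have e : 1 / u * (d * (u ^ d * ω) + (d - 1) * q - q ^ 2 / (u ^ d * ω)) = 
       d * ω * u ^ (d - 1) + ((d - 1) / u) * q - 1 / u * (q ^ 2 / (u ^ d * ω)) := by
      rw [mul_sub, hp]; field_simp
    rw [e]; linarith
  have := mul_le_mul_of_nonneg_left h3 (mul_nonneg (Real.rpow_nonneg hu0.le a) (W_pos a u).le)
  refine le_trans (le_of_eq ?_) this
  ring

lemma setInt_diff {f : 𝔼 → ℝ} {A B : Set 𝔼} (hA : MeasurableSet A) (hB : MeasurableSet B)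
    (h : IntegrableOn f (A ∪ B)) : 
    (∫ x in A, f x) - ∫ x in B, f x = (∫ x in A \ B, f x) - ∫ x in B \ A, f x := by
  have h1 := integral_inter_add_sdiff hB (h.mono_set (subset_union_left (s := A) (t := B)))
  have h2 := integral_inter_add_sdiff hA (h.mono_set (subset_union_right (s := A) (t := B)))
  rw [inter_comm] at h2
  linarith

theorem caseII (hd : 1 ≤ d) {a : ℝ} (ha : 2 ≤ a) {A : Set 𝔼} {r L : ℝ} (hr : 0 < r) (hR : (d : ℝ) + 2 ≤ a * r ^ (a + 1))
    (hrL : r ≤ L) (hA : A ⊆ closedBall 0 L)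
    (hAm : MeasurableSet A) (hm : ∫ x in A, W a ‖x‖ = ∫ x in closedBall (0 : 𝔼) r, W a ‖x‖) :
    d * volume.real (ball (0 : 𝔼) 1) * r ^ (d - 1) * W a r ≤ FF a A r L := by
  have ha0 : 0 < a := by linarith
  have hω := om_pos (d := d)
  have cW := W_cont ha0
  have cW' := W'_cont ha0
  have cp := pow_cont ha0
  have hBm : MeasurableSet (closedBall (0 : 𝔼) r) := measurableSet_closedBall
  have hBL : closedBall (0 : 𝔼) r ⊆ closedBall 0 L := closedBall_subset_closedBall hrL
  have hAB : A \ closedBall 0 r ⊆ closedBall 0 L := sdiff_subset.trans hA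
  have hBA : closedBall 0 r \ A ⊆ closedBall (0 : 𝔼) r := sdiff_subset
  have hABm : MeasurableSet (A \ closedBall 0 r) := hAm.diff hBm
  have hBAm : MeasurableSet (closedBall 0 r \ A) := hBm.diff hAm
  have hXX : ∫ x in A \ closedBall 0 r, W a ‖x‖ = ∫ x in closedBall 0 r \ A, W a ‖x‖ := by
    have := setInt_diff hAm hBm (intOn cW (union_subset hA hBL))
    linarith
  obtain ⟨X, hX⟩ : ∃ X, X = ∫ x in closedBall (0 : 𝔼) r \ A, W a ‖x‖ := ⟨_, rfl⟩
  obtain ⟨Q, hQ⟩ : ∃ Q, Q = volume.real (A \ closedBall 0 r) := ⟨_, rfl⟩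
  obtain ⟨β, hβ⟩ : ∃ β, β = r ^ d * volume.real (ball (0 : 𝔼) 1) := ⟨_, rfl⟩
  have hβ0 : 0 < β := by rw [hβ]; positivity
  have hBr : volume.real (closedBall (0 : 𝔼) r) = β := by rw [hβ, ball_real hd hr.le]
  have hwr := W_pos a r
  have hout : ∀ x ∈ A \ closedBall 0 r, r ≤ ‖x‖ := fun x hx => by
    have := hx.2
    simp at this
    exact this.le
  have hin : ∀ x ∈ closedBall 0 r \ A, ‖x‖ ≤ r := fun x hx => by simpa using hx.1
  have cst : ∀ {S : Set 𝔼} {c : ℝ}, ∫ _x in S, c = volume.real S * c := by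
    intro S c; simp
  have v1 : Q * W a r ≤ X := by
    rw [hX, ← hXX, hQ, ← cst]
    exact setIntegral_mono_on (intOn (k := fun _ => W a r) continuous_const hAB) (intOn cW hAB) hABm
      fun x hx => W_mono ha0 hr.le (hout x hx)
  have v2 : X ≤ W a r * β := by
    have : X ≤ volume.real (closedBall 0 r \ A) * W a r := by
      rw [hX, ← cst]
      exact setIntegral_mono_on (intOn cW hBA) (intOn (k := fun _ => W a r) continuous_const hBA) hBAm
        fun x hx => W_mono ha0 (norm_nonneg _) (hin x hx)
    have h2 : volume.real (closedBall 0 r \ A) ≤ β := by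
      rw [← hBr]; exact measureReal_mono hBA (vol_fin subset_rfl)
    nlinarith
  have hQβ : Q ≤ β := by
    have : Q * W a r ≤ β * W a r := by linarith
    exact le_of_mul_le_mul_right this hwr
  have inn := inner_part hd ha0 hr hA hAm hβ hQ hX
  have out := outer_part hd ha0 hr hrL hA hAm (by rw [← hQ, ← hβ]; exact hQβ)
  have hM := second_moment ha0 hr hBA hBAm (β := β) (by
      rw [← hBr]; exact measureReal_mono hBA (vol_fin subset_rfl))
  rw [← hX] at hM
  have hJ : ∫ x in closedBall (0 : 𝔼) L \ A, ‖x‖ ^ a * W a ‖x‖ =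
     (∫ x in closedBall (0 : 𝔼) L \ closedBall 0 r, ‖x‖ ^ a * W a ‖x‖) + (∫ x in closedBall 0 r \ A, ‖x‖ ^ a * W a ‖x‖) -
      ∫ x in A \ closedBall 0 r, ‖x‖ ^ a * W a ‖x‖ := by
    have h0 := intOn cW' (subset_refl (closedBall (0 : 𝔼) L))
    have h1 := setInt_diff measurableSet_closedBall hAm (h0.mono_set (union_subset subset_rfl hA))
    have h2 := setInt_diff measurableSet_closedBall hBm (h0.mono_set (union_subset subset_rfl hBL))
    have h3 := setInt_diff hAm hBm (h0.mono_set (union_subset hA hBL))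
    rw [sdiff_eq_empty.2 hA] at h1
    rw [sdiff_eq_empty.2 hBL] at h2
    simp only [Measure.restrict_empty, integral_zero_measure] at h1 h2
    linarith
  have c1 := rho_cont hr
  have hc : Continuous fun u : ℝ => u ^ a * W a u * (((d : ℝ) - 1) / max u r - 1 / r) := by
    have : (fun u : ℝ => u ^ a * W a u * (((d : ℝ) - 1) / max u r - 1 / r)) = fun u => u ^ a * W a u * ((d - 1) * (1 / max u r) - 1 / r) := by
      ext u; ring
    rw [this]; fun_prop
  have hK := intervalIntegral.continuous_primitive (μ := volume) (fun s t => hc.intervalIntegrable s t) r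
  have i : 0 ≤ (∫ x in A \ closedBall 0 r, ‖x‖ ^ a * W a ‖x‖) - r ^ a * X + 
      (∫ x in A \ closedBall 0 r, (∫ u in r..‖x‖, u ^ a * W a u * ((d - 1) / max u r - 1 / r))) - (d / r) * (X - W a r * Q) := by
    have h : 0 ≤ ∫ x in A \ closedBall 0 r, (‖x‖ ^ a * W a ‖x‖ - r ^ a * W a ‖x‖ + (∫ u in r..‖x‖, u ^ a * W a u * ((d - 1) / max u r - 1 / r)) -
      (d / r) * (W a ‖x‖ - W a r)) := setIntegral_nonneg hABm fun x hx => Phi ha hr hR (hout x hx)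
    have j1 := intOn cW' hAB
    have j2 := intOn (k := fun u => r ^ a * W a u) (by fun_prop) hAB
    have j3 := intOn hK hAB
    have j5 := intOn cW hAB
    have j6 := intOn (k := fun u => W a r) (by fun_prop) hAB
    have j4 := (j5.sub j6).const_mul (d / r)
    have e := integral_sub ((j1.sub j2).add j3) j4
    have e' := integral_add (j1.sub j2) j3
    have e'' := integral_sub j1 j2
    have e3 := integral_sub j5 j6
    simp only [Pi.sub_apply, Pi.add_apply] at e e' 
    rw [e, e', e'', integral_const_mul, integral_const_mul, e3, cst, hXX, ← hX, ← hQ] at h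
    linarith
  have ii : 0 ≤ r ^ a * X - (∫ x in closedBall 0 r \ A, ‖x‖ ^ a * W a ‖x‖) - (1 / r) * 
      ∫ x in closedBall (0 : 𝔼) r \ A, W a ‖x‖ * (1 - W a ‖x‖ / W a r) := by
    have h : 0 ≤ ∫ x in closedBall (0 : 𝔼) r \ A, (r ^ a * W a ‖x‖ - ‖x‖ ^ a * W a ‖x‖ - (1 / r) * (W a ‖x‖ * (1 - W a ‖x‖ / W a r))) :=
      setIntegral_nonneg hBAm fun x hx => inner_ineq (by linarith) hr (norm_nonneg x) (hin x hx)
    have j1 := intOn cW' hBA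
    have j2 := intOn (k := fun u => r ^ a * W a u) (by fun_prop) hBA
    have j3 := (intOn (k := fun u => W a u * (1 - W a u / W a r)) (by fun_prop) hBA).const_mul (1 / r)
    have e := integral_sub (j2.sub j1) j3
    have e' := integral_sub j2 j1
    simp only [Pi.sub_apply] at e
    rw [e, e', integral_const_mul, integral_const_mul, ← hX] at h
    exact h
  have iv : FF a A r L = (GG A r 0 + (∫ u in 0..r, u ^ a * W a u * GG A r u)) + (∫ u in r..L, u ^ a * W a u * GG A r u) - 
    ∫ x in closedBall (0 : 𝔼) L \ A, ‖x‖ ^ a * W a ‖x‖ := by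
    rw [FF, ← intervalIntegral.integral_add_adjacent_intervals (GG_ii hr hA cW' 0 r) (GG_ii hr hA cW' r L)]
    ring
  have fin := final_arith (d := d) (F := FF a A r L) hr hβ0 hwr (Q := Q) (by rw [hQ]; exact measureReal_nonneg) i ii hM (by
    rw [iv, ← inn, hJ]; linarith) v1 v2
  refine le_trans (le_of_eq ?_) fin
  have hp : r ^ d = r ^ (d - 1) * r := by rw [← pow_succ]; congr 1; omega
  rw [hβ, hp]; field_simp

end S12

namespace S12

/-- Derivative of the radial calibration profile. -/
noncomputable def pp (r u : ℝ) : ℝ := (3 / r - 3 * (min |u| r) ^ 2 / r ^ 3) / 2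

/-- The radial profile. -/
noncomputable def ph (r u : ℝ) : ℝ := ∫ t in 0..u, pp r t

/-- The profile divided by the radius. -/
noncomputable def ps (r u : ℝ) : ℝ := (3 / r - (min |u| r) ^ 2 / r ^ 3) / 2 * (r * (1 / max u r))

/-- The weighted divergence of the radial field. -/
noncomputable def DD (d : ℕ) (a r u : ℝ) : ℝ := pp r u + (d - 1) * ps r u + u * ps r u * u ^ a

lemma pp_cont (r : ℝ) : Continuous (pp r) := by unfold pp; fun_prop

lemma ps_cont {r : ℝ} (hr : 0 < r) : Continuous (ps r) := by
  have := rho_cont hr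
  unfold ps; fun_prop

lemma DD_cont (d : ℕ) {a r : ℝ} (ha : 0 < a) (hr : 0 < r) : Continuous (DD d a r) := by
  have := ps_cont hr
  have := pp_cont r
  have := pow_cont ha
  unfold DD; fun_prop

lemma pp_nonneg {r : ℝ} (hr : 0 < r) (u : ℝ) : 0 ≤ pp r u := by
  have h0 : 0 ≤ min |u| r := le_min (abs_nonneg u) hr.le
  have h1 : min |u| r ≤ r := min_le_right _ _
  unfold pp
  have : 3 / r - 3 * (min |u| r) ^ 2 / r ^ 3 = 3 * (r ^ 2 - (min |u| r) ^ 2) / r ^ 3 := by field_simp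
  rw [this]
  have : 0 ≤ r ^ 2 - (min |u| r) ^ 2 := by nlinarith
  positivity

lemma ps_nonneg {r : ℝ} (hr : 0 < r) (u : ℝ) : 0 ≤ ps r u := by
  have h0 : 0 ≤ min |u| r := le_min (abs_nonneg u) hr.le
  have h1 : min |u| r ≤ r := min_le_right _ _
  unfold ps
  have : 3 / r - (min |u| r) ^ 2 / r ^ 3 = (3 * r ^ 2 - (min |u| r) ^ 2) / r ^ 3 := by field_simp
  rw [this]
  have : 0 ≤ 3 * r ^ 2 - (min |u| r) ^ 2 := by nlinarith
  have : 0 < max u r := lt_max_of_lt_right hr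
  positivity

lemma ph_deriv (r u : ℝ) : HasDerivAt (ph r) (pp r u) u :=
  intervalIntegral.integral_hasDerivAt_right ((pp_cont r).intervalIntegrable _ _)
    (pp_cont r).aestronglyMeasurable.stronglyMeasurableAtFilter (pp_cont r).continuousAt

lemma ph_zero (r : ℝ) : ph r 0 = 0 := by simp [ph]

lemma pp_in {r u : ℝ} (h0 : 0 ≤ u) (hu : u ≤ r) : pp r u = (3 / r - 3 * u ^ 2 / r ^ 3) / 2 := by
  rw [pp, abs_of_nonneg h0, min_eq_left hu]

lemma ph_in {r u : ℝ} (h0 : 0 ≤ u) (hu : u ≤ r) : ph r u = (3 / r * u - u ^ 3 / r ^ 3) / 2 := by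
  have := intervalIntegral.integral_eq_sub_of_hasDerivAt (a := 0) (b := u) (f := fun t => (3 / r * t - t ^ 3 / r ^ 3) / 2)
    (f' := pp r) (fun t ht => ?_) ((pp_cont r).intervalIntegrable _ _)
  · rw [ph, this]; simp
  · rw [uIcc_of_le h0] at ht
    rw [pp_in ht.1 (ht.2.trans hu)]
    have := (((hasDerivAt_id t).const_mul (3 / r)).sub ((hasDerivAt_pow 3 t).div_const (r ^ 3))).div_const 2
    refine this.congr_deriv ?_
    simp

lemma pp_out {r u : ℝ} (hr : 0 < r) (hu : r ≤ u) : pp r u = 0 := by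
  rw [pp, abs_of_nonneg (hr.le.trans hu), min_eq_right hu]
  field_simp; ring

lemma ph_out {r u : ℝ} (hr : 0 < r) (hu : r ≤ u) : ph r u = 1 := by
  have h1 : ph r u = ph r r + ∫ t in r..u, pp r t :=
    (intervalIntegral.integral_add_adjacent_intervals ((pp_cont r).intervalIntegrable _ _) ((pp_cont r).intervalIntegrable _ _)).symm
  have h2 : ∫ t in r..u, pp r t = ∫ t in r..u, 0 := intervalIntegral.integral_congr fun t ht => by
    rw [uIcc_of_le hu] at ht
    exact pp_out hr ht.1
  rw [h1, h2, ph_in hr.le le_rfl]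
  simp
  field_simp; norm_num

lemma ph_ps {r u : ℝ} (hr : 0 < r) (h0 : 0 ≤ u) : ph r u = u * ps r u := by
  rcases le_total u r with h | h
  · rw [ph_in h0 h, ps, abs_of_nonneg h0, min_eq_left h, max_eq_right h]
    field_simp
  · have : 0 < u := hr.trans_le h
    rw [ph_out hr h, ps, abs_of_nonneg h0, min_eq_right h, max_eq_left h]
    field_simp; norm_num

lemma ph_le_one {r u : ℝ} (hr : 0 < r) (h0 : 0 ≤ u) : ph r u ≤ 1 := by
  rcases le_total u r with h | h
  · rw [ph_in h0 h]
    obtain ⟨z, hz⟩ : ∃ z, z = u / r := ⟨_, rfl⟩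
    have hz0 : 0 ≤ z := by rw [hz]; positivity
    have : (3 / r * u - u ^ 3 / r ^ 3) / 2 = (3 * z - z ^ 3) / 2 := by rw [hz]; field_simp
    rw [this]
    nlinarith [mul_nonneg (sq_nonneg (1 - z)) (by linarith : 0 ≤ z + 2)]
  · exact (ph_out hr h).le

lemma DD_nonneg {d : ℕ} (hd : 1 ≤ d) {a r u : ℝ} (hr : 0 < r) (h0 : 0 ≤ u) : 0 ≤ DD d a r u := by
  have h1 := pp_nonneg hr u
  have h2 := ps_nonneg hr u
  have h3 : (0 : ℝ) ≤ d - 1 := by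
    have : (1 : ℝ) ≤ d := by exact_mod_cast hd
    linarith
  have h4 := Real.rpow_nonneg h0 a
  unfold DD; positivity

lemma DD_out {d : ℕ} (hd : 1 ≤ d) {a r u : ℝ} (ha : 0 < a) (hr : 0 < r) (hR : (d : ℝ) + 2 ≤ a * r ^ (a + 1)) (hu : r ≤ u) :
    (d - 1) / r + r ^ a ≤ DD d a r u := by
  have hu0 : 0 < u := hr.trans_le hu
  have e1 : u * ps r u = 1 := by rw [← ph_ps hr hu0.le, ph_out hr hu]
  have e2 : ps r u = 1 / u := by field_simp; linarith
  rw [DD, pp_out hr hu, e1, e2]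
  obtain ⟨q, hq⟩ : ∃ q, q = u / r := ⟨_, rfl⟩
  have hq1 : 1 ≤ q := by rw [hq, one_le_div hr]; exact hu
  have huq : u = r * q := by rw [hq]; field_simp
  have hqa : u ^ a = r ^ a * q ^ a := by rw [huq, Real.mul_rpow hr.le (by linarith)]
  have h1 : 1 + a * (1 - 1 / q) ≤ q ^ a := by
    rw [Real.rpow_def_of_pos (by linarith)]
    have h := Real.add_one_le_exp (Real.log q * a)
    have h2 := Real.one_sub_inv_le_log_of_pos (by linarith : 0 < q)
    rw [one_div]
    nlinarith
  have hR' : (d : ℝ) + 2 ≤ a * (r ^ a * r) := by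
    rwa [Real.rpow_add hr, Real.rpow_one] at hR
  have hra : 0 < r ^ a := by positivity
  have h2 : 0 ≤ 1 - 1 / q := by
    have : 1 / q ≤ 1 := by rw [div_le_one (by linarith)]; exact hq1
    linarith
  have h3 : ((d : ℝ) + 2) * (1 - 1 / q) ≤ r * (u ^ a - r ^ a) := by
    calc ((d : ℝ) + 2) * (1 - 1 / q) ≤ a * (r ^ a * r) * (1 - 1 / q) := by gcongr
      _ = r * r ^ a * (a * (1 - 1 / q)) := by ring
      _ ≤ r * r ^ a * (q ^ a - 1) := by gcongr; linarith
      _ = _ := by rw [hqa]; ring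
  have h4 : ((d : ℝ) - 1) * (1 - 1 / q) ≤ r * (u ^ a - r ^ a) := by nlinarith
  have h5 : ((d : ℝ) - 1) * (1 - 1 / q) = r * ((d - 1) / r - (d - 1) * (1 / u)) := by
    rw [huq]; field_simp
  rw [h5] at h4
  have := le_of_mul_le_mul_left h4 hr
  linarith

lemma DD_in {d : ℕ} {a r u : ℝ} (ha : 0 < a) (ha2 : a ≤ 2) (hr : 0 < r) (hR : (d : ℝ) + 2 ≤ a * r ^ (a + 1))
    (h0 : 0 ≤ u) (hu : u ≤ r) :
    DD d a r u ≤ (d - 1) / r + r ^ a := by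
  obtain ⟨z, hz⟩ : ∃ z, z = u / r := ⟨_, rfl⟩
  have hz0 : 0 ≤ z := by rw [hz]; positivity
  have hz1 : z ≤ 1 := by rw [hz, div_le_one hr]; exact hu
  have huz : u = r * z := by rw [hz]; field_simp
  have hR' : (d : ℝ) + 2 ≤ a * (r ^ a * r) := by
    rwa [Real.rpow_add hr, Real.rpow_one] at hR
  have hra : 0 < r ^ a := by positivity
  have hza0 : 0 ≤ z ^ a := by positivity
  have hza : z ^ a ≤ (1 - a / 2) + a / 2 * z ^ 2 := by
    have := Real.geom_mean_le_arith_mean2_weighted (w₁ := 1 - a / 2) (w₂ := a / 2) (p₁ := 1) (p₂ := z ^ 2)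
      (by linarith) (by linarith) zero_le_one (by positivity) (by ring)
    rw [Real.one_rpow, ← Real.rpow_natCast, ← Real.rpow_mul hz0] at this
    have e : ((2 : ℕ) : ℝ) * (a / 2) = a := by push_cast; ring
    rw [e, Real.rpow_natCast] at this
    linarith
  have key : a * (1 - z ^ 2) ≤ 2 - z * z ^ a * (3 - z ^ 2) := by
    have h3 : 0 ≤ z * (3 - z ^ 2) := mul_nonneg hz0 (by nlinarith)
    have h4 := mul_le_mul_of_nonneg_left hza h3
    have h5 : 0 ≤ (1 - a / 2) * ((1 - z) ^ 2 * (z + 2)) := by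
      have : 0 ≤ 1 - a / 2 := by linarith
      positivity
    have h6 : 0 ≤ a / 2 * (z ^ 2 * ((1 - z) ^ 2 * (z + 2))) := by positivity
    nlinarith
  have h1 : ((d : ℝ) + 2) * (1 - z ^ 2) ≤ (r ^ a * r) * (2 - z * z ^ a * (3 - z ^ 2)) := by
    have : 0 ≤ 1 - z ^ 2 := by nlinarith
    calc ((d : ℝ) + 2) * (1 - z ^ 2) ≤ a * (r ^ a * r) * (1 - z ^ 2) := by gcongr
      _ = (r ^ a * r) * (a * (1 - z ^ 2)) := by ring
      _ ≤ _ := by gcongr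
  have e1 : ps r u = (3 - z ^ 2) / 2 / r := by
    rw [ps, abs_of_nonneg h0, min_eq_left hu, max_eq_right hu, huz]; field_simp
  have e2 : pp r u = 3 * (1 - z ^ 2) / 2 / r := by
    rw [pp_in h0 hu, huz]; field_simp
  have e3 : u ^ a = r ^ a * z ^ a := by rw [huz, Real.mul_rpow hr.le hz0]
  have e4 : DD d a r u = (3 * (1 - z ^ 2) / 2 + (d - 1) * ((3 - z ^ 2) / 2) + (r ^ a * r) * (z * z ^ a) * ((3 - z ^ 2) / 2)) / r := by
    rw [DD, e1, e2, e3, huz]; field_simp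
  have e5 : (d - 1) / r + r ^ a = ((d - 1) + r ^ a * r) / r := by field_simp
  rw [e4, e5]
  refine div_le_div_of_nonneg_right ?_ hr.le
  nlinarith

lemma pointwise {d : ℕ} (hd : 1 ≤ d) {a r u s : ℝ} (ha : 0 < a) (hr : 0 < r) (hu : 0 < u) (hs : 0 ≤ s) :
    u ^ (d - 1) * (W a u * (1 + s * DD d a r u)) ≤
      |1 + s * pp r u| * ((u + s * ph r u) ^ (d - 1) * W a (u + s * ph r u)) := by
  have h1 := pp_nonneg hr u
  have h2 := ps_nonneg hr u
  have h3 : (0 : ℝ) ≤ d - 1 := by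
    have : (1 : ℝ) ≤ d := by exact_mod_cast hd
    linarith
  have eT : u + s * ph r u = u * (1 + s * ps r u) := by rw [ph_ps hr hu.le]; ring
  have hsp : 0 ≤ s * ps r u := by positivity
  have hspp : 0 ≤ s * pp r u := by positivity
  rw [eT, abs_of_nonneg (by linarith), mul_pow]
  have b1 : 1 + (d - 1) * (s * ps r u) ≤ (1 + s * ps r u) ^ (d - 1) := by
    have := one_add_mul_le_pow (a := s * ps r u) (by linarith) (d - 1)
    rwa [Nat.cast_sub hd, Nat.cast_one] at this
  have b2 : W a u * (1 + s * (u * ps r u * u ^ a)) ≤ W a (u * (1 + s * ps r u)) := by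
    have hB : 1 + (a + 1) * (s * ps r u) ≤ (1 + s * ps r u) ^ (a + 1) :=
      one_add_mul_self_le_rpow_one_add (by linarith) (by linarith)
    have e : W a (u * (1 + s * ps r u)) = W a u * Real.exp (u ^ (a + 1) * ((1 + s * ps r u) ^ (a + 1) - 1) / (a + 1)) := by
      unfold W
      rw [← Real.exp_add, Real.mul_rpow hu.le (by linarith)]
      congr 1; ring
    rw [e]
    have hua : u ^ (a + 1) = u ^ a * u := by rw [Real.rpow_add hu, Real.rpow_one]
    have := W_pos a u
    gcongr
    refine le_trans ?_ (Real.add_one_le_exp _)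
    have : u ^ (a + 1) * ((a + 1) * (s * ps r u)) / (a + 1) ≤ u ^ (a + 1) * ((1 + s * ps r u) ^ (a + 1) - 1) / (a + 1) := by
      gcongr; linarith
    have e2 : u ^ (a + 1) * ((a + 1) * (s * ps r u)) / (a + 1) = s * (u * ps r u * u ^ a) := by
      rw [hua]; field_simp
    linarith
  have hW := W_pos a u
  have hua : 0 ≤ u ^ a := by positivity
  calc u ^ (d - 1) * (W a u * (1 + s * DD d a r u))
      ≤ u ^ (d - 1) * (W a u * ((1 + s * pp r u) * (1 + (d - 1) * (s * ps r u)) * (1 + s * (u * ps r u * u ^ a)))) := by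
        gcongr
        unfold DD
        have x0 : 0 ≤ (d - 1) * (s * ps r u) := by positivity
        have y0 : 0 ≤ s * (u * ps r u * u ^ a) := by positivity
        have := mul_nonneg hspp x0
        have := mul_nonneg hspp y0
        have := mul_nonneg x0 y0
        have := mul_nonneg (mul_nonneg hspp x0) y0
        linarith
    _ = (1 + s * pp r u) * (u ^ (d - 1) * (1 + (d - 1) * (s * ps r u)) * (W a u * (1 + s * (u * ps r u * u ^ a)))) := by ring
    _ ≤ _ := by
      have : 0 ≤ W a u * (1 + s * (u * ps r u * u ^ a)) := by positivity
      gcongr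

variable {d : ℕ}

local notation "𝔼" => EuclideanSpace ℝ (Fin d)

/-- Integration in polar coordinates. -/
lemma polar (hd : 1 ≤ d) {g : 𝔼 → ℝ≥0∞} (hg : Measurable g) :
    ∫⁻ x, g x = ∫⁻ σ, (∫⁻ u in Ioi (0 : ℝ), ENNReal.ofReal (u ^ (d - 1)) * g (u • (σ : 𝔼)))
      ∂(volume : Measure 𝔼).toSphere := by
  have : Nonempty (Fin d) := ⟨⟨0, by omega⟩⟩
  have hmp := (volume : Measure 𝔼).measurePreserving_homeomorphUnitSphereProd
  have hdim : Module.finrank ℝ 𝔼 = d := by simp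
  rw [hdim] at hmp
  have e1 : ∫⁻ x, g x = ∫⁻ x : ({(0 : 𝔼)}ᶜ : Set 𝔼), g (x : 𝔼) ∂((volume : Measure 𝔼).comap Subtype.val) := by
    rw [lintegral_subtype_comap (measurableSet_singleton _).compl, restrict_compl_singleton]
  have e2 := hmp.lintegral_comp_emb (Homeomorph.measurableEmbedding _)
    (fun p : sphere (0 : 𝔼) 1 × Ioi (0 : ℝ) => g ((homeomorphUnitSphereProd 𝔼).symm p : 𝔼))
  simp only [Homeomorph.symm_apply_apply] at e2
  have hm : Measurable fun p : sphere (0 : 𝔼) 1 × Ioi (0 : ℝ) => g ((homeomorphUnitSphereProd 𝔼).symm p : 𝔼) :=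
    hg.comp (measurable_subtype_coe.comp (homeomorphUnitSphereProd 𝔼).symm.continuous.measurable)
  rw [e1, e2, lintegral_prod _ hm.aemeasurable]
  congr 1; ext σ
  rw [Measure.volumeIoiPow, lintegral_withDensity_eq_lintegral_mul]
  · simp only [Pi.mul_apply, homeomorphUnitSphereProd_symm_apply_coe]
    exact lintegral_subtype_comap measurableSet_Ioi (fun u : ℝ => ENNReal.ofReal (u ^ (d - 1)) * g (u • (σ : 𝔼)))
  · fun_prop
  · exact hm.comp measurable_prodMk_left

end S12

namespace S12

variable {d : ℕ}

local notation "𝔼" => EuclideanSpace ℝ (Fin d)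

lemma ray (hd : 1 ≤ d) {a : ℝ} (ha : 0 < a) {A : Set 𝔼} {r s ε : ℝ} (hr : 0 < r) (hs : 0 < s) (hsε : s < ε)
    (hAm : MeasurableSet A) (σ : sphere (0 : 𝔼) 1) :
    (∫⁻ u in Ioi (0 : ℝ), ENNReal.ofReal (u ^ (d - 1)) *
      A.indicator (fun x => ENNReal.ofReal (W a ‖x‖ * (1 + s * DD d a r ‖x‖))) (u • (σ : 𝔼))) ≤
    ∫⁻ u in Ioi (0 : ℝ), ENNReal.ofReal (u ^ (d - 1)) *
      (thickening ε A).indicator (fun x => ENNReal.ofReal (W a ‖x‖)) (u • (σ : 𝔼)) := by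
  have hσ : ‖(σ : 𝔼)‖ = 1 := by simp
  have hn : ∀ u : ℝ, 0 < u → ‖u • (σ : 𝔼)‖ = u := fun u hu => by
    rw [norm_smul, hσ, mul_one, Real.norm_of_nonneg hu.le]
  obtain ⟨T, hT⟩ : ∃ T : ℝ → ℝ, T = fun u => u + s * ph r u := ⟨_, rfl⟩
  have hT' : ∀ u, HasDerivAt T (1 + s * pp r u) u := fun u => by
    rw [hT]; exact (hasDerivAt_id u).add ((ph_deriv r u).const_mul s)
  have hmono : StrictMono T := strictMono_of_deriv_pos fun u => by
    rw [(hT' u).deriv]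
    have := mul_nonneg hs.le (pp_nonneg hr u)
    linarith
  have hcm : Measurable fun u : ℝ => u • (σ : 𝔼) := by fun_prop
  set As : Set ℝ := Ioi 0 ∩ (fun u : ℝ => u • (σ : 𝔼)) ⁻¹' A with hAs
  have hAsm : MeasurableSet As := measurableSet_Ioi.inter (hcm hAm)
  set As' : Set ℝ := Ioi 0 ∩ (fun u : ℝ => u • (σ : 𝔼)) ⁻¹' (thickening ε A) with hAs'
  have hAsm' : MeasurableSet As' := measurableSet_Ioi.inter (hcm isOpen_thickening.measurableSet)
  have conv : ∀ (S : Set 𝔼) (k : ℝ → ℝ), MeasurableSet S → (∫⁻ u in Ioi (0 : ℝ), ENNReal.ofReal (u ^ (d - 1)) *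
      S.indicator (fun x => ENNReal.ofReal (k ‖x‖)) (u • (σ : 𝔼))) = 
      ∫⁻ u in Ioi 0 ∩ (fun u : ℝ => u • (σ : 𝔼)) ⁻¹' S, ENNReal.ofReal (u ^ (d - 1) * k u) := by
    intro S k hS
    rw [inter_comm, ← setLIntegral_indicator (hcm hS)]
    refine setLIntegral_congr_fun measurableSet_Ioi fun u hu => ?_
    have hu : 0 < u := hu
    by_cases h : u • (σ : 𝔼) ∈ S
    · simp only [indicator, mem_preimage, h, if_true, hn u hu]
      rw [ENNReal.ofReal_mul (by positivity)]
    · simp [indicator, h]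
  rw [conv A (fun u => W a u * (1 + s * DD d a r u)) hAm, conv _ (W a) isOpen_thickening.measurableSet, ← hAs, ← hAs']
  have hsub : T '' As ⊆ As' := by
    rintro _ ⟨u, ⟨hu, huA⟩, rfl⟩
    have hu : 0 < u := hu
    have hph0 : 0 ≤ ph r u := by rw [ph_ps hr hu.le]; exact mul_nonneg hu.le (ps_nonneg hr u)
    have hph1 := ph_le_one hr hu.le
    refine ⟨?_, ?_⟩
    · rw [hT]; exact add_pos_of_pos_of_nonneg hu (by positivity)
    · refine mem_thickening_iff.2 ⟨_, huA, ?_⟩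
      rw [dist_eq_norm, ← sub_smul, norm_smul, hσ, hT, mul_one, add_sub_cancel_left, Real.norm_of_nonneg (by positivity)]
      nlinarith
  calc ∫⁻ u in As, ENNReal.ofReal (u ^ (d - 1) * (W a u * (1 + s * DD d a r u)))
      ≤ ∫⁻ u in As, ENNReal.ofReal |1 + s * pp r u| * ENNReal.ofReal ((T u) ^ (d - 1) * W a (T u)) := by
        refine setLIntegral_mono' hAsm fun u hu => ?_
        rw [← ENNReal.ofReal_mul (abs_nonneg _), hT]
        exact ENNReal.ofReal_le_ofReal (pointwise hd ha hr hu.1 hs.le)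
    _ = ∫⁻ u in T '' As, ENNReal.ofReal (u ^ (d - 1) * W a u) :=
        (lintegral_image_eq_lintegral_abs_deriv_mul hAsm (fun u _ => (hT' u).hasDerivWithinAt) hmono.injective.injOn
          (fun u => ENNReal.ofReal (u ^ (d - 1) * W a u))).symm
    _ ≤ _ := lintegral_mono_set hsub

lemma radial_bound (hd : 1 ≤ d) {a : ℝ} (ha : 0 < a) {A : Set 𝔼} {r s ε L : ℝ} (hr : 0 < r) (hs : 0 < s) (hsε : s < ε)
    (hAm : MeasurableSet A) (hA : A ⊆ closedBall 0 L) {v : ℝ → ℝ} (hv : ∀ r : ℝ, v r = r ^ (a + 1) / (a + 1)) :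
    ENNReal.ofReal (s * ∫ x in A, W a ‖x‖ * DD d a r ‖x‖) + radMeasure d v A ≤ radMeasure d v (thickening ε A) := by
  have cW := W_cont ha
  have cD := DD_cont d ha hr
  have h := lintegral_mono (μ := (volume : Measure 𝔼).toSphere) fun σ => ray hd ha hr hs hsε hAm σ
  rw [← polar hd, ← polar hd, lintegral_indicator hAm, lintegral_indicator isOpen_thickening.measurableSet] at h
  rotate_left
  · exact Measurable.indicator (by fun_prop) isOpen_thickening.measurableSet
  · exact Measurable.indicator (by fun_prop) hAm
  have hv' : v = fun r => r ^ (a + 1) / (a + 1) := funext hv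
  have e1 : radMeasure d v (thickening ε A) = ∫⁻ x in thickening ε A, ENNReal.ofReal (W a ‖x‖) := by
    rw [radMeasure, withDensity_apply _ isOpen_thickening.measurableSet, hv']; rfl
  rw [e1]
  refine le_trans (le_of_eq ?_) h
  have i1 := intOn cW hA
  have i2 := intOn (k := fun u => s * (W a u * DD d a r u)) (by fun_prop) hA
  rw [rad_apply ha hv hA hAm, ← ENNReal.ofReal_add, ← integral_const_mul, add_comm, ← integral_add i1 i2,
    ofReal_integral_eq_lintegral_ofReal
      (f := fun x : 𝔼 => W a ‖x‖ + s * (W a ‖x‖ * DD d a r ‖x‖)) (i1.add i2)]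
  · refine lintegral_congr fun x => ?_
    congr 1; ring
  · refine Eventually.of_forall fun x => ?_
    have := W_pos a ‖x‖
    have := DD_nonneg (a := a) hd hr (norm_nonneg x)
    simp only [Pi.zero_apply]; positivity
  · refine mul_nonneg hs.le (integral_nonneg fun x => ?_)
    have := W_pos a ‖x‖
    have := DD_nonneg (a := a) hd hr (norm_nonneg x)
    simp only [Pi.zero_apply]; positivity
  · exact integral_nonneg fun x => (W_pos a ‖x‖).le

lemma surf_DD (hd : 1 ≤ d) {a : ℝ} (ha : 0 < a) {A : Set 𝔼} {r L : ℝ} (hr : 0 < r) 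
    (hAm : MeasurableSet A) (hA : A ⊆ closedBall 0 L) {v : ℝ → ℝ} (hv : ∀ r : ℝ, v r = r ^ (a + 1) / (a + 1)) :
    ENNReal.ofReal (∫ x in A, W a ‖x‖ * DD d a r ‖x‖) ≤ surfaceMeasure (radMeasure d v) A := by
  set F := ∫ x in A, W a ‖x‖ * DD d a r ‖x‖ with hF
  refine surf_ge (δ := fun ε => ε * F) ?_ ?_ ?_
  · have : Tendsto (fun ε : ℝ => ε * F) (nhds 0) (nhds (0 * F)) := tendsto_id.mul_const F
    rw [zero_mul] at this
    exact this.mono_left nhdsWithin_le_nhds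
  · rw [rad_apply ha hv hA hAm]; exact ENNReal.ofReal_ne_top
  · filter_upwards [Ioo_mem_nhdsGT (zero_lt_one' ℝ)] with ε hε
    have := radial_bound hd ha hr (s := ε * (1 - ε)) (ε := ε) (mul_pos hε.1 (by linarith [hε.2])) (by nlinarith [hε.1]) hAm hA hv
    refine le_trans (le_of_eq ?_) this
    rw [← hF]; congr 2; ring

lemma ball_DD (hd : 2 ≤ d) {a : ℝ} (ha : 0 < a) {r : ℝ} (hr : 0 < r) :
    ∫ x in closedBall (0 : 𝔼) r, W a ‖x‖ * DD d a r ‖x‖ = d * volume.real (ball (0 : 𝔼) 1) * r ^ (d - 1) * W a r := by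
  have : Nonempty (Fin d) := ⟨⟨0, by omega⟩⟩
  have cW := W_cont ha
  have cD := DD_cont d ha hr
  have h0 := radial (d := d) (by omega) (k := fun u => W a u * DD d a r u) le_rfl hr.le
  have e0 : ∫ x in closedBall (0 : 𝔼) r \ closedBall 0 0, W a ‖x‖ * DD d a r ‖x‖ = ∫ x in closedBall (0 : 𝔼) r, W a ‖x‖ * DD d a r ‖x‖ := by
    refine setIntegral_congr_set (sdiff_null_ae_eq_self ?_)
    simp
  rw [← e0, h0]
  have e1 := intervalIntegral.integral_eq_sub_of_hasDerivAt (a := 0) (b := r)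
    (f := fun u => d * volume.real (ball (0 : 𝔼) 1) * (u ^ (d - 1) * (W a u * ph r u)))
    (f' := fun u => W a u * DD d a r u * (d * volume.real (ball (0 : 𝔼) 1) * u ^ (d - 1))) (fun u hu => ?_)
    (by apply Continuous.intervalIntegrable; fun_prop)
  · rw [e1, ph_zero, ph_out hr le_rfl]; ring
  · rw [uIcc_of_le hr.le] at hu
    have := ((hasDerivAt_pow (d - 1) u).mul ((W_hasDeriv ha u).mul (ph_deriv r u))).const_mul (d * volume.real (ball (0 : 𝔼) 1))
    refine this.congr_deriv ?_
    have hp : u ^ (d - 1) = u ^ (d - 1 - 1) * u := by rw [← pow_succ]; congr 1; omega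
    simp only [Pi.mul_apply]
    rw [ph_ps hr hu.1, hp, DD, Nat.cast_sub (by omega), Nat.cast_one]
    ring

theorem caseI (hd : 2 ≤ d) {a : ℝ} (ha : 0 < a) (ha2 : a ≤ 2) {A : Set 𝔼} {r L : ℝ} (hr : 0 < r) (hR : (d : ℝ) + 2 ≤ a * r ^ (a + 1))
    (hA : A ⊆ closedBall 0 L) (hrL : r ≤ L)
    (hAm : MeasurableSet A) (hm : ∫ x in A, W a ‖x‖ = ∫ x in closedBall (0 : 𝔼) r, W a ‖x‖) :
    d * volume.real (ball (0 : 𝔼) 1) * r ^ (d - 1) * W a r ≤ ∫ x in A, W a ‖x‖ * DD d a r ‖x‖ := by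
  rw [← ball_DD hd ha hr]
  have cW := W_cont ha
  have cD := DD_cont d ha hr
  have hBm : MeasurableSet (closedBall (0 : 𝔼) r) := measurableSet_closedBall
  have hBL : closedBall (0 : 𝔼) r ⊆ closedBall 0 L := closedBall_subset_closedBall hrL
  set H : ℝ := (d - 1) / r + r ^ a with hH
  have hs := setInt_diff (f := fun x : 𝔼 => W a ‖x‖ * DD d a r ‖x‖ - H * W a ‖x‖) hAm hBm
    (intOn (k := fun u => W a u * DD d a r u - H * W a u) (by fun_prop) (union_subset hA hBL))
  have h1 : 0 ≤ ∫ x in A \ closedBall 0 r, (W a ‖x‖ * DD d a r ‖x‖ - H * W a ‖x‖) :=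
    setIntegral_nonneg (hAm.diff hBm) fun x hx => by
      have h := hx.2
      simp at h
      have := DD_out (by omega : 1 ≤ d) ha hr hR h.le
      have := W_pos a ‖x‖
      nlinarith
  have h2 : ∫ x in closedBall 0 r \ A, (W a ‖x‖ * DD d a r ‖x‖ - H * W a ‖x‖) ≤ 0 :=
    setIntegral_nonpos (hBm.diff hAm) fun x hx => by
      have h := hx.1
      simp at h
      have := DD_in ha ha2 hr hR (norm_nonneg x) h
      have := W_pos a ‖x‖
      nlinarith
  have sp : ∀ S : Set 𝔼, S ⊆ closedBall 0 L → ∫ x in S, (W a ‖x‖ * DD d a r ‖x‖ - H * W a ‖x‖) =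
     (∫ x in S, W a ‖x‖ * DD d a r ‖x‖) - H * ∫ x in S, W a ‖x‖ := fun S hS => by
    rw [integral_sub (intOn (k := fun u => W a u * DD d a r u) (by fun_prop) hS) (intOn (k := fun u => H * W a u) (by fun_prop) hS),
      integral_const_mul]
  rw [sp A hA, sp _ hBL, hm] at hs
  linarith

end S12

theorem stmt_12 (d : ℕ) (hd : 2 ≤ d) (a : ℝ) (ha : 0 < a)
    (v : ℝ → ℝ) (hv : ∀ r : ℝ, v r = r ^ (a + 1) / (a + 1))
    (r0 : ℝ) (hr0 : r0 = ((d + 2) / a) ^ (1 / (a + 1)))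
    (r : ℝ) (hr : r0 ≤ r)
    (A : Set (EuclideanSpace ℝ (Fin d)))
    (hAbd : Bornology.IsBounded A) (hAopen : IsOpen A) (hAsm : HasSmoothBoundary A)
    (hvol : radMeasure d v A =
      radMeasure d v (Metric.closedBall (0 : EuclideanSpace ℝ (Fin d)) r)) :
    surfaceMeasure (radMeasure d v) (Metric.closedBall (0 : EuclideanSpace ℝ (Fin d)) r) ≤
      surfaceMeasure (radMeasure d v) A := by
  have hr0p : 0 < r0 := by rw [hr0]; positivity
  have hrp : 0 < r := hr0p.trans_le hr
  have hR : (d : ℝ) + 2 ≤ a * r ^ (a + 1) := by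
    have h1 : r0 ^ (a + 1) = (d + 2) / a := by
      rw [hr0, ← Real.rpow_mul (by positivity), one_div_mul_cancel (by positivity), Real.rpow_one]
    have h2 : r0 ^ (a + 1) ≤ r ^ (a + 1) := by gcongr
    rw [h1, div_le_iff₀ ha] at h2
    linarith
  obtain ⟨L0, hL0⟩ := hAbd.subset_closedBall (0 : EuclideanSpace ℝ (Fin d))
  obtain ⟨L, hL1, hLr, hLA⟩ : ∃ L : ℝ, 1 < L ∧ r ≤ L ∧ A ⊆ closedBall 0 (L - 1) := by
    refine ⟨max (max r 2) (L0 + 1), ?_, ?_, ?_⟩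
    · exact lt_of_lt_of_le (by norm_num) ((le_max_right r 2).trans (le_max_left _ _))
    · exact (le_max_left r 2).trans (le_max_left _ _)
    · refine hL0.trans (closedBall_subset_closedBall ?_)
      have := le_max_right (max r 2) (L0 + 1)
      linarith
  have hAL : A ⊆ closedBall 0 L := hLA.trans (closedBall_subset_closedBall (by linarith))
  have hAm := hAopen.measurableSet
  have hm : ∫ x in A, S12.W a ‖x‖ = ∫ x in closedBall (0 : EuclideanSpace ℝ (Fin d)) r, S12.W a ‖x‖ := by
    rw [S12.rad_apply ha hv hAL hAm, S12.rad_apply ha hv subset_rfl measurableSet_closedBall] at hvol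
    exact (ENNReal.ofReal_eq_ofReal_iff (integral_nonneg fun x => (S12.W_pos a ‖x‖).le)
      (integral_nonneg fun x => (S12.W_pos a ‖x‖).le)).1 hvol
  refine (S12.ball_surf ha hv (by omega) hrp).trans ?_
  rcases le_total a 2 with h | h
  · exact (ENNReal.ofReal_le_ofReal (S12.caseI hd ha h hrp hR hAL hLr hAm hm)).trans
      (S12.surf_DD (by omega) ha hrp hAm hAL hv)
  · exact (ENNReal.ofReal_le_ofReal (S12.caseII (by omega) h hrp hR hLr hAL hAm hm)).trans
      (S12.surf_FF ha hv (by omega) hrp hL1 hLA hAm)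
end

section
/- Let d ≥ 2 and let v : [0,∞) → ℝ be a convex increasing function, and let μ be the measure on ℝ^d with density e^{v(|x|)} with respect to Lebesgue measure. Then for every bounded open set A ⊂ ℝ^d with smooth boundary and every r > 0 with μ(A) = μ(B_r), one has μ⁺(∂A) ≥ (1/√(1+π²)) · μ⁺(∂B_r), where B_r = {x : |x| ≤ r} is the closed ball of radius r about the origin. -/
open MeasureTheory Metric Filter Set
open scoped ENNReal

section Helpers

open scoped Pointwise

theorem bm_compact {K L : Set ℝ} (hK : IsCompact K) (hL : IsCompact L) (hK0 : K.Nonempty)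
    (hL0 : L.Nonempty) {C : Set ℝ} (hC : ∀ x ∈ K, ∀ y ∈ L, x + y ∈ C) :
    volume K + volume L ≤ volume C := by
  obtain ⟨k, hk, hkm⟩ := hK.exists_isGreatest hK0
  obtain ⟨l, hl, hlm⟩ := hL.exists_isLeast hL0
  have h1 : volume ((fun x => l + x) '' K) = volume K := by
    rw [Set.image_add_left]; simp
  have h2 : volume ((fun x => k + x) '' L) = volume L := by
    rw [Set.image_add_left]; simp
  have hd : AEDisjoint volume ((fun x => l + x) '' K) ((fun x => k + x) '' L) := by
    refine measure_mono_null (t := {k + l}) ?_ (by simp)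
    rintro z ⟨⟨x, hx, rfl⟩, ⟨y, hy, hxy⟩⟩
    have a1 := hkm hx
    have a2 := hlm hy
    simp only at hxy
    simp only [mem_singleton_iff]
    linarith
  rw [← h1, ← h2, ← measure_union₀ _ hd]
  · apply measure_mono
    rintro z (⟨x, hx, rfl⟩ | ⟨y, hy, rfl⟩)
    · simpa [add_comm] using hC x hx l hl
    · exact hC k hk y hy
  · exact (hL.image (by fun_prop)).measurableSet.nullMeasurableSet

theorem exists_compact_gt {S : Set ℝ} (hS : MeasurableSet S) (hS0 : S.Nonempty)
    {a : ℝ≥0∞} (ha : a < volume S ∨ a = 0) : ∃ K ⊆ S, IsCompact K ∧ K.Nonempty ∧ a ≤ volume K := by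
  rcases ha with ha | ha
  · obtain ⟨K, hKS, hK, hKa⟩ := hS.exists_lt_isCompact ha
    refine ⟨K, hKS, hK, ?_, hKa.le⟩
    by_contra h
    rw [Set.not_nonempty_iff_eq_empty] at h
    simp [h] at hKa
  · obtain ⟨x, hx⟩ := hS0
    exact ⟨{x}, by simpa using hx, isCompact_singleton, by simp, by simp [ha]⟩

theorem bm_real {S T : Set ℝ} (hS : MeasurableSet S) (hT : MeasurableSet T) (hS0 : S.Nonempty)
    (hT0 : T.Nonempty) {C : Set ℝ} (hC : ∀ x ∈ S, ∀ y ∈ T, x + y ∈ C) :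
    volume S + volume T ≤ volume C := by
  have key : ∀ a b : ℝ≥0∞, (a < volume S ∨ a = 0) → (b < volume T ∨ b = 0) → a + b ≤ volume C := by
    intro a b ha hb
    obtain ⟨K, hKS, hK, hK0, haK⟩ := exists_compact_gt hS hS0 ha
    obtain ⟨L, hLS, hL, hL0, haL⟩ := exists_compact_gt hT hT0 hb
    exact (add_le_add haK haL).trans
      (bm_compact hK hL hK0 hL0 fun x hx y hy => hC x (hKS hx) y (hLS hy))
  have k2 : ∀ a, (a < volume S ∨ a = 0) → a + volume T ≤ volume C := by
    intro a ha
    rcases eq_or_ne (volume T) 0 with h | h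
    · rw [h]; exact key a 0 ha (Or.inr rfl)
    · refine ENNReal.le_of_forall_nnreal_lt fun c hc => ?_
      by_contra hcc
      push Not at hcc
      have : ∃ b < volume T, (c:ℝ≥0∞) < a + b := by
        have hcont : ContinuousAt (fun b : ℝ≥0∞ => a + b) (volume T) := by fun_prop
        have := (hcont.eventually (lt_mem_nhds hc)).filter_mono
          (nhdsWithin_le_nhds (s := Iio (volume T)))
        have hne : (nhdsWithin (volume T) (Iio (volume T))).NeBot :=
          nhdsLT_neBot_of_exists_lt ⟨0, pos_iff_ne_zero.2 h⟩
        obtain ⟨b, hb1, hb2⟩ := (this.and self_mem_nhdsWithin).exists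
        exact ⟨b, hb2, hb1⟩
      obtain ⟨b, hb, hb2⟩ := this
      exact absurd (key a b ha (Or.inl hb)) (not_le.2 (hcc.trans hb2))
  rcases eq_or_ne (volume S) 0 with h | h
  · rw [h]; exact k2 0 (Or.inr rfl)
  · refine ENNReal.le_of_forall_nnreal_lt fun c hc => ?_
    by_contra hcc
    push Not at hcc
    have : ∃ b < volume S, (c:ℝ≥0∞) < b + volume T := by
      have hcont : ContinuousAt (fun b : ℝ≥0∞ => b + volume T) (volume S) := by fun_prop
      have := (hcont.eventually (lt_mem_nhds hc)).filter_mono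
        (nhdsWithin_le_nhds (s := Iio (volume S)))
      have hne : (nhdsWithin (volume S) (Iio (volume S))).NeBot :=
        nhdsLT_neBot_of_exists_lt ⟨0, pos_iff_ne_zero.2 h⟩
      obtain ⟨b, hb1, hb2⟩ := (this.and self_mem_nhdsWithin).exists
      exact ⟨b, hb2, hb1⟩
    obtain ⟨b, hb, hb2⟩ := this
    exact absurd (k2 b (Or.inl hb)) (not_le.2 (hcc.trans hb2))

theorem bm_real_conv {S T : Set ℝ} (hS : MeasurableSet S) (hT : MeasurableSet T)
    (hS0 : S.Nonempty) (hT0 : T.Nonempty) {l : ℝ} (hl0 : 0 < l) (hl1 : l < 1) {C : Set ℝ}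
    (hC : ∀ x ∈ S, ∀ y ∈ T, (1 - l) * x + l * y ∈ C) :
    ENNReal.ofReal (1 - l) * volume S + ENNReal.ofReal l * volume T ≤ volume C := by
  have e : ∀ c : ℝ, 0 < c → ∀ S : Set ℝ, volume ((fun x => c * x) '' S)
      = ENNReal.ofReal c * volume S := by
    intro c hc S
    have := Measure.addHaar_smul (volume : Measure ℝ) c S
    rw [← Set.image_smul] at this
    simpa only [Module.finrank_self, pow_one, abs_of_pos hc, smul_eq_mul] using this
  have m : ∀ c : ℝ, 0 < c → ∀ S : Set ℝ, MeasurableSet S → MeasurableSet ((fun x => c * x) '' S) := by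
    intro c hc S hS
    exact (measurableEmbedding_mulLeft₀ hc.ne').measurableSet_image.2 hS
  have h1l : 0 < 1 - l := by linarith
  rw [← e _ h1l, ← e _ hl0]
  refine bm_real (m _ h1l _ hS) (m _ hl0 _ hT) (hS0.image _) (hT0.image _) ?_
  rintro _ ⟨x, hx, rfl⟩ _ ⟨y, hy, rfl⟩
  exact hC x hx y hy

theorem pl_norm {f g h : ℝ → ℝ} (hf : Measurable f) (hg : Measurable g) (hh : Measurable h)
    (f0 : ∀ x, 0 ≤ f x) (g0 : ∀ x, 0 ≤ g x) (h0 : ∀ x, 0 ≤ h x)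
    (f1 : ∀ x, f x ≤ 1) (g1 : ∀ x, g x ≤ 1)
    (fs : ∀ t > 0, t < 1 → ∃ x, t < f x) (gs : ∀ t > 0, t < 1 → ∃ x, t < g x)
    {l : ℝ} (hl0 : 0 < l) (hl1 : l < 1)
    (H : ∀ t > 0, t < 1 → ∀ x y, t < f x → t < g y → t < h ((1 - l) * x + l * y)) :
    ENNReal.ofReal (1 - l) * (∫⁻ x, ENNReal.ofReal (f x)) +
      ENNReal.ofReal l * (∫⁻ x, ENNReal.ofReal (g x)) ≤ ∫⁻ x, ENNReal.ofReal (h x) := by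
  rw [lintegral_eq_lintegral_meas_lt _ (ae_of_all _ f0) hf.aemeasurable,
    lintegral_eq_lintegral_meas_lt _ (ae_of_all _ g0) hg.aemeasurable,
    lintegral_eq_lintegral_meas_lt _ (ae_of_all _ h0) hh.aemeasurable]
  have anti : ∀ f : ℝ → ℝ, Measurable fun t => volume {a | t < f a} := by
    intro f
    apply Antitone.measurable
    intro s t hst
    apply measure_mono
    intro a (ha : t < f a)
    exact lt_of_le_of_lt hst ha
  rw [← lintegral_const_mul _ (anti f), ← lintegral_const_mul _ (anti g),
    ← lintegral_add_left ((anti f).const_mul _)]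
  apply setLIntegral_mono (anti h)
  intro t (ht : 0 < t)
  rcases lt_or_ge t 1 with h1 | h1
  · exact bm_real_conv (measurableSet_lt measurable_const hf) (measurableSet_lt measurable_const hg)
      (fs t ht h1) (gs t ht h1) hl0 hl1 (fun x hx y hy => H t ht h1 x y hx hy)
  · have e1 : {a | t < f a} = ∅ := by
      ext a; simp; linarith [f1 a]
    have e2 : {a | t < g a} = ∅ := by
      ext a; simp; linarith [g1 a]
    simp [e1, e2]

theorem amgm_ennreal {l : ℝ} (hl0 : 0 < l) (hl1 : l < 1) (a b : ℝ≥0∞) :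
    a ^ (1 - l) * b ^ l ≤ ENNReal.ofReal (1 - l) * a + ENNReal.ofReal l * b := by
  have h1l : 0 < 1 - l := by linarith
  by_cases ha : a = ∞
  · subst ha
    rw [ENNReal.mul_top (by simpa using h1l)]
    simp
  by_cases hb : b = ∞
  · subst hb
    rw [ENNReal.mul_top (by simpa using hl0)]
    simp
  lift a to NNReal using ha
  lift b to NNReal using hb
  rw [← ENNReal.coe_rpow_of_nonneg _ h1l.le, ← ENNReal.coe_rpow_of_nonneg _ hl0.le]
  have := NNReal.geom_mean_le_arith_mean2_weighted (1-l).toNNReal l.toNNReal a b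
    (by rw [← Real.toNNReal_add h1l.le hl0.le]; simp)
  rw [Real.coe_toNNReal _ h1l.le, Real.coe_toNNReal _ hl0.le] at this
  unfold ENNReal.ofReal
  exact_mod_cast this

theorem pl_bdd {f g h : ℝ → ℝ≥0∞} (hf : Measurable f) (hg : Measurable g) (hh : Measurable h)
    {l : ℝ} (hl0 : 0 < l) (hl1 : l < 1) {c : ℝ≥0∞} (hc : c ≠ ∞) (fc : ∀ x, f x ≤ c)
    (gc : ∀ x, g x ≤ c)
    (H : ∀ x y, f x ^ (1 - l) * g y ^ l ≤ h ((1 - l) * x + l * y)) :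
    (∫⁻ x, f x) ^ (1 - l) * (∫⁻ x, g x) ^ l ≤ ∫⁻ x, h x := by
  have h1l : 0 < 1 - l := by linarith
  set a := ⨆ x, f x with ha
  set b := ⨆ x, g x with hb
  have hfa : ∀ x, f x ≤ a := fun x => le_iSup f x
  have hgb : ∀ x, g x ≤ b := fun x => le_iSup g x
  have a_top : a ≠ ∞ := ((iSup_le fc).trans_lt hc.lt_top).ne
  have b_top : b ≠ ∞ := ((iSup_le gc).trans_lt hc.lt_top).ne
  rcases eq_or_ne a 0 with a0 | a0
  · have : ∀ x, f x = 0 := fun x => le_antisymm ((hfa x).trans a0.le) bot_le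
    simp [this, h1l]
  rcases eq_or_ne b 0 with b0 | b0
  · have : ∀ x, g x = 0 := fun x => le_antisymm ((hgb x).trans b0.le) bot_le
    simp [this, hl0]
  set k := a ^ (1 - l) * b ^ l with hk
  have k0 : k ≠ 0 := by
    rw [hk]
    refine mul_ne_zero ?_ ?_
    · simp [a0, a_top, ENNReal.rpow_eq_zero_iff]
    · simp [b0, b_top, ENNReal.rpow_eq_zero_iff]
  have k_top : k ≠ ∞ := ENNReal.mul_ne_top (ENNReal.rpow_ne_top_of_nonneg h1l.le a_top)
      (ENNReal.rpow_ne_top_of_nonneg hl0.le b_top)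
  have div1 : ∀ (f : ℝ → ℝ≥0∞) (a : ℝ≥0∞), a ≠ 0 → a ≠ ∞ → (∀ x, f x ≤ a) → ∀ x, f x / a ≤ 1 := by
    intro f a a0 at1 hfa x
    exact ENNReal.div_le_of_le_mul (by simpa using hfa x)
  have sup1 : ∀ (f : ℝ → ℝ≥0∞) (a : ℝ≥0∞), a ≠ 0 → a ≠ ∞ → (∀ x, f x ≤ a) → a = ⨆ x, f x →
      ∀ t > 0, t < (1:ℝ) → ∃ x, t < (f x / a).toReal := by
    intro f a a0 at1 hfa hs t ht0 ht
    have : ENNReal.ofReal t * a < a := by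
      conv_rhs => rw [← one_mul a]
      exact ENNReal.mul_lt_mul_left a0 at1 (by simpa using ht)
    rw [hs, lt_iSup_iff, ← hs] at this
    obtain ⟨x, hx⟩ := this
    refine ⟨x, ?_⟩
    have h2 : ENNReal.ofReal t < f x / a := (ENNReal.lt_div_iff_mul_lt (Or.inl a0) (Or.inl at1)).2 hx
    exact (ENNReal.ofReal_lt_iff_lt_toReal ht0.le (ne_top_of_le_ne_top (by simp) (div1 f a a0 at1 hfa x))).1 h2
  have main := pl_norm (f := fun x => (f x / a).toReal) (g := fun x => (g x / b).toReal)
    (h := fun x => (min (h x / k) 1).toReal)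
    (hf.div_const a).ennreal_toReal (hg.div_const b).ennreal_toReal
    ((hh.div_const k).min measurable_const).ennreal_toReal
    (fun _ => ENNReal.toReal_nonneg) (fun _ => ENNReal.toReal_nonneg)
    (fun _ => ENNReal.toReal_nonneg)
    (fun x => ENNReal.toReal_le_of_le_ofReal zero_le_one (by simpa using div1 f a a0 a_top hfa x))
    (fun x => ENNReal.toReal_le_of_le_ofReal zero_le_one (by simpa using div1 g b b0 b_top hgb x))
    (sup1 f a a0 a_top hfa ha) (sup1 g b b0 b_top hgb hb) hl0 hl1 ?_
  · have ef : ∀ x, ENNReal.ofReal (f x / a).toReal = f x / a := fun x =>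
      ENNReal.ofReal_toReal (ne_top_of_le_ne_top (by simp) (div1 f a a0 a_top hfa x))
    have eg : ∀ x, ENNReal.ofReal (g x / b).toReal = g x / b := fun x =>
      ENNReal.ofReal_toReal (ne_top_of_le_ne_top (by simp) (div1 g b b0 b_top hgb x))
    have eh : ∀ x, ENNReal.ofReal (min (h x / k) 1).toReal ≤ h x / k := fun x =>
      ENNReal.ofReal_toReal_le.trans (min_le_left _ _)
    simp only [ef, eg] at main
    have m2 := ((amgm_ennreal hl0 hl1 _ _).trans main).trans (lintegral_mono eh)
    simp only [div_eq_mul_inv] at m2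
    rw [lintegral_mul_const _ hf, lintegral_mul_const _ hg, lintegral_mul_const _ hh,
      ENNReal.mul_rpow_of_nonneg _ _ h1l.le, ENNReal.mul_rpow_of_nonneg _ _ hl0.le,
      mul_mul_mul_comm, ENNReal.inv_rpow, ENNReal.inv_rpow,
      ← ENNReal.mul_inv (by
        right; exact ENNReal.rpow_ne_top_of_nonneg hl0.le b_top)
        (by left; exact ENNReal.rpow_ne_top_of_nonneg h1l.le a_top), ← hk] at m2
    exact (ENNReal.mul_le_mul_iff_left (ENNReal.inv_ne_zero.2 k_top) (ENNReal.inv_ne_top.2 k0)).1 m2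
  · intro t ht0 ht1 x y hx hy
    have h1 : ENNReal.ofReal t < f x / a :=
      (ENNReal.ofReal_lt_iff_lt_toReal ht0.le (ne_top_of_le_ne_top (by simp) (div1 f a a0 a_top hfa x))).2 hx
    have h2 : ENNReal.ofReal t < g y / b :=
      (ENNReal.ofReal_lt_iff_lt_toReal ht0.le (ne_top_of_le_ne_top (by simp) (div1 g b b0 b_top hgb y))).2 hy
    refine (ENNReal.ofReal_lt_iff_lt_toReal ht0.le (ne_top_of_le_ne_top (by simp) (min_le_right _ _))).1 ?_
    refine lt_min ?_ (by simpa using ht1)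
    have h3 : ENNReal.ofReal t < (f x / a) ^ (1 - l) * (g y / b) ^ l := by
      have : ENNReal.ofReal t = ENNReal.ofReal t ^ (1 - l) * ENNReal.ofReal t ^ l := by
        rw [← ENNReal.rpow_add _ _ (by simpa using ht0) (by simp)]
        simp
      rw [this]
      exact ENNReal.mul_lt_mul (ENNReal.rpow_lt_rpow h1 h1l) (ENNReal.rpow_lt_rpow h2 hl0)
    refine h3.trans_le ?_
    rw [ENNReal.div_rpow_of_nonneg _ _ h1l.le, ENNReal.div_rpow_of_nonneg _ _ hl0.le]
    simp only [div_eq_mul_inv]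
    rw [mul_mul_mul_comm, ← ENNReal.mul_inv (by
        right; exact ENNReal.rpow_ne_top_of_nonneg hl0.le b_top)
        (by left; exact ENNReal.rpow_ne_top_of_nonneg h1l.le a_top), ← hk]
    gcongr
    exact H x y

theorem pl_one {f g h : ℝ → ℝ≥0∞} (hf : Measurable f) (hg : Measurable g) (hh : Measurable h)
    {l : ℝ} (hl0 : 0 < l) (hl1 : l < 1)
    (H : ∀ x y, f x ^ (1 - l) * g y ^ l ≤ h ((1 - l) * x + l * y)) :
    (∫⁻ x, f x) ^ (1 - l) * (∫⁻ x, g x) ^ l ≤ ∫⁻ x, h x := by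
  have h1l : 0 < 1 - l := by linarith
  rcases eq_or_ne (∫⁻ x, f x) 0 with a0 | a0
  · simp [a0, h1l]
  rcases eq_or_ne (∫⁻ x, g x) 0 with b0 | b0
  · simp [b0, hl0]
  have T : ∀ f : ℝ → ℝ≥0∞, Measurable f →
      Tendsto (fun n : ℕ => ∫⁻ x, min (f x) n) atTop (nhds (∫⁻ x, f x)) := by
    intro f hf
    refine lintegral_tendsto_of_tendsto_of_monotone
      (fun n => (hf.min measurable_const).aemeasurable) (ae_of_all _ ?_) (ae_of_all _ ?_)
    · intro x m n hmn
      exact min_le_min_left _ (by exact_mod_cast hmn)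
    · intro x
      have := (tendsto_const_nhds (x := f x)).min ENNReal.tendsto_nat_nhds_top
      simpa using this
  have T1 := (ENNReal.continuous_rpow_const (y := 1 - l)).continuousAt.tendsto.comp (T f hf)
  have T2 := (ENNReal.continuous_rpow_const (y := l)).continuousAt.tendsto.comp (T g hg)
  have T3 := ENNReal.Tendsto.mul T1 (Or.inl ?_) T2 (Or.inl ?_)
  · refine le_of_tendsto' T3 fun n => ?_
    refine pl_bdd (hf.min measurable_const) (hg.min measurable_const) hh hl0 hl1
      (c := n) (by simp) (fun _ => min_le_right _ _) (fun _ => min_le_right _ _) ?_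
    intro x y
    refine le_trans ?_ (H x y)
    gcongr
    · exact min_le_left _ _
    · exact min_le_left _ _
  · simp [ENNReal.rpow_eq_zero_iff, a0, h1l.le, not_lt.2]
  · simp [ENNReal.rpow_eq_zero_iff, b0, hl0.le, not_lt.2]

theorem pl_pi (n : ℕ) {l : ℝ} (hl0 : 0 < l) (hl1 : l < 1) : ∀ {f g h : (Fin n → ℝ) → ℝ≥0∞}
    (_ : Measurable f) (_ : Measurable g) (_ : Measurable h)
    (_ : ∀ x y, f x ^ (1 - l) * g y ^ l ≤ h ((1 - l) • x + l • y)),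
    (∫⁻ x, f x) ^ (1 - l) * (∫⁻ x, g x) ^ l ≤ ∫⁻ x, h x := by
  induction n with
  | zero =>
    intro f g h hf hg hh H
    rw [Measure.volume_pi_eq_dirac 0, lintegral_dirac, lintegral_dirac, lintegral_dirac]
    simpa using H 0 0
  | succ n ih =>
    intro f g h hf hg hh H
    have ee : ∀ (s : ℝ) (y : Fin n → ℝ),
        (MeasurableEquiv.piFinSuccAbove (fun _ : Fin (n+1) => ℝ) 0).symm (s, y)
          = (Fin.cons s y : Fin (n+1) → ℝ) := by
      intro s y
      simp [MeasurableEquiv.piFinSuccAbove, Fin.insertNthEquiv]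
    have key : ∀ f : (Fin (n+1) → ℝ) → ℝ≥0∞, Measurable f →
        ∫⁻ x, f x = ∫⁻ s : ℝ, ∫⁻ y : Fin n → ℝ, f (Fin.cons s y) := by
      intro f hf
      have mp := (volume_preserving_piFinSuccAbove (fun _ : Fin (n+1) => ℝ) 0).symm
      rw [← mp.lintegral_comp_emb (MeasurableEquiv.measurableEmbedding _)]
      rw [Measure.volume_eq_prod, lintegral_prod]
      · simp only [ee]
      · exact (hf.comp (MeasurableEquiv.measurable _)).aemeasurable
    have meas : ∀ f : (Fin (n+1) → ℝ) → ℝ≥0∞, Measurable f →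
        Measurable fun p : ℝ × (Fin n → ℝ) => f (Fin.cons p.1 p.2) := by
      intro f hf
      have := hf.comp (MeasurableEquiv.piFinSuccAbove (fun _ : Fin (n+1) => ℝ) 0).symm.measurable
      have e2 : (fun p : ℝ × (Fin n → ℝ) => f (Fin.cons p.1 p.2)) =
          f ∘ (MeasurableEquiv.piFinSuccAbove (fun _ : Fin (n+1) => ℝ) 0).symm := by
        ext p
        exact (congrArg f (ee p.1 p.2)).symm
      rw [e2]
      exact this
    rw [key f hf, key g hg, key h hh]
    refine pl_one (meas f hf).lintegral_prod_right' (meas g hg).lintegral_prod_right'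
      (meas h hh).lintegral_prod_right' hl0 hl1 ?_
    intro s t
    refine ih ((meas f hf).comp measurable_prodMk_left) ((meas g hg).comp measurable_prodMk_left)
      ((meas h hh).comp measurable_prodMk_left) ?_
    intro x y
    refine (H _ _).trans (le_of_eq ?_)
    congr 1
    ext i
    refine Fin.cases ?_ (fun j => ?_) i <;> simp

/-- Weak Brunn-Minkowski inequality for a set and a ball. -/
theorem bm_ball {d : ℕ} {E C : Set (EuclideanSpace ℝ (Fin d))} (hE : MeasurableSet E)
    (hC : MeasurableSet C) {r ε : ℝ} (hr : 0 < r) (hε : 0 < ε)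
    (hEr : volume E ≤ volume (ball (0 : EuclideanSpace ℝ (Fin d)) r))
    (H : ∀ x ∈ E, ∀ y, ‖y‖ < ε → x + y ∈ C) :
    ENNReal.ofReal ((1 + ε / r) ^ d) * volume E ≤ volume C := by
  set l := ε / (r + ε) with hl
  have hl0 : 0 < l := by positivity
  have hl1 : l < 1 := by rw [hl, div_lt_one (by positivity)]; linarith
  have h1l : 0 < 1 - l := by linarith
  have h1l' : 1 - l = r / (r + ε) := by rw [hl]; field_simp; ring
  set c := 1 + ε / r with hc
  have hc0 : 0 < c := by positivity
  have hc1 : (1 - l) * c = 1 := by rw [h1l', hc]; field_simp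
  have hc2 : l * c * r = ε := by rw [hl, hc]; field_simp
  have vol : ∀ S : Set (EuclideanSpace ℝ (Fin d)),
      volume (c • S) = ENNReal.ofReal (c ^ d) * volume S := by
    intro S
    rw [Measure.addHaar_smul_of_nonneg _ hc0.le]; simp
  have mp := PiLp.volume_preserving_toLp (Fin d)
  have memb : MeasurableEmbedding (@WithLp.toLp 2 (Fin d → ℝ)) :=
    (MeasurableEquiv.toLp 2 (Fin d → ℝ)).measurableEmbedding
  have lin : ∀ S : Set (EuclideanSpace ℝ (Fin d)), MeasurableSet S →
      ∫⁻ x : Fin d → ℝ, S.indicator (fun _ => (1:ℝ≥0∞)) (WithLp.toLp 2 x) = volume S := by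
    intro S hS
    rw [mp.lintegral_comp_emb memb (S.indicator (fun _ => (1:ℝ≥0∞)))]
    simp [lintegral_indicator hS]
  have hcE : MeasurableSet (c • E) := hE.const_smul₀ c
  have hcB : MeasurableSet (c • ball (0 : EuclideanSpace ℝ (Fin d)) r) :=
    measurableSet_ball.const_smul₀ c
  have mi : ∀ S : Set (EuclideanSpace ℝ (Fin d)), MeasurableSet S →
      Measurable fun x : Fin d → ℝ => S.indicator (fun _ => (1:ℝ≥0∞)) (WithLp.toLp 2 x) := by
    intro S hS
    exact (measurable_const.indicator hS).comp memb.measurable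
  have P := pl_pi d hl0 hl1 (mi _ hcE) (mi _ hcB) (mi _ hC) ?_
  · rw [lin _ hcE, lin _ hcB, lin _ hC, vol, vol] at P
    refine le_trans ?_ P
    rw [ENNReal.mul_rpow_of_nonneg _ _ h1l.le, ENNReal.mul_rpow_of_nonneg _ _ hl0.le,
      mul_mul_mul_comm]
    have e : ∀ x : ℝ≥0∞, x ^ (1 - l) * x ^ l = x := by
      intro x
      rw [← ENNReal.rpow_add_of_nonneg _ _ h1l.le hl0.le]; simp
    rw [e]
    gcongr
    conv_lhs => rw [← e (volume E)]
    gcongr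
  · intro x y
    by_cases hx : WithLp.toLp 2 x ∈ c • E
    · by_cases hy : WithLp.toLp 2 y ∈ c • ball (0 : EuclideanSpace ℝ (Fin d)) r
      · have : WithLp.toLp 2 ((1 - l) • x + l • y) ∈ C := by
          obtain ⟨x', hx', hxx⟩ := hx
          obtain ⟨y', hy', hyy⟩ := hy
          simp only at hxx hyy
          rw [WithLp.toLp_add, WithLp.toLp_smul, WithLp.toLp_smul, ← hxx, ← hyy, smul_smul, hc1,
            one_smul]
          refine H x' hx' _ ?_
          rw [smul_smul, norm_smul, Real.norm_of_nonneg (by positivity), ← hc2]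
          have : ‖y'‖ < r := by simpa using hy'
          gcongr
        rw [Set.indicator_of_mem this]
        simp [hx, hy]
      · simp [hy, hl0]
    · simp [hx, h1l]

theorem layer_le {X : Type*} [MeasurableSpace X] (μ : Measure X) {f h : X → ℝ}
    (hf : Measurable f) (hh : Measurable h) (f0 : ∀ x, 0 ≤ f x) (h0 : ∀ x, 0 ≤ h x) (a b : ℝ≥0∞)
    (H : ∀ t > 0, a * μ {x | t < f x} ≤ b * μ {x | t < h x}) :
    a * ∫⁻ x, ENNReal.ofReal (f x) ∂μ ≤ b * ∫⁻ x, ENNReal.ofReal (h x) ∂μ := by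
  rw [lintegral_eq_lintegral_meas_lt _ (ae_of_all _ f0) hf.aemeasurable,
    lintegral_eq_lintegral_meas_lt _ (ae_of_all _ h0) hh.aemeasurable]
  have anti : ∀ f : X → ℝ, Measurable fun t => μ {a | t < f a} := by
    intro f
    apply Antitone.measurable
    intro s t hst
    apply measure_mono
    intro a (ha : t < f a)
    exact lt_of_le_of_lt hst ha
  rw [← lintegral_const_mul _ (anti f), ← lintegral_const_mul _ (anti h)]
  exact setLIntegral_mono ((anti h).const_mul _) (fun t ht => H t ht)

/-- Layer-cake comparison for set integrals of positive functions. -/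
theorem layer_set_le {X : Type*} [MeasurableSpace X] (μ : Measure X) {f h : X → ℝ}
    (hf : Measurable f) (hh : Measurable h) (f0 : ∀ x, 0 ≤ f x) (h0 : ∀ x, 0 ≤ h x) (a b : ℝ≥0∞)
    {A B : Set X} (hA : MeasurableSet A) (hB : MeasurableSet B)
    (H : ∀ t > 0, a * μ {x | x ∈ A ∧ t < f x} ≤ b * μ {x | x ∈ B ∧ t < h x}) :
    a * ∫⁻ x in A, ENNReal.ofReal (f x) ∂μ ≤ b * ∫⁻ x in B, ENNReal.ofReal (h x) ∂μ := by
  have e : ∀ (f : X → ℝ) (A : Set X), MeasurableSet A → ∫⁻ x in A, ENNReal.ofReal (f x) ∂μ =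
      ∫⁻ x, ENNReal.ofReal (A.indicator f x) ∂μ := by
    intro f A hA
    rw [← lintegral_indicator hA]
    congr 1; ext x
    by_cases hx : x ∈ A <;> simp [hx]
  have s : ∀ (f : X → ℝ) (A : Set X) (t : ℝ), 0 < t →
      {x | t < A.indicator f x} = {x | x ∈ A ∧ t < f x} := by
    intro f A t ht
    ext x
    by_cases hx : x ∈ A <;> simp [hx, ht.le]
  rw [e f A hA, e h B hB]
  refine layer_le μ (hf.indicator hA) (hh.indicator hB)
    (fun x => Set.indicator_nonneg (fun x _ => f0 x) x)
    (fun x => Set.indicator_nonneg (fun x _ => h0 x) x) a b ?_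
  intro t ht
  rw [s f A t ht, s h B t ht]
  exact H t ht

theorem rearr {X : Type*} [MeasurableSpace X] (μ : Measure X) {g : X → ℝ≥0∞}
    {A B : Set X} (hA : MeasurableSet A) (hB : MeasurableSet B)
    (hAB : μ A = μ B) (hfin : μ A ≠ ∞) (G : ℝ≥0∞) (h1 : ∀ x ∈ A \ B, G ≤ g x)
    (h2 : ∀ x ∈ B \ A, g x ≤ G) : ∫⁻ x in B, g x ∂μ ≤ ∫⁻ x in A, g x ∂μ := by
  have hd : μ (B \ A) = μ (A \ B) := by
    have e1 := measure_inter_add_sdiff (μ := μ) A hB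
    have e2 := measure_inter_add_sdiff (μ := μ) B hA
    rw [inter_comm B A, ← hAB, ← e1] at e2
    exact (ENNReal.add_right_inj (measure_ne_top_of_subset inter_subset_left hfin)).1 e2
  rw [← lintegral_inter_add_sdiff g A hB, ← lintegral_inter_add_sdiff g B hA, inter_comm B A]
  refine add_le_add le_rfl ?_
  calc ∫⁻ x in B \ A, g x ∂μ ≤ ∫⁻ x in B \ A, G ∂μ :=
        setLIntegral_mono measurable_const h2
    _ = G * μ (A \ B) := by rw [setLIntegral_const, hd]
    _ = ∫⁻ x in A \ B, G ∂μ := by rw [setLIntegral_const]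
    _ ≤ ∫⁻ x in A \ B, g x ∂μ := setLIntegral_mono' (hA.diff hB) h1

theorem weight_meas {d : ℕ} {V : ℝ → ℝ} (hV : Monotone V) (c : ℝ) :
    Measurable fun x : EuclideanSpace ℝ (Fin d) => Real.exp (V (‖x‖ + c)) :=
  Real.measurable_exp.comp (hV.measurable.comp (measurable_norm.add_const c))

theorem bm_weight {d : ℕ} {V : ℝ → ℝ} (hV : Monotone V) {A : Set (EuclideanSpace ℝ (Fin d))}
    (hA : IsOpen A) {r ε : ℝ} (hr : 0 < r) (hε : 0 < ε)
    (hEr : volume A ≤ volume (ball (0 : EuclideanSpace ℝ (Fin d)) r)) :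
    ENNReal.ofReal ((1 + ε / r) ^ d) * ∫⁻ x in A, ENNReal.ofReal (Real.exp (V (‖x‖ + -ε))) ≤
      ∫⁻ x in thickening ε A, ENNReal.ofReal (Real.exp (V (‖x‖ + 0))) := by
  have := layer_set_le (volume : Measure (EuclideanSpace ℝ (Fin d))) (weight_meas hV (-ε))
    (weight_meas hV 0) (fun x => (Real.exp_pos _).le) (fun x => (Real.exp_pos _).le)
    (ENNReal.ofReal ((1 + ε / r) ^ d)) 1 hA.measurableSet
    (isOpen_thickening (δ := ε) (E := A)).measurableSet ?_
  · simpa using this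
  intro t ht
  rw [one_mul]
  refine bm_ball (hA.measurableSet.inter (measurableSet_lt measurable_const (weight_meas hV _)))
    ((isOpen_thickening (δ := ε) (E := A)).measurableSet.inter
      (measurableSet_lt measurable_const (weight_meas hV _))) hr hε
    ((measure_mono fun x hx => hx.1).trans hEr) ?_
  rintro x ⟨hx, hxt⟩ y hy
  refine ⟨mem_thickening_iff.2 ⟨x, hx, by simpa using hy⟩, ?_⟩
  refine lt_of_lt_of_le (show t < Real.exp (V (‖x‖ + -ε)) from hxt) ?_
  apply Real.exp_le_exp.2
  apply hV
  have := norm_sub_norm_le x (x + y)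
  have e : x - (x + y) = -y := by abel
  rw [e, norm_neg] at this
  linarith

theorem antilip_vol {d : ℕ} {T : EuclideanSpace ℝ (Fin d) → EuclideanSpace ℝ (Fin d)}
    (hT : AntilipschitzWith 1 T) (S : Set (EuclideanSpace ℝ (Fin d))) :
    volume S ≤ volume (T '' S) := by
  have h := hT.le_hausdorffMeasure_image
    (d := (Module.finrank ℝ (EuclideanSpace ℝ (Fin d)) : ℝ)) (by positivity) S
  have e := Measure.isAddLeftInvariant_eq_smul
    (volume : Measure (EuclideanSpace ℝ (Fin d)))
    (Measure.hausdorffMeasure (Module.finrank ℝ (EuclideanSpace ℝ (Fin d)) : ℝ))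
  rw [e]
  simp only [Measure.smul_apply]
  simp only [ENNReal.coe_one, ENNReal.one_rpow, one_mul] at h
  gcongr

theorem radial_antilip {E : Type*} [NormedAddCommGroup E] [InnerProductSpace ℝ E] {ε : ℝ}
    (hε : 0 < ε) : AntilipschitzWith 1 fun x : E => x + ε • (‖x‖⁻¹ • x) := by
  apply AntilipschitzWith.of_le_mul_dist
  intro x y
  rw [dist_eq_norm, dist_eq_norm]
  simp only [NNReal.coe_one, one_mul]
  set u := ‖x‖⁻¹ • x with hu
  set w := ‖y‖⁻¹ • y with hw
  have nu : ∀ x : E, ‖‖x‖⁻¹ • x‖ ≤ 1 := by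
    intro x
    rw [norm_smul, norm_inv, norm_norm]
    exact inv_mul_le_one
  have iu : ∀ x : E, inner ℝ x (‖x‖⁻¹ • x) = ‖x‖ := by
    intro x
    rw [inner_smul_right, real_inner_self_eq_norm_sq]
    by_cases h : ‖x‖ = 0
    · simp [h]
    · field_simp
  have key : 0 ≤ inner ℝ (x - y) (u - w) := by
    rw [inner_sub_left, inner_sub_right, inner_sub_right, hu, iu x, hw, iu y]
    have h1 := real_inner_le_norm x (‖y‖⁻¹ • y)
    have h2 := real_inner_le_norm y (‖x‖⁻¹ • x)
    have h3 := mul_le_mul_of_nonneg_left (nu y) (norm_nonneg x)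
    have h4 := mul_le_mul_of_nonneg_left (nu x) (norm_nonneg y)
    linarith
  have e : x + ε • u - (y + ε • w) = (x - y) + ε • (u - w) := by
    rw [smul_sub]; abel
  rw [e]
  apply le_of_sq_le_sq _ (norm_nonneg _)
  rw [norm_add_sq_real, inner_smul_right]
  nlinarith [mul_nonneg hε.le key, sq_nonneg ‖ε • (u - w)‖]

theorem radial_weight {d : ℕ} (hd : 2 ≤ d) {V : ℝ → ℝ} (hV : Monotone V)
    {A : Set (EuclideanSpace ℝ (Fin d))} (hA : IsOpen A) {ε : ℝ} (hε : 0 < ε) :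
    ∫⁻ x in A, ENNReal.ofReal (Real.exp (V (‖x‖ + ε))) ≤
      ∫⁻ x in thickening ε A, ENNReal.ofReal (Real.exp (V (‖x‖ + 0))) := by
  have := layer_set_le (volume : Measure (EuclideanSpace ℝ (Fin d))) (weight_meas hV ε)
    (weight_meas hV 0) (fun x => (Real.exp_pos _).le) (fun x => (Real.exp_pos _).le)
    1 1 hA.measurableSet
    (isOpen_thickening (δ := ε) (E := A)).measurableSet ?_
  · simpa using this
  intro t ht
  rw [one_mul, one_mul]
  have hne : Nonempty (Fin d) := ⟨⟨0, by omega⟩⟩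
  have h0 : volume ({0} : Set (EuclideanSpace ℝ (Fin d))) = 0 := measure_singleton _
  rw [← measure_sdiff_null h0]
  refine (antilip_vol (radial_antilip hε) _).trans (measure_mono ?_)
  rintro _ ⟨x, ⟨⟨hx, hxt⟩, hx0⟩, rfl⟩
  have hx0 : x ≠ 0 := by simpa using hx0
  have hn : 0 < ‖x‖ := norm_pos_iff.2 hx0
  have hu : ‖‖x‖⁻¹ • x‖ = 1 := by
    rw [norm_smul, norm_inv, norm_norm, inv_mul_cancel₀ hn.ne']
  refine ⟨?_, ?_⟩
  · obtain ⟨δ, hδ, hball⟩ := Metric.isOpen_iff.1 hA x hx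
    set s := min (δ / 2) (ε / 2) with hs
    have hs0 : 0 < s := by positivity
    have hs1 : s < δ := (min_le_left _ _).trans_lt (by linarith)
    have hs2 : s < ε := (min_le_right _ _).trans_lt (by linarith)
    refine mem_thickening_iff.2 ⟨x + s • (‖x‖⁻¹ • x), hball ?_, ?_⟩
    · rw [mem_ball, dist_eq_norm, add_sub_cancel_left, norm_smul, hu, mul_one,
        Real.norm_of_nonneg hs0.le]
      exact hs1
    · rw [dist_eq_norm, add_sub_add_left_eq_sub, ← sub_smul, norm_smul, hu, mul_one,
        Real.norm_of_nonneg (by linarith)]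
      linarith
  · have e : ‖x + ε • (‖x‖⁻¹ • x)‖ = ‖x‖ + ε := by
      have : x + ε • (‖x‖⁻¹ • x) = (1 + ε * ‖x‖⁻¹) • x := by
        rw [add_smul, one_smul, smul_smul]
      rw [this, norm_smul, Real.norm_of_nonneg (by positivity)]
      field_simp
    simp only at hxt ⊢
    rw [e, add_zero]
    exact hxt

theorem scale_weight {d : ℕ} {V : ℝ → ℝ} (hV : Monotone V) {r ε : ℝ} (hr : 0 < r) (hε : 0 < ε) :
    ∫⁻ x in ball (0 : EuclideanSpace ℝ (Fin d)) (r + ε), ENNReal.ofReal (Real.exp (V (‖x‖ + 0))) ≤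
    ENNReal.ofReal ((1 + ε / r) ^ d) *
      ∫⁻ x in closedBall (0 : EuclideanSpace ℝ (Fin d)) r,
        ENNReal.ofReal (Real.exp (V (‖x‖ + ε))) := by
  have := layer_set_le (volume : Measure (EuclideanSpace ℝ (Fin d))) (weight_meas hV 0)
    (weight_meas hV ε) (fun x => (Real.exp_pos _).le) (fun x => (Real.exp_pos _).le)
    1 (ENNReal.ofReal ((1 + ε / r) ^ d))
    (measurableSet_ball (x := (0 : EuclideanSpace ℝ (Fin d))) (ε := r + ε))
    (measurableSet_closedBall (x := (0 : EuclideanSpace ℝ (Fin d))) (ε := r)) ?_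
  · simpa using this
  intro t ht
  set c := 1 + ε / r with hc
  have hc0 : 0 < c := by positivity
  have hcr : c * r = r + ε := by rw [hc]; field_simp
  have vol : ∀ S : Set (EuclideanSpace ℝ (Fin d)),
      volume (c • S) = ENNReal.ofReal (c ^ d) * volume S := by
    intro S
    rw [Measure.addHaar_smul_of_nonneg _ hc0.le]; simp
  rw [← vol, one_mul]
  apply measure_mono
  rintro x ⟨hx, hxt⟩
  have hxr : ‖x‖ < r + ε := by simpa using hx
  have hy : ‖c⁻¹ • x‖ = c⁻¹ * ‖x‖ := by
    rw [norm_smul, Real.norm_of_nonneg (by positivity)]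
  have hyx : ‖x‖ = c * ‖c⁻¹ • x‖ := by rw [hy]; field_simp
  have hyr : ‖c⁻¹ • x‖ ≤ r := by
    have : c * ‖c⁻¹ • x‖ ≤ c * r := by rw [← hyx, hcr]; exact hxr.le
    exact le_of_mul_le_mul_left this hc0
  refine ⟨c⁻¹ • x, ⟨by simpa using hyr, lt_of_lt_of_le hxt ?_⟩, ?_⟩
  · apply Real.exp_le_exp.2
    apply hV
    have : ε / r * ‖c⁻¹ • x‖ ≤ ε := by
      calc ε / r * ‖c⁻¹ • x‖ ≤ ε / r * r := by gcongr
        _ = ε := by field_simp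
    rw [hyx]
    generalize ‖c⁻¹ • x‖ = z at *
    rw [hc]
    nlinarith
  · simp only
    rw [smul_smul, mul_inv_cancel₀ hc0.ne', one_smul]

theorem arith_final {K M N J J' L : ℝ≥0∞} {q : ℝ} (hq : 1 ≤ q) (hM : M ≠ ∞) (hN : N ≠ ∞)
    (hMN : M ≤ N) (hJ : J ≤ N) (hJ' : J' ≤ J) (hL : ENNReal.ofReal q * L ≤ N)
    (h2 : 2 * M ≤ L + J) (hK : K ≤ ENNReal.ofReal q * J') :
    K - M ≤ ENNReal.ofReal (2 * q + 1) * (N - M) := by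
  have q0 : 0 < q := by linarith
  have hJt : J ≠ ∞ := ne_top_of_le_ne_top hN hJ
  have hJt' : J' ≠ ∞ := ne_top_of_le_ne_top hJt hJ'
  have hKt : K ≠ ∞ := ne_top_of_le_ne_top (ENNReal.mul_ne_top (by simp) hJt') hK
  have hLt : L ≠ ∞ := by
    rintro rfl
    rw [ENNReal.mul_top (by simpa using q0)] at hL
    exact hN (top_le_iff.1 hL)
  lift K to NNReal using hKt
  lift M to NNReal using hM
  lift N to NNReal using hN
  lift J to NNReal using hJt
  lift J' to NNReal using hJt'
  lift L to NNReal using hLt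
  lift q to NNReal using q0.le
  have e : ENNReal.ofReal (2 * (q:ℝ) + 1) = ((2 * q + 1 : NNReal) : ℝ≥0∞) := by
    rw [← ENNReal.ofReal_coe_nnreal]; simp
  rw [ENNReal.ofReal_coe_nnreal] at hL hK
  rw [e]
  norm_cast at *
  rw [tsub_le_iff_right]
  rw [← NNReal.coe_le_coe] at *
  push_cast [NNReal.coe_sub hMN] at *
  nlinarith

theorem main_ineq {d : ℕ} (hd : 2 ≤ d) {V : ℝ → ℝ} (hV : Monotone V)
    (hinc : ∀ ε > 0, ∀ s t, 0 ≤ s → s ≤ t → V (s + ε) - V s ≤ V (t + ε) - V t)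
    (hmid : ∀ ε > 0, ∀ s, 0 ≤ s → 2 * V s ≤ V (s + -ε) + V (s + ε))
    {A : Set (EuclideanSpace ℝ (Fin d))} (hA : IsOpen A) {r ε : ℝ} (hr : 0 < r) (hε : 0 < ε)
    (μ : Measure (EuclideanSpace ℝ (Fin d)))
    (hμ : μ = volume.withDensity fun x => ENNReal.ofReal (Real.exp (V (‖x‖ + 0))))
    (hvol : μ A = μ (closedBall 0 r)) :
    μ (thickening ε (closedBall 0 r)) - μ (closedBall 0 r) ≤
      ENNReal.ofReal (2 * (1 + ε / r) ^ d + 1) * (μ (thickening ε A) - μ A) := by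
  have ap : ∀ S, MeasurableSet S → μ S = ∫⁻ x in S, ENNReal.ofReal (Real.exp (V (‖x‖ + 0))) := by
    intro S hS
    rw [hμ, withDensity_apply _ hS]
  have wm := fun c => (weight_meas (d := d) hV c).ennreal_ofReal
  have hBm : MeasurableSet (closedBall (0 : EuclideanSpace ℝ (Fin d)) r) := measurableSet_closedBall
  have hBfin : μ (closedBall 0 r) ≠ ∞ := by
    rw [ap _ hBm]
    refine ne_top_of_le_ne_top ?_ (setLIntegral_mono (measurable_const
      (a := ENNReal.ofReal (Real.exp (V (r + 0))))) (g := fun _ => _) ?_)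
    · rw [setLIntegral_const]
      exact ENNReal.mul_ne_top (by simp) measure_closedBall_lt_top.ne
    · intro x hx
      have : ‖x‖ ≤ r := by simpa using hx
      exact ENNReal.ofReal_le_ofReal (Real.exp_le_exp.2 (hV (by linarith)))
  have conv : ∀ (a : ℝ → ℝ), Measurable a → ∀ S, MeasurableSet S →
      ∫⁻ x in S, ENNReal.ofReal (Real.exp (a ‖x‖ - V (‖x‖ + 0))) ∂μ =
        ∫⁻ x in S, ENNReal.ofReal (Real.exp (a ‖x‖)) := by
    intro a ha S hS
    have hm : Measurable fun x : EuclideanSpace ℝ (Fin d) =>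
        ENNReal.ofReal (Real.exp (a ‖x‖ - V (‖x‖ + 0))) :=
      (Real.measurable_exp.comp ((ha.comp measurable_norm).sub
        (hV.measurable.comp (measurable_norm.add_const 0)))).ennreal_ofReal
    rw [hμ, setLIntegral_withDensity_eq_setLIntegral_mul _ (wm 0) hm hS]
    congr 1
    ext x
    simp only [Pi.mul_apply]
    rw [← ENNReal.ofReal_mul (Real.exp_pos _).le, ← Real.exp_add]
    congr 2
    ring
  have hAfin : μ A ≠ ∞ := hvol ▸ hBfin
  have hJ' : ∫⁻ x in closedBall (0 : EuclideanSpace ℝ (Fin d)) r, ENNReal.ofReal (Real.exp (V (‖x‖ + ε))) ≤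
      ∫⁻ x in A, ENNReal.ofReal (Real.exp (V (‖x‖ + ε))) := by
    have ma : Measurable fun s => V (s + ε) := hV.measurable.comp (measurable_id.add_const ε)
    rw [← conv _ ma _ hBm, ← conv _ ma _ hA.measurableSet]
    refine rearr μ hA.measurableSet hBm hvol hAfin
      (ENNReal.ofReal (Real.exp (V (r + ε) - V r))) ?_ ?_
    · rintro x ⟨-, hx⟩
      have hx : r < ‖x‖ := by simpa using hx
      refine ENNReal.ofReal_le_ofReal (Real.exp_le_exp.2 ?_)
      simpa using hinc ε hε r ‖x‖ hr.le hx.le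
    · rintro x ⟨hx, -⟩
      have hx : ‖x‖ ≤ r := by simpa using hx
      refine ENNReal.ofReal_le_ofReal (Real.exp_le_exp.2 ?_)
      simpa using hinc ε hε ‖x‖ r (norm_nonneg _) hx
  have hne : Nonempty (Fin d) := ⟨⟨0, by omega⟩⟩
  have hAr : volume A ≤ volume (ball (0 : EuclideanSpace ℝ (Fin d)) r) := by
    have h := rearr μ (g := fun x => ENNReal.ofReal (Real.exp ((fun _ => (0:ℝ)) ‖x‖ - V (‖x‖ + 0))))
      hBm hA.measurableSet hvol.symm hBfin
      (ENNReal.ofReal (Real.exp (0 - V r))) ?_ ?_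
    · rw [conv _ measurable_const _ hBm, conv _ measurable_const _ hA.measurableSet] at h
      simp only [Real.exp_zero, ENNReal.ofReal_one, setLIntegral_one] at h
      rwa [Measure.addHaar_closedBall_eq_addHaar_ball] at h
    · rintro x ⟨hx, -⟩
      have hx : ‖x‖ ≤ r := by simpa using hx
      refine ENNReal.ofReal_le_ofReal (Real.exp_le_exp.2 ?_)
      simpa using hV hx
    · rintro x ⟨-, hx⟩
      have hx : r < ‖x‖ := by simpa using hx
      refine ENNReal.ofReal_le_ofReal (Real.exp_le_exp.2 ?_)
      simpa using hV hx.le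
  have hq : 1 ≤ (1 + ε / r) ^ d := one_le_pow₀ (by linarith [div_pos hε hr])
  have hMN : μ A ≤ μ (thickening ε A) := measure_mono (self_subset_thickening hε A)
  by_cases hN : μ (thickening ε A) = ∞
  · rw [hN, ENNReal.top_sub hAfin, ENNReal.mul_top (by simp; positivity)]
    exact le_top
  rw [← hvol]
  have om : MeasurableSet (thickening ε A) := isOpen_thickening.measurableSet
  refine arith_final hq hAfin hN hMN (J := ∫⁻ x in A, ENNReal.ofReal (Real.exp (V (‖x‖ + ε))))
    (L := ∫⁻ x in A, ENNReal.ofReal (Real.exp (V (‖x‖ + -ε)))) ?_ hJ' ?_ ?_ ?_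
  · rw [ap _ om]; exact radial_weight hd hV hA hε
  · rw [ap _ om]; exact bm_weight hV hA hr hε hAr
  · rw [ap _ hA.measurableSet, ← lintegral_const_mul _ (wm 0), ← lintegral_add_left (wm (-ε))]
    refine lintegral_mono fun x => ?_
    have h2 : (2 : ℝ≥0∞) = ENNReal.ofReal 2 := by simp
    have hm := hmid ε hε ‖x‖ (norm_nonneg _)
    generalize ‖x‖ = z at hm ⊢
    rw [h2, ← ENNReal.ofReal_mul (by norm_num),
      ← ENNReal.ofReal_add (Real.exp_pos _).le (Real.exp_pos _).le]
    refine ENNReal.ofReal_le_ofReal ?_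
    rw [add_zero]
    set p := V (z + -ε)
    set q := V (z + ε)
    have e1 : Real.exp (V z) ≤ Real.exp (p / 2) * Real.exp (q / 2) := by
      rw [← Real.exp_add]; exact Real.exp_le_exp.2 (by linarith)
    have e2 : Real.exp p = Real.exp (p / 2) ^ 2 := by
      rw [← Real.exp_nat_mul]; congr 1; push_cast; ring
    have e3 : Real.exp q = Real.exp (q / 2) ^ 2 := by
      rw [← Real.exp_nat_mul]; congr 1; push_cast; ring
    rw [e2, e3]
    nlinarith [sq_nonneg (Real.exp (p / 2) - Real.exp (q / 2))]
  · rw [thickening_closedBall hε hr.le, ap _ measurableSet_ball, add_comm ε r]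
    exact scale_weight hV hr hε

end Helpers

theorem stmt_13 (d : ℕ) (hd : 2 ≤ d) (v : ℝ → ℝ)
    (hconv : ConvexOn ℝ (Set.Ici 0) v) (hmono : MonotoneOn v (Set.Ici 0))
    (A : Set (EuclideanSpace ℝ (Fin d)))
    (hAbd : Bornology.IsBounded A) (hAopen : IsOpen A) (hAsm : HasSmoothBoundary A)
    (r : ℝ) (hr : 0 < r)
    (hvol : radMeasure d v A =
      radMeasure d v (Metric.closedBall (0 : EuclideanSpace ℝ (Fin d)) r)) :
    ENNReal.ofReal (1 / Real.sqrt (1 + Real.pi ^ 2)) *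
        surfaceMeasure (radMeasure d v) (Metric.closedBall (0 : EuclideanSpace ℝ (Fin d)) r) ≤
      surfaceMeasure (radMeasure d v) A := by
  set V : ℝ → ℝ := fun s => v (max s 0) with hVdef
  have hVv : ∀ s, 0 ≤ s → V s = v s := fun s hs => by simp only [hVdef, max_eq_left hs]
  have hV : Monotone V := fun s t hst =>
    hmono (mem_Ici.2 (le_max_right _ _)) (mem_Ici.2 (le_max_right _ _)) (max_le_max_right 0 hst)
  have hc : ∀ x y a b : ℝ, 0 ≤ x → 0 ≤ y → 0 ≤ a → 0 ≤ b → a + b = 1 →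
      v (a * x + b * y) ≤ a * v x + b * v y := by
    intro x y a b hx hy ha hb hab
    simpa only [smul_eq_mul] using hconv.2 (mem_Ici.2 hx) (mem_Ici.2 hy) ha hb hab
  have hinc : ∀ ε > 0, ∀ s t, 0 ≤ s → s ≤ t → V (s + ε) - V s ≤ V (t + ε) - V t := by
    intro ε hε s t hs hst
    rw [hVv s hs, hVv t (hs.trans hst), hVv (s + ε) (by linarith), hVv (t + ε) (by linarith)]
    have hL : 0 < t + ε - s := by linarith
    have hx : ε / (t + ε - s) ≤ 1 := by rw [div_le_one hL]; linarith
    have hx0 : 0 ≤ ε / (t + ε - s) := by positivity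
    have hLe : ε / (t + ε - s) * (t + ε - s) = ε := by field_simp
    set x := ε / (t + ε - s)
    have c1 := hc s (t + ε) (1 - x) x hs (by linarith) (by linarith) hx0 (by ring)
    have c2 := hc s (t + ε) x (1 - x) hs (by linarith) hx0 (by linarith) (by ring)
    have e1 : (1 - x) * s + x * (t + ε) = s + ε := by linear_combination hLe
    have e2 : x * s + (1 - x) * (t + ε) = t := by linear_combination -hLe
    rw [e1] at c1
    rw [e2] at c2
    linarith
  have hmid : ∀ ε > 0, ∀ s, 0 ≤ s → 2 * V s ≤ V (s + -ε) + V (s + ε) := by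
    intro ε hε s hs
    rw [hVv s hs, hVv (s + ε) (by linarith)]
    simp only [hVdef]
    have p0 : 0 ≤ max (s + -ε) 0 := le_max_right _ _
    have p1 : max (s + -ε) 0 ≤ s := max_le (by linarith) hs
    have p2 : s + -ε ≤ max (s + -ε) 0 := le_max_left _ _
    set p := max (s + -ε) 0
    have c1 := hc p (2 * s - p) (1 / 2) (1 / 2) p0 (by linarith) (by norm_num) (by norm_num)
      (by norm_num)
    have e1 : 1 / 2 * p + 1 / 2 * (2 * s - p) = s := by ring
    rw [e1] at c1
    have c2 := hmono (mem_Ici.2 (show (0:ℝ) ≤ 2 * s - p by linarith))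
      (mem_Ici.2 (show (0:ℝ) ≤ s + ε by linarith))
      (by linarith)
    linarith
  have hμ : radMeasure d v = volume.withDensity
      fun x => ENNReal.ofReal (Real.exp (V (‖x‖ + 0))) := by
    unfold radMeasure
    congr 1
    ext x
    rw [add_zero, hVv _ (norm_nonneg x)]
  have hsq0 : 0 < Real.sqrt (1 + Real.pi ^ 2) := by positivity
  have hsq : 3 < Real.sqrt (1 + Real.pi ^ 2) := by
    apply Real.lt_sqrt_of_sq_lt
    nlinarith [Real.pi_gt_three]
  unfold surfaceMeasure
  rw [← ENNReal.liminf_const_mul_of_ne_top ENNReal.ofReal_ne_top]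
  refine Filter.liminf_le_liminf ?_
  have hev : ∀ᶠ ε in nhdsWithin (0:ℝ) (Ioi 0),
      2 * (1 + ε / r) ^ d + 1 < Real.sqrt (1 + Real.pi ^ 2) := by
    have hcont : Continuous fun ε : ℝ => 2 * (1 + ε / r) ^ d + 1 := by fun_prop
    have := hcont.tendsto 0
    refine (this.eventually_lt_const ?_).filter_mono nhdsWithin_le_nhds
    simp only [zero_div, add_zero, one_pow]
    linarith
  filter_upwards [hev, self_mem_nhdsWithin] with ε h1 hε
  have hm := main_ineq hd hV hinc hmid hAopen hr hε _ hμ hvol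
  rw [← mul_div_assoc]
  gcongr
  calc _ ≤ ENNReal.ofReal (1 / Real.sqrt (1 + Real.pi ^ 2)) *
        (ENNReal.ofReal (2 * (1 + ε / r) ^ d + 1) *
          (radMeasure d v (thickening ε A) - radMeasure d v A)) := by gcongr
    _ = ENNReal.ofReal (1 / Real.sqrt (1 + Real.pi ^ 2) * (2 * (1 + ε / r) ^ d + 1)) *
          (radMeasure d v (thickening ε A) - radMeasure d v A) := by
        rw [← mul_assoc, ← ENNReal.ofReal_mul (by positivity)]
    _ ≤ 1 * (radMeasure d v (thickening ε A) - radMeasure d v A) := by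
        gcongr
        rw [ENNReal.ofReal_le_one, one_div, inv_mul_le_one₀ hsq0]
        exact h1.le
    _ = _ := one_mul _
end
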